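/- Let n ≥ 1, let b ≥ 1 be an integer, α ∈ (1/2, 1], and let p(·) ∈ P^log([0,∞)) with b+1 < p⁻ ≤ p⁺ < ∞. Let q ∈ (1,∞) be a constant with q > nb/(2α−1) such that for a.e. t ≥ 0: b/p(t) + 1/(2α) + nb/(2αq) < 1 ≤ (b+1)/p(t) + 1/(2α) + nb/(2αq). Let q̄(·) ∈ P^emb_q(ℝ^n), let u₀ ∈ L^{q̄(·)}(ℝ^n), and let f : (0,∞)×ℝ^n → ℝ be measurable with ∫_0^∞ ‖f(s,·)‖_{L^{q̄(·)}(ℝ^n)} ds < ∞. Then there exist T ∈ (0,∞), R > 0, and a measurable u : [0,T]×ℝ^n → ℝ with ‖u‖_{E_T} ≤ R which is a mild solution (with γ = 1) of ∂_t u + (−Δ)^α u = 1⃗·∇(|u|^b u) + f with data u₀ on [0,T], and u is the unique mild solution on [0,T] satisfying ‖u‖_{E_T} ≤ R. -/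

import Mathlib

open MeasureTheory Set
open scoped ENNReal FourierTransform

noncomputable section

/-- Euclidean space `ℝ^n`. -/
abbrev Rn (n : ℕ) := EuclideanSpace ℝ (Fin n)

/-- Luxemburg norm of an `ℝ≥0∞`-valued function for a variable exponent `p`. -/
def luxNorm {Ω : Type*} [MeasurableSpace Ω] (μ : Measure Ω) (p : Ω → ℝ) (f : Ω → ℝ≥0∞) : ℝ≥0∞ :=
  sInf {lam : ℝ≥0∞ | 0 < lam ∧ ∫⁻ x, (f x / lam) ^ (p x) ∂μ ≤ 1}

/-- Luxemburg norm `‖f‖_{L^{p(·)}}` of a real-valued function. -/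
def luxNormR {Ω : Type*} [MeasurableSpace Ω] (μ : Measure Ω) (p : Ω → ℝ) (f : Ω → ℝ) : ℝ≥0∞ :=
  luxNorm μ p (fun x => ENNReal.ofReal |f x|)

/-- `p(·) ∈ P^log(Ω)`: measurable, with values in `[1,∞)` on `Ω`, locally log-Hölder
continuous on `Ω`, and satisfying the log-Hölder decay condition on `Ω`. -/
def IsPLog {E : Type*} [NormedAddCommGroup E] [MeasurableSpace E] (Ω : Set E) (p : E → ℝ) : Prop :=
  Measurable p ∧ (∀ x ∈ Ω, 1 ≤ p x) ∧
  ∃ C₁ > (0:ℝ), ∃ C₂ > (0:ℝ), ∃ pinf : ℝ,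
    (∀ x ∈ Ω, ∀ y ∈ Ω, x ≠ y →
      |1 / p x - 1 / p y| ≤ C₁ / Real.log (Real.exp 1 + 1 / ‖x - y‖)) ∧
    (∀ x ∈ Ω, |1 / p x - 1 / pinf| ≤ C₂ / Real.log (Real.exp 1 + ‖x‖))

/-- The fractional heat kernel `𝔤_t^α` on `ℝ^n`: the inverse Fourier transform of
`ξ ↦ exp (-t‖ξ‖^{2α})` (it is real-valued; we take the real part). -/
def gKer (n : ℕ) (α t : ℝ) (x : Rn n) : ℝ :=
  (𝓕⁻ (fun ξ : Rn n => (Real.exp (-t * ‖ξ‖ ^ (2 * α)) : ℂ)) x).re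

/-- Convolution on `ℝ^n`. -/
def conv (n : ℕ) (g f : Rn n → ℝ) (x : Rn n) : ℝ := ∫ y, g (x - y) * f y

/-- The partial derivative `∂_j 𝔤_t^α`. -/
def dKer (n : ℕ) (α t : ℝ) (j : Fin n) (z : Rn n) : ℝ :=
  fderiv ℝ (gKer n α t) z (EuclideanSpace.single j 1)

/-- The class `P^emb_q(ℝ^n)` of variable exponents whose Lebesgue space embeds in `L^q`. -/
def IsPembq (n : ℕ) (q : ℝ) (qb : Rn n → ℝ) : Prop :=
  IsPLog univ qb ∧ q ≤ essInf qb volume ∧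
  (∃ M : ℝ, ∀ᵐ x ∂(volume : Measure (Rn n)), qb x ≤ M) ∧
  Filter.Tendsto (fun x : Rn n => q * qb x / (qb x - q)) (Filter.cocompact (Rn n)) Filter.atTop

/-- The Luxemburg-type norm of `E_T = L^{p(·)}([0,T], L^q(ℝ^n))`:
`‖u‖_{E_T} = inf {λ > 0 : ∫_0^T (‖u(t,·)‖_{L^q}/λ)^{p(t)} dt ≤ 1}`. -/
def eNormT (n : ℕ) (p : ℝ → ℝ) (q T : ℝ) (u : ℝ → Rn n → ℝ) : ℝ≥0∞ :=
  sInf {lam : ℝ≥0∞ | 0 < lam ∧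
    ∫⁻ t in Ioc (0:ℝ) T, (eLpNorm (u t) (ENNReal.ofReal q) volume / lam) ^ (p t) ≤ 1}

/-- Mild solution (γ = 1) on the time set `S` of `∂_t u + (-Δ)^α u = 1⃗·∇(|u|^b u) + f`,
`u(0) = u₀`: the force enters through the plain kernel and the nonlinearity through the
differentiated kernel; for a.e. `(t,x)` with `t ∈ S`, all integrals converge absolutely
and the Duhamel formula holds. -/
def IsMildSol1' (n : ℕ) (α : ℝ) (b : ℕ) (S : Set ℝ) (f : ℝ → Rn n → ℝ) (u₀ : Rn n → ℝ)
    (u : ℝ → Rn n → ℝ) : Prop :=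
  ∀ᵐ tx : ℝ × Rn n ∂((volume.restrict S).prod volume),
    Integrable (fun y => gKer n α tx.1 (tx.2 - y) * u₀ y) volume ∧
    IntegrableOn (fun sy : ℝ × Rn n => gKer n α (tx.1 - sy.1) (tx.2 - sy.2) * f sy.1 sy.2)
      (Ioc 0 tx.1 ×ˢ univ) (volume.prod volume) ∧
    (∀ j : Fin n, IntegrableOn
      (fun sy : ℝ × Rn n =>
        dKer n α (tx.1 - sy.1) j (tx.2 - sy.2) * (|u sy.1 sy.2| ^ b * u sy.1 sy.2))
      (Ioc 0 tx.1 ×ˢ univ) (volume.prod volume)) ∧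
    u tx.1 tx.2 = conv n (gKer n α tx.1) u₀ tx.2
      + (∫ s in Ioc (0:ℝ) tx.1, conv n (gKer n α (tx.1 - s)) (f s) tx.2)
      - ∑ j : Fin n, ∫ s in Ioc (0:ℝ) tx.1,
          conv n (dKer n α (tx.1 - s) j) (fun y => |u s y| ^ b * u s y) tx.2

open Filter Topology

/-- The Lévy density of the `α`-stable subordinator, integrated against `1 - e^{-v}`. -/
def levyIntegrand (α v : ℝ) : ℝ := (1 - Real.exp (-v)) * (α * v ^ (-1 - α))

lemma levyIntegrand_nonneg {α v : ℝ} (hα : 0 < α) (hv : 0 < v) : 0 ≤ levyIntegrand α v := by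
  unfold levyIntegrand
  have : Real.exp (-v) ≤ 1 := by simpa using hv.le
  have := Real.rpow_nonneg hv.le (-1 - α)
  have h1 : 0 ≤ 1 - Real.exp (-v) := by linarith
  positivity

lemma levyIntegrand_integrableOn {α : ℝ} (hα : 0 < α) (hα1 : α < 1) :
    IntegrableOn (levyIntegrand α) (Ioi 0) := by
  have hm : Measurable (levyIntegrand α) := by unfold levyIntegrand; fun_prop
  have h1 : IntegrableOn (levyIntegrand α) (Ioc 0 1) := by
    have hi : IntegrableOn (fun v : ℝ => α * v ^ (-α)) (Ioc 0 1) := by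
      have := (intervalIntegral.intervalIntegrable_rpow' (a := 0) (b := 1) (r := -α) (by linarith))
      rw [intervalIntegrable_iff_integrableOn_Ioc_of_le (by norm_num)] at this
      exact this.const_mul α
    refine Integrable.mono' hi hm.aestronglyMeasurable ?_
    refine (ae_restrict_iff' measurableSet_Ioc).2 (Eventually.of_forall fun v hv => ?_)
    rw [Real.norm_of_nonneg (levyIntegrand_nonneg hα hv.1)]
    unfold levyIntegrand
    have h2 : 1 - Real.exp (-v) ≤ v := by linarith [Real.add_one_le_exp (-v)]
    have h3 : v ^ (-α) = v * v ^ (-1 - α) := by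
      rw [← Real.rpow_one_add' hv.1.le (by linarith)]; congr 1; ring
    rw [h3]
    have := Real.rpow_nonneg hv.1.le (-1 - α)
    nlinarith [mul_le_mul_of_nonneg_right h2 (mul_nonneg hα.le this)]
  have h2 : IntegrableOn (levyIntegrand α) (Ioi 1) := by
    have hi : IntegrableOn (fun v : ℝ => α * v ^ (-1-α)) (Ioi 1) :=
      (integrableOn_Ioi_rpow_of_lt (by linarith) (by norm_num)).const_mul α
    refine Integrable.mono' hi hm.aestronglyMeasurable ?_
    refine (ae_restrict_iff' measurableSet_Ioi).2 (Eventually.of_forall fun v hv => ?_)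
    have hv0 : (0:ℝ) < v := lt_trans one_pos hv
    rw [Real.norm_of_nonneg (levyIntegrand_nonneg hα hv0)]
    unfold levyIntegrand
    have := Real.rpow_nonneg hv0.le (-1 - α)
    have h3 := Real.exp_pos (-v)
    nlinarith [mul_nonneg h3.le (mul_nonneg hα.le this)]
  have := h1.union h2
  rwa [Ioc_union_Ioi_eq_Ioi (by norm_num)] at this

lemma levyIntegrand_integral_pos {α : ℝ} (hα : 0 < α) (hα1 : α < 1) :
    0 < ∫ v in Ioi 0, levyIntegrand α v := by
  rw [setIntegral_pos_iff_support_of_nonneg_ae]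
  · have : Ioi (0:ℝ) ⊆ Function.support (levyIntegrand α) := by
      intro v hv
      have hv : 0 < v := hv
      have := Real.rpow_pos_of_pos hv (-1 - α)
      have h1 : Real.exp (-v) < 1 := by simpa using hv
      have h1 : 0 < 1 - Real.exp (-v) := by linarith
      simp only [Function.mem_support, levyIntegrand]
      positivity
    rw [inter_eq_self_of_subset_right this]
    simp
  · exact (ae_restrict_iff' measurableSet_Ioi).2
      (Eventually.of_forall fun v hv => levyIntegrand_nonneg hα hv)
  · exact levyIntegrand_integrableOn hα hα1

/-- Pareto law with index `α` on `(1, ∞)`. -/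
def pareto (α : ℝ) : Measure ℝ :=
  (volume.restrict (Ioi 1)).withDensity (fun r => ENNReal.ofReal (α * r ^ (-1 - α)))

lemma pareto_integral {α : ℝ} (hα : 0 < α) (g : ℝ → ℝ) :
    ∫ r, g r ∂(pareto α) = ∫ r in Ioi 1, (α * r ^ (-1 - α)) * g r := by
  unfold pareto
  rw [integral_withDensity_eq_integral_toReal_smul (by fun_prop) (by simp)]
  refine setIntegral_congr_fun measurableSet_Ioi fun r hr => ?_
  have hr : (1:ℝ) < r := hr
  have := Real.rpow_nonneg (by linarith : 0 ≤ r) (-1 - α)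
  simp only [smul_eq_mul]
  rw [ENNReal.toReal_ofReal (by positivity)]

lemma pareto_density_integral {α : ℝ} (hα : 0 < α) :
    ∫ r in Ioi (1:ℝ), (α * r ^ (-1 - α)) = 1 := by
  rw [integral_const_mul, integral_Ioi_rpow_of_lt (by linarith) (by norm_num),
    show -1 - α + 1 = -α by ring, Real.one_rpow]
  field_simp

instance pareto_isProbabilityMeasure {α : ℝ} [Fact (0 < α)] : IsProbabilityMeasure (pareto α) := by
  have hα : 0 < α := Fact.out
  constructor
  unfold pareto
  rw [withDensity_apply _ MeasurableSet.univ, Measure.restrict_univ,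
    ← ofReal_integral_eq_lintegral_ofReal, pareto_density_integral hα, ENNReal.ofReal_one]
  · exact (integrableOn_Ioi_rpow_of_lt (by linarith) (by norm_num)).const_mul α
  · refine (ae_restrict_iff' measurableSet_Ioi).2 (Eventually.of_forall fun v hv => ?_)
    have hr : (1:ℝ) < v := hv
    have := Real.rpow_nonneg (by linarith : 0 ≤ v) (-1 - α)
    show 0 ≤ α * v ^ (-1-α)
    positivity

lemma pareto_laplace {α h : ℝ} (hα : 0 < α) (hh : 0 < h) :
    ∫ r, Real.exp (-(h * r)) ∂(pareto α) = 1 - h ^ α * ∫ v in Ioi h, levyIntegrand α v := by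
  rw [pareto_integral hα]
  have e := integral_comp_mul_left_Ioi (levyIntegrand α) 1 hh
  rw [mul_one, smul_eq_mul] at e
  have e2 : h ^ α * ∫ v in Ioi h, levyIntegrand α v =
      h ^ (1 + α) * ∫ x in Ioi (1:ℝ), levyIntegrand α (h * x) := by
    rw [e, Real.rpow_add hh, Real.rpow_one]; field_simp
  rw [e2, show ∀ y : ℝ, 1 - y = (∫ r in Ioi (1:ℝ), (α * r ^ (-1 - α))) - y from fun y => by
    rw [pareto_density_integral hα], ← integral_const_mul, ← integral_sub]
  · refine setIntegral_congr_fun measurableSet_Ioi fun r hr => ?_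
    have hr : (1:ℝ) < r := hr
    simp only [levyIntegrand]
    rw [Real.mul_rpow hh.le (by linarith)]
    have : h ^ (1 + α) * h ^ (-1 - α) = 1 := by
      rw [← Real.rpow_add hh]; simp
    linear_combination (Real.exp (-(h*r)) - 1) * (-1) * α * r ^ (-1-α) * this
  · exact (integrableOn_Ioi_rpow_of_lt (by linarith) (by norm_num)).const_mul α
  · have hi : IntegrableOn (fun v : ℝ => h ^ (1+α) * (h ^ (-1-α) * (α * v ^ (-1-α)))) (Ioi 1) :=
      (((integrableOn_Ioi_rpow_of_lt (by linarith) (by norm_num)).const_mul α).const_mul _).const_mul _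
    refine Integrable.mono' hi (by unfold levyIntegrand; fun_prop) ?_
    refine (ae_restrict_iff' measurableSet_Ioi).2 (Eventually.of_forall fun v hv => ?_)
    have hv : (1:ℝ) < v := hv
    have hv0 : (0:ℝ) < v := by linarith
    rw [Real.norm_of_nonneg (mul_nonneg (by positivity) (levyIntegrand_nonneg hα (by positivity)))]
    refine mul_le_mul_of_nonneg_left ?_ (by positivity)
    unfold levyIntegrand
    rw [Real.mul_rpow hh.le hv0.le]
    have h3 := Real.exp_pos (-(h*v))
    have h4 : 0 ≤ α * (h ^ (-1 - α) * v ^ (-1 - α)) := by positivity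
    nlinarith [mul_nonneg h3.le h4]

lemma pareto_laplace_limit {α s : ℝ} (hα : 0 < α) (hα1 : α < 1) (hs : 0 < s) :
    Tendsto (fun N : ℕ => (∫ r, Real.exp (-((s *
      ((∫ v in Ioi 0, levyIntegrand α v) * (N + 1)) ^ (-(1/α))) * r)) ∂(pareto α)) ^ (N + 1))
      atTop (𝓝 (Real.exp (-s ^ α))) := by
  set C := ∫ v in Ioi 0, levyIntegrand α v with hC
  have hCpos : 0 < C := levyIntegrand_integral_pos hα hα1
  set a : ℕ → ℝ := fun N => s * (C * (N + 1)) ^ (-(1/α)) with ha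
  have ha0 : ∀ N, 0 < a N := fun N => by simp only [ha]; positivity
  have haα : ∀ N : ℕ, (a N) ^ α = s ^ α / (C * (N + 1)) := by
    intro N
    simp only [ha]
    rw [Real.mul_rpow hs.le (by positivity), ← Real.rpow_mul (by positivity)]
    have : -(1/α) * α = -1 := by field_simp
    rw [this, Real.rpow_neg_one]; rfl
  have hlim : Tendsto a atTop (𝓝 0) := by
    have h1 : Tendsto (fun N : ℕ => C * ((N:ℝ) + 1)) atTop atTop :=
      Tendsto.const_mul_atTop hCpos (tendsto_atTop_add_const_right _ _ tendsto_natCast_atTop_atTop)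
    have h2 := (tendsto_rpow_neg_atTop (y := 1/α) (by positivity)).comp h1
    have h3 := h2.const_mul s
    rw [mul_zero] at h3
    exact h3
  have hJ : Tendsto (fun N => ∫ v in Ioi (a N), levyIntegrand α v) atTop (𝓝 C) := by
    have hcov := aecover_Ioi_of_Ioi (μ := volume) hlim
    have := hcov.integral_tendsto_of_countably_generated (levyIntegrand_integrableOn hα hα1)
    refine this.congr fun N => ?_
    rw [Measure.restrict_restrict measurableSet_Ioi,
      inter_eq_self_of_subset_left (Ioi_subset_Ioi (ha0 N).le)]
  have hg : Tendsto (fun N : ℕ => (N:ℝ) *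
      (-(s ^ α / (C * N) * ∫ v in Ioi (a (N-1)), levyIntegrand α v))) atTop (𝓝 (-s ^ α)) := by
    rw [← tendsto_add_atTop_iff_nat 1]
    have := hJ.const_mul (-(s^α/C))
    have e : -(s ^ α / C) * C = - s ^ α := by field_simp
    rw [e] at this
    refine this.congr fun N => ?_
    push_cast
    have : (N:ℝ) + 1 ≠ 0 := by positivity
    field_simp
  have := (Real.tendsto_one_add_pow_exp_of_tendsto hg).comp (tendsto_add_atTop_nat 1)
  refine this.congr fun N => ?_
  simp only [Function.comp]
  rw [pareto_laplace hα (ha0 N)]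
  rw [haα]
  congr 1
  push_cast
  ring

lemma exists_mul_conv_pow (ν : Measure unitInterval) [IsProbabilityMeasure ν] (k : ℕ) :
    ∃ μ : Measure unitInterval, IsProbabilityMeasure μ ∧
      ∀ s : ℝ, 0 < s → ∫ x, (x:ℝ) ^ s ∂μ = (∫ x, (x:ℝ) ^ s ∂ν) ^ k := by
  induction k with
  | zero => exact ⟨Measure.dirac 1, inferInstance, fun s hs => by simp⟩
  | succ k ih =>
    obtain ⟨μ, hμ, h⟩ := ih
    have hmm : Measurable (fun z : unitInterval × unitInterval => z.1 * z.2) :=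
      Continuous.measurable (by fun_prop)
    refine ⟨(μ.prod ν).map (fun z => z.1 * z.2),
      Measure.isProbabilityMeasure_map hmm.aemeasurable, fun s hs => ?_⟩
    rw [integral_map hmm.aemeasurable]
    · have : ∀ z : unitInterval × unitInterval,
          (((z.1 * z.2 : unitInterval) : ℝ)) ^ s = (z.1:ℝ) ^ s * (z.2:ℝ) ^ s := fun z => by
        rw [← Real.mul_rpow z.1.2.1 z.2.2.1]; simp
      simp_rw [this]
      rw [integral_prod_mul (μ := μ) (ν := ν) (fun x : unitInterval => (x:ℝ) ^ s)
        (fun x : unitInterval => (x:ℝ) ^ s), h s hs, pow_succ]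
    · exact (Measurable.pow_const measurable_subtype_coe s).aestronglyMeasurable

lemma exists_pareto_exp (α c : ℝ) (hα : 0 < α) (hc : 0 < c) :
    ∃ μ : Measure unitInterval, IsProbabilityMeasure μ ∧
      ∀ s : ℝ, 0 < s → ∫ x, (x:ℝ) ^ s ∂μ = ∫ r, Real.exp (-((s * c) * r)) ∂(pareto α) := by
  have : Fact (0 < α) := ⟨hα⟩
  let φ : ℝ → unitInterval := fun r => ⟨Real.exp (-(c * |r|)), (Real.exp_pos _).le, by
    rw [Real.exp_le_one_iff]; have := mul_nonneg hc.le (abs_nonneg r); linarith⟩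
  have hφ : Measurable φ := Measurable.subtype_mk (by fun_prop)
  refine ⟨(pareto α).map φ, Measure.isProbabilityMeasure_map hφ.aemeasurable, fun s hs => ?_⟩
  rw [integral_map hφ.aemeasurable
    (Measurable.pow_const measurable_subtype_coe s).aestronglyMeasurable,
    pareto_integral hα, pareto_integral hα]
  refine setIntegral_congr_fun measurableSet_Ioi fun r hr => ?_
  have hr : (1:ℝ) < r := hr
  simp only [φ]
  rw [← Real.exp_mul, abs_of_pos (by linarith)]
  ring_nf

lemma exists_unitInterval_stable {α : ℝ} (hα : 0 < α) (hα1 : α < 1) :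
    ∃ μ : Measure unitInterval, IsProbabilityMeasure μ ∧
      ∀ s : ℝ, 0 < s → ∫ x, (x:ℝ) ^ s ∂μ = Real.exp (-s ^ α) := by
  have hC := levyIntegrand_integral_pos hα hα1
  have key : ∀ N : ℕ, ∃ μ : ProbabilityMeasure unitInterval, ∀ s : ℝ, 0 < s →
      ∫ x, (x:ℝ) ^ s ∂(μ : Measure unitInterval) = (∫ r, Real.exp (-((s *
      ((∫ v in Ioi 0, levyIntegrand α v) * (N + 1)) ^ (-(1/α))) * r)) ∂(pareto α)) ^ (N + 1) := by
    intro N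
    obtain ⟨ν, hν, h1⟩ := exists_pareto_exp α
      (((∫ v in Ioi 0, levyIntegrand α v) * (N + 1)) ^ (-(1/α))) hα (by positivity)
    obtain ⟨μ, hμ, h2⟩ := exists_mul_conv_pow ν (N + 1)
    exact ⟨⟨μ, hμ⟩, fun s hs => by rw [ProbabilityMeasure.coe_mk, h2 s hs, h1 s hs]⟩
  choose μ hμ using key
  obtain ⟨m, -, hm⟩ := isCompact_univ.ultrafilter_le_nhds ((hyperfilter ℕ : Ultrafilter ℕ).map μ)
    (by simp)
  have hm' : Tendsto μ (hyperfilter ℕ : Filter ℕ) (𝓝 m) := hm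
  refine ⟨m, inferInstance, fun s hs => ?_⟩
  have hcont : Continuous (fun x : unitInterval => (x:ℝ) ^ s) :=
    continuous_subtype_val.rpow_const (fun _ => Or.inr hs.le)
  let F : BoundedContinuousFunction unitInterval ℝ := BoundedContinuousFunction.mkOfCompact ⟨_, hcont⟩
  have h1 := (ProbabilityMeasure.tendsto_iff_forall_integral_tendsto.1 hm') F
  have h2 : Tendsto (fun N => ∫ x, F x ∂(μ N : Measure unitInterval)) (hyperfilter ℕ : Filter ℕ)
      (𝓝 (Real.exp (-s ^ α))) := by
    refine ((pareto_laplace_limit hα hα1 hs).mono_left Nat.hyperfilter_le_atTop).congr fun N => ?_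
    exact (hμ N s hs).symm
  exact tendsto_nhds_unique h1 h2

/-- Existence of the `α`-stable subordinator law. -/
lemma exists_stable_law {α : ℝ} (hα : 0 < α) (hα1 : α ≤ 1) :
    ∃ η : Measure ℝ, IsProbabilityMeasure η ∧ (∀ᵐ r ∂η, 0 < r) ∧
      ∀ s : ℝ, 0 < s → ∫ r, Real.exp (-(r * s)) ∂η = Real.exp (-s ^ α) := by
  rcases hα1.eq_or_lt with rfl | hα1
  · exact ⟨Measure.dirac 1, inferInstance, by simp, fun s hs => by simp⟩
  obtain ⟨μ, hμ, h⟩ := exists_unitInterval_stable hα hα1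
  have hmx : ∀ s : ℝ, AEStronglyMeasurable (fun x : unitInterval => (x:ℝ) ^ s) μ := fun s =>
    (Measurable.pow_const measurable_subtype_coe s).aestronglyMeasurable
  have hone : ∫ x : unitInterval, (1:ℝ) ∂μ = 1 := by simp
  have hbd : ∀ s : ℝ, 0 < s → ∀ x : unitInterval, ‖(x:ℝ) ^ s‖ ≤ 1 := fun s hs x => by
    rw [Real.norm_of_nonneg (Real.rpow_nonneg x.2.1 s)]
    exact Real.rpow_le_one x.2.1 x.2.2 hs.le
  have hmeas0 : MeasurableSet {x : unitInterval | (0:ℝ) < x} :=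
    measurableSet_lt measurable_const measurable_subtype_coe
  have hmeas1 : MeasurableSet {x : unitInterval | (x:ℝ) = 1} :=
    measurableSet_eq_fun measurable_subtype_coe measurable_const
  have h0 : ∀ᵐ x ∂μ, (0:ℝ) < (x : unitInterval) := by
    have t1 : Tendsto (fun k : ℕ => ∫ x : unitInterval, (x:ℝ) ^ (1 / ((k:ℝ) + 1)) ∂μ) atTop
        (𝓝 (∫ x : unitInterval, {x : unitInterval | (0:ℝ) < x}.indicator (fun _ => (1:ℝ)) x ∂μ)) := by
      refine tendsto_integral_of_dominated_convergence (fun _ => 1) (fun k => hmx _)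
        (by simp) (fun k => Eventually.of_forall (hbd _ (by positivity)))
        (Eventually.of_forall fun x => ?_)
      by_cases hx : (0:ℝ) < x
      · rw [indicator_of_mem (by exact hx)]
        have := (tendsto_one_div_add_atTop_nhds_zero_nat (𝕜 := ℝ))
        have h3 := ((Real.continuousAt_const_rpow (a := (x:ℝ)) (b := 0) hx.ne').tendsto).comp this
        rw [Real.rpow_zero] at h3
        exact h3
      · rw [indicator_of_notMem (by exact hx)]
        have hx0 : (x:ℝ) = 0 := le_antisymm (not_lt.1 hx) x.2.1
        refine tendsto_const_nhds.congr fun k => ?_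
        rw [hx0, Real.zero_rpow (by positivity)]
    have t2 : Tendsto (fun k : ℕ => ∫ x : unitInterval, (x:ℝ) ^ (1 / ((k:ℝ) + 1)) ∂μ) atTop (𝓝 1) := by
      have := (tendsto_one_div_add_atTop_nhds_zero_nat (𝕜 := ℝ)).rpow_const (p := α) (Or.inr hα.le)
      rw [Real.zero_rpow hα.ne'] at this
      have h4 := (Real.continuous_exp.tendsto _).comp this.neg
      rw [neg_zero, Real.exp_zero] at h4
      exact h4.congr fun k => (h _ (by positivity)).symm
    have e := tendsto_nhds_unique t1 t2
    rw [integral_indicator_const _ hmeas0, smul_eq_mul, mul_one] at e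
    rw [ae_iff]
    have := (prob_compl_eq_zero_iff hmeas0 (μ := μ)).2 (by
      rw [← ENNReal.ofReal_one, ← e, Measure.real, ENNReal.ofReal_toReal (measure_ne_top _ _)])
    exact this
  have h1 : ∀ᵐ x ∂μ, ((x : unitInterval):ℝ) < 1 := by
    have t1 : Tendsto (fun k : ℕ => ∫ x : unitInterval, (x:ℝ) ^ ((k:ℝ) + 1) ∂μ) atTop
        (𝓝 (∫ x : unitInterval, {x : unitInterval | (x:ℝ) = 1}.indicator (fun _ => (1:ℝ)) x ∂μ)) := by
      refine tendsto_integral_of_dominated_convergence (fun _ => 1) (fun k => hmx _)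
        (by simp) (fun k => Eventually.of_forall (hbd _ (by positivity)))
        (Eventually.of_forall fun x => ?_)
      by_cases hx : (x:ℝ) = 1
      · rw [indicator_of_mem (by exact hx)]
        simp [hx]
      · rw [indicator_of_notMem (by exact hx)]
        have hx1 : (x:ℝ) < 1 := lt_of_le_of_ne x.2.2 hx
        have := (tendsto_pow_atTop_nhds_zero_of_lt_one x.2.1 hx1).comp (tendsto_add_atTop_nat 1)
        refine this.congr fun k => ?_
        rw [Function.comp, ← Real.rpow_natCast]; push_cast; rfl
    have t2 : Tendsto (fun k : ℕ => ∫ x : unitInterval, (x:ℝ) ^ ((k:ℝ) + 1) ∂μ) atTop (𝓝 0) := by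
      have := (tendsto_rpow_atTop hα).comp
        (tendsto_atTop_add_const_right _ (1:ℝ) tendsto_natCast_atTop_atTop)
      have h4 := Real.tendsto_exp_neg_atTop_nhds_zero.comp this
      exact h4.congr fun k => (h _ (by positivity)).symm
    have e := tendsto_nhds_unique t1 t2
    rw [integral_indicator_const _ hmeas1, smul_eq_mul, mul_one] at e
    have h5 : μ {x : unitInterval | (x:ℝ) = 1} = 0 := (measureReal_eq_zero_iff (by finiteness)).1 e
    rw [ae_iff]
    refine measure_mono_null (fun x hx => ?_) h5
    exact le_antisymm x.2.2 (not_lt.1 hx)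
  have hL : Measurable (fun x : unitInterval => -Real.log (x:ℝ)) := by fun_prop
  refine ⟨μ.map (fun x : unitInterval => -Real.log (x:ℝ)), Measure.isProbabilityMeasure_map hL.aemeasurable,
    ?_, fun s hs => ?_⟩
  · rw [ae_map_iff hL.aemeasurable measurableSet_Ioi]
    filter_upwards [h0, h1] with x hx0 hx1
    have := Real.log_neg hx0 hx1
    linarith
  · rw [integral_map hL.aemeasurable (by fun_prop), ← h s hs]
    refine integral_congr_ae ?_
    filter_upwards [h0] with x hx0
    rw [Real.rpow_def_of_pos hx0]
    congr 1; ring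

/-- The `L^r` norm of an `ℝ≥0∞`-valued function. -/
def lnorm {X : Type*} [MeasurableSpace X] (μ : Measure X) (r : ℝ) (F : X → ℝ≥0∞) : ℝ≥0∞ :=
  (∫⁻ x, F x ^ r ∂μ) ^ (1 / r)

section lnorm
variable {X Y S : Type*} [MeasurableSpace X] [MeasurableSpace Y] [MeasurableSpace S]
  {μ : Measure X} {ν : Measure Y} {r : ℝ}

lemma lnorm_rpow (hr : 0 < r) (F : X → ℝ≥0∞) : lnorm μ r F ^ r = ∫⁻ x, F x ^ r ∂μ := by
  rw [lnorm, ← ENNReal.rpow_mul, one_div_mul_cancel hr.ne', ENNReal.rpow_one]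

lemma lnorm_le_iff (hr : 0 < r) {F : X → ℝ≥0∞} {A : ℝ≥0∞} :
    lnorm μ r F ≤ A ↔ ∫⁻ x, F x ^ r ∂μ ≤ A ^ r := by
  rw [← lnorm_rpow hr, ENNReal.rpow_le_rpow_iff hr]

lemma lnorm_mono (hr : 0 ≤ r) {F G : X → ℝ≥0∞} (h : F ≤ᵐ[μ] G) : lnorm μ r F ≤ lnorm μ r G := by
  unfold lnorm
  refine ENNReal.rpow_le_rpow (lintegral_mono_ae ?_) (by positivity)
  filter_upwards [h] with x hx using ENNReal.rpow_le_rpow hx hr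

lemma lnorm_mono_measure (hr : 0 ≤ r) {μ' : Measure X} (h : μ ≤ μ') (F : X → ℝ≥0∞) :
    lnorm μ r F ≤ lnorm μ' r F :=
  ENNReal.rpow_le_rpow (lintegral_mono' h le_rfl) (by positivity)

lemma lnorm_one (F : X → ℝ≥0∞) : lnorm μ 1 F = ∫⁻ x, F x ∂μ := by simp [lnorm]

lemma lnorm_const_mul (hr : 0 < r) (c : ℝ≥0∞) {F : X → ℝ≥0∞} (hF : AEMeasurable F μ) :
    lnorm μ r (fun x => c * F x) = c * lnorm μ r F := by
  unfold lnorm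
  simp_rw [ENNReal.mul_rpow_of_nonneg _ _ hr.le]
  rw [lintegral_const_mul'' _ (hF.pow_const r), ENNReal.mul_rpow_of_nonneg _ _ (by positivity),
    ← ENNReal.rpow_mul, mul_one_div_cancel hr.ne', ENNReal.rpow_one]

lemma lnorm_add_le (hr : 1 ≤ r) {F G : X → ℝ≥0∞} (hF : AEMeasurable F μ) (hG : AEMeasurable G μ) :
    lnorm μ r (fun x => F x + G x) ≤ lnorm μ r F + lnorm μ r G :=
  ENNReal.lintegral_Lp_add_le hF hG hr

lemma lnorm_pow (hr : 0 < r) {k : ℝ} (hk : 0 < k) (F : X → ℝ≥0∞) :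
    lnorm μ r (fun x => F x ^ k) = lnorm μ (k * r) F ^ k := by
  unfold lnorm
  simp_rw [← ENNReal.rpow_mul]
  congr 1
  field_simp

lemma lnorm_eq_zero (hr : 0 < r) {F : X → ℝ≥0∞} (hF : AEMeasurable F μ) (h : lnorm μ r F = 0) :
    F =ᵐ[μ] 0 := by
  have := lnorm_rpow (μ := μ) hr F
  rw [h, ENNReal.zero_rpow_of_pos hr] at this
  rw [eq_comm, lintegral_eq_zero_iff' (hF.pow_const r)] at this
  filter_upwards [this] with x hx
  simpa [hr, hr.not_gt] using hx

lemma lnorm_lt_top_ae (hr : 0 < r) {F : X → ℝ≥0∞} (hF : AEMeasurable F μ) (h : lnorm μ r F ≠ ⊤) :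
    ∀ᵐ x ∂μ, F x ≠ ⊤ := by
  have h1 : ∫⁻ x, F x ^ r ∂μ ≠ ⊤ := by
    rw [← lnorm_rpow hr]; exact ENNReal.rpow_ne_top_of_nonneg hr.le h
  filter_upwards [ae_lt_top' (hF.pow_const r) h1] with x hx h2
  rw [h2, ENNReal.top_rpow_of_pos hr] at hx
  exact lt_irrefl _ hx

/-- Minkowski's integral inequality. -/
lemma minkowski_integral [SFinite μ] {σ : Measure S} [SFinite σ] (hr : 1 ≤ r)
    {F : S → X → ℝ≥0∞} (hF : Measurable (Function.uncurry F)) :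
    lnorm μ r (fun x => ∫⁻ s, F s x ∂σ) ≤ ∫⁻ s, lnorm μ r (F s) ∂σ := by
  have hFl : Measurable (fun z : X × S => F z.2 z.1) := hF.comp measurable_swap
  rcases hr.eq_or_lt with rfl | hr1
  · simp_rw [lnorm_one]
    rw [lintegral_lintegral_swap hFl.aemeasurable]
  have hr0 : 0 < r := by linarith
  set c : S → ℝ≥0∞ := fun s => lnorm μ r (F s) with hc
  have hcm : Measurable c := (Measurable.lintegral_prod_right' (f := fun z : S × X => F z.1 z.2 ^ r)
    (hF.pow_const r)).pow_const _
  by_cases hI : ∫⁻ s, c s ∂σ = ⊤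
  · rw [hI]; exact le_top
  have hct : ∀ᵐ s ∂σ, c s < ⊤ := ae_lt_top hcm hI
  rw [lnorm_le_iff hr0]
  set e : ℝ := 1 - 1 / r with he
  have he0 : 0 < e := by
    rw [he, sub_pos, div_lt_one hr0]; exact hr1
  have hpt : ∀ᵐ x ∂μ, ∀ᵐ s ∂σ, F s x ≤ c s ^ e * (F s x * c s ^ (-e)) := by
    have hm : MeasurableSet {z : S × X | F z.1 z.2 ≤ c z.1 ^ e * (F z.1 z.2 * c z.1 ^ (-e))} := by
      have h1 : Measurable (fun z : S × X => c z.1) := hcm.comp measurable_fst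
      exact measurableSet_le hF ((h1.pow_const _).mul (hF.mul (h1.pow_const _)))
    refine (Measure.ae_ae_comm (p := fun s x => F s x ≤ c s ^ e * (F s x * c s ^ (-e))) hm).1 ?_
    filter_upwards [hct] with s hs
    by_cases h0 : c s = 0
    · have := lnorm_eq_zero hr0 (hF.of_uncurry_left (x := s)).aemeasurable h0
      filter_upwards [this] with x hx
      rw [hx]; simp
    · refine Eventually.of_forall fun x => ?_
      rw [mul_comm, mul_assoc, ← ENNReal.rpow_add _ _ h0 hs.ne]
      simp
  have hbound : ∀ᵐ x ∂μ, (∫⁻ s, F s x ∂σ) ^ r ≤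
      (∫⁻ s, c s ∂σ) ^ (r - 1) * ∫⁻ s, F s x ^ r * c s ^ (1 - r) ∂σ := by
    filter_upwards [hpt] with x hx
    have hFx : Measurable (fun s => F s x) := hF.of_uncurry_right
    have hpq : (1/e).HolderConjugate r := by
      rw [Real.holderConjugate_iff]
      refine ⟨?_, ?_⟩
      · rw [lt_div_iff₀ he0, he]
        have : 0 < 1 / r := by positivity
        linarith
      · rw [he]; simp
    have h1 := ENNReal.lintegral_mul_le_Lp_mul_Lq σ hpq (f := fun s => c s ^ e)
      (g := fun s => F s x * c s ^ (-e)) (hcm.pow_const _).aemeasurable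
      (hFx.mul (hcm.pow_const _)).aemeasurable
    have h2 : ∫⁻ s, F s x ∂σ ≤ _ := (lintegral_mono_ae hx).trans h1
    have h3 := ENNReal.rpow_le_rpow h2 hr0.le
    refine h3.trans ?_
    rw [ENNReal.mul_rpow_of_nonneg _ _ hr0.le, ← ENNReal.rpow_mul, ← ENNReal.rpow_mul,
      one_div_mul_cancel hr0.ne', ENNReal.rpow_one]
    have e1 : 1 / (1 / e) * r = r - 1 := by rw [he]; field_simp
    rw [e1]
    have e2 : ∀ s, (c s ^ e) ^ (1 / e) = c s := fun s => by
      rw [← ENNReal.rpow_mul, mul_one_div_cancel he0.ne', ENNReal.rpow_one]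
    have e3 : ∀ s, (F s x * c s ^ (-e)) ^ r = F s x ^ r * c s ^ (1 - r) := fun s => by
      rw [ENNReal.mul_rpow_of_nonneg _ _ hr0.le, ← ENNReal.rpow_mul]
      congr 2; rw [he]; field_simp; ring
    simp only [e2, e3]
    exact le_rfl
  refine (lintegral_mono_ae hbound).trans ?_
  have hmm : Measurable (fun z : X × S => F z.2 z.1 ^ r * c z.2 ^ (1 - r)) :=
    (hFl.pow_const r).mul ((hcm.comp measurable_snd).pow_const _)
  rw [lintegral_const_mul _ (Measurable.lintegral_prod_right' hmm),
    lintegral_lintegral_swap hmm.aemeasurable]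
  have h5 : ∫⁻ s, ∫⁻ x, F s x ^ r * c s ^ (1 - r) ∂μ ∂σ ≤ ∫⁻ s, c s ∂σ := by
    refine lintegral_mono_ae ?_
    filter_upwards [hct] with s hs
    rw [lintegral_mul_const _ ((hF.of_uncurry_left (x := s)).pow_const r), ← lnorm_rpow hr0]
    show c s ^ r * c s ^ (1 - r) ≤ c s
    by_cases h0 : c s = 0
    · rw [h0, ENNReal.zero_rpow_of_pos hr0]; simp
    · rw [← ENNReal.rpow_add _ _ h0 hs.ne]; simp
  refine (mul_le_mul_right h5 _).trans ?_
  by_cases h0 : ∫⁻ s, c s ∂σ = 0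
  · rw [h0]; simp
  · nth_rewrite 2 [← ENNReal.rpow_one (∫⁻ s, c s ∂σ)]
    rw [← ENNReal.rpow_add _ _ h0 hI]; simp

/-- Schur's form of Young's inequality. -/
lemma schur_young [SFinite μ] [SFinite ν] {m ρ : ℝ} (hr : 1 ≤ r) (hm : 1 ≤ m) (hρ : 0 < ρ)
    (hexp : 1 + 1 / ρ = 1 / r + 1 / m)
    {κ : X → Y → ℝ≥0∞} (hκ : Measurable (Function.uncurry κ)) {H : Y → ℝ≥0∞} (hH : Measurable H)
    {A : ℝ≥0∞} (h1 : ∀ x, lnorm ν r (κ x) ≤ A) (h2 : ∀ y, lnorm μ r (fun x => κ x y) ≤ A) :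
    lnorm μ ρ (fun x => ∫⁻ y, κ x y * H y ∂ν) ≤ A * lnorm ν m H := by
  have hr0 : 0 < r := by linarith
  have hm0 : 0 < m := by linarith
  have hr1 : 1 / r ≤ 1 := by rw [div_le_one hr0]; exact hr
  have hm1 : 1 / m ≤ 1 := by rw [div_le_one hm0]; exact hm
  have hκx : ∀ x, Measurable (κ x) := fun x => hκ.of_uncurry_left
  have hκy : ∀ y, Measurable (fun x => κ x y) := fun y => hκ.of_uncurry_right
  have e1 : 0 ≤ 1 / r - 1 / ρ := by linarith
  have e2 : 0 ≤ 1 / m - 1 / ρ := by linarith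
  rw [lnorm_le_iff hρ]
  set B := lnorm ν m H with hB
  have hpt : ∀ x, (∫⁻ y, κ x y * H y ∂ν) ^ ρ ≤
      (A ^ (ρ - r) * B ^ (ρ - m)) * ∫⁻ y, κ x y ^ r * H y ^ m ∂ν := by
    intro x
    have h3 := ENNReal.lintegral_prod_norm_pow_le (μ := ν) (Finset.univ : Finset (Fin 3))
      (f := ![fun y => κ x y ^ r * H y ^ m, fun y => κ x y ^ r, fun y => H y ^ m])
      (by
        intro i _
        fin_cases i
        · exact (((hκx x).pow_const r).mul (hH.pow_const m)).aemeasurable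
        · exact ((hκx x).pow_const r).aemeasurable
        · exact (hH.pow_const m).aemeasurable)
      (p := ![1/ρ, 1/r - 1/ρ, 1/m - 1/ρ])
      (by rw [Fin.sum_univ_three]; simp; simp at hexp; linarith)
      (by
        intro i _
        fin_cases i
        · simp; positivity
        · simpa using e1
        · simpa using e2)
    simp only [Fin.prod_univ_three, Matrix.cons_val_zero, Matrix.cons_val_one, Matrix.cons_val] at h3
    have e3 : ∀ y, (κ x y ^ r * H y ^ m) ^ (1 / ρ) * (κ x y ^ r) ^ (1 / r - 1 / ρ) *
        (H y ^ m) ^ (1 / m - 1 / ρ) = κ x y * H y := by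
      intro y
      rw [ENNReal.mul_rpow_of_nonneg _ _ (by positivity), mul_assoc, mul_mul_mul_comm,
        ← ENNReal.rpow_add_of_nonneg _ _ (by positivity) e1,
        ← ENNReal.rpow_add_of_nonneg _ _ (by positivity) e2,
        ← ENNReal.rpow_mul, ← ENNReal.rpow_mul]
      have a1 : r * (1 / ρ + (1 / r - 1 / ρ)) = 1 := by field_simp; ring
      have a2 : m * (1 / ρ + (1 / m - 1 / ρ)) = 1 := by field_simp; ring
      rw [a1, a2, ENNReal.rpow_one, ENNReal.rpow_one]
    simp_rw [e3] at h3
    have h4 := ENNReal.rpow_le_rpow h3 hρ.le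
    refine h4.trans ?_
    rw [ENNReal.mul_rpow_of_nonneg _ _ hρ.le, ENNReal.mul_rpow_of_nonneg _ _ hρ.le,
      ← ENNReal.rpow_mul, ← ENNReal.rpow_mul, ← ENNReal.rpow_mul, one_div_mul_cancel hρ.ne',
      ENNReal.rpow_one, ← lnorm_rpow hr0 (κ x), ← lnorm_rpow hm0 H, ← ENNReal.rpow_mul,
      ← ENNReal.rpow_mul, mul_comm (∫⁻ y, _ ∂ν), mul_right_comm]
    have a1 : r * ((1 / r - 1 / ρ) * ρ) = ρ - r := by field_simp
    have a2 : m * ((1 / m - 1 / ρ) * ρ) = ρ - m := by field_simp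
    have a3 : 0 ≤ ρ - r := by rw [← a1]; positivity
    rw [a1, a2]
    gcongr
    exact h1 x
  refine (lintegral_mono hpt).trans ?_
  have hmm : Measurable (fun z : X × Y => κ z.1 z.2 ^ r * H z.2 ^ m) :=
    (hκ.pow_const r).mul ((hH.comp measurable_snd).pow_const m)
  rw [lintegral_const_mul _ (Measurable.lintegral_prod_right' hmm),
    lintegral_lintegral_swap hmm.aemeasurable]
  have h5 : ∫⁻ y, ∫⁻ x, κ x y ^ r * H y ^ m ∂μ ∂ν ≤ A ^ r * B ^ m := by
    rw [hB, lnorm_rpow hm0, ← lintegral_const_mul _ (hH.pow_const m)]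
    refine lintegral_mono fun y => ?_
    rw [lintegral_mul_const _ ((hκy y).pow_const r)]
    gcongr
    exact (lnorm_le_iff hr0).1 (h2 y)
  refine (mul_le_mul_right h5 _).trans ?_
  have a1 : 0 ≤ ρ - r := by
    have : r * ((1 / r - 1 / ρ) * ρ) = ρ - r := by field_simp
    rw [← this]; positivity
  have a2 : 0 ≤ ρ - m := by
    have : m * ((1 / m - 1 / ρ) * ρ) = ρ - m := by field_simp
    rw [← this]; positivity
  rw [mul_mul_mul_comm, ← ENNReal.rpow_add_of_nonneg _ _ a1 hr0.le,
    ← ENNReal.rpow_add_of_nonneg _ _ a2 hm0.le, ENNReal.mul_rpow_of_nonneg _ _ hρ.le]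
  simp

end lnorm

/-- `η` is the law of the one-sided `α`-stable subordinator at time one. -/
structure IsStable (α : ℝ) (η : Measure ℝ) : Prop where
  prob : IsProbabilityMeasure η
  pos : ∀ᵐ r ∂η, 0 < r
  laplace : ∀ s : ℝ, 0 < s → ∫ r, Real.exp (-(r * s)) ∂η = Real.exp (-s ^ α)

lemma exists_isStable {α : ℝ} (hα : 0 < α) (hα1 : α ≤ 1) : ∃ η, IsStable α η :=
  let ⟨η, h1, h2, h3⟩ := exists_stable_law hα hα1
  ⟨η, h1, h2, h3⟩

namespace IsStable
variable {α : ℝ} {η : Measure ℝ}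

lemma laplace_nonneg (h : IsStable α η) (hα : 0 < α) {s : ℝ} (hs : 0 ≤ s) :
    ∫ r, Real.exp (-(r * s)) ∂η = Real.exp (-s ^ α) := by
  have := h.prob
  rcases hs.eq_or_lt with rfl | hs
  · simp [Real.zero_rpow hα.ne']
  · exact h.laplace s hs

lemma integrable_exp (h : IsStable α η) {s : ℝ} (hs : 0 ≤ s) :
    Integrable (fun r => Real.exp (-(r * s))) η := by
  have := h.prob
  refine Integrable.mono' (integrable_const (1:ℝ)) (by fun_prop) ?_
  filter_upwards [h.pos] with r hr
  rw [Real.norm_of_nonneg (Real.exp_pos _).le, Real.exp_le_one_iff]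
  have := mul_nonneg hr.le hs
  linarith

lemma integrable_rpow_neg (h : IsStable α η) (hα : 0 < α) {σ : ℝ} (hσ : 0 ≤ σ) :
    Integrable (fun r => r ^ (-σ)) η := by
  have := h.prob
  rcases hσ.eq_or_lt with rfl | hσ
  · simp
  have hG := Real.Gamma_pos_of_pos hσ
  have hnn : 0 ≤ᵐ[η] fun r => r ^ (-σ) := by
    filter_upwards [h.pos] with r hr using Real.rpow_nonneg hr.le _
  refine ⟨(measurable_id.pow_const _).aestronglyMeasurable, ?_⟩
  rw [hasFiniteIntegral_iff_ofReal hnn]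
  have key : ∀ᵐ r ∂η, ENNReal.ofReal (r ^ (-σ)) = ENNReal.ofReal (Real.Gamma σ)⁻¹ *
      ∫⁻ s in Ioi (0:ℝ), ENNReal.ofReal (s ^ (σ - 1)) * ENNReal.ofReal (Real.exp (-(r * s))) := by
    filter_upwards [h.pos] with r hr
    have e := Real.integral_rpow_mul_exp_neg_mul_Ioi hσ hr
    have hint : IntegrableOn (fun s : ℝ => s ^ (σ - 1) * Real.exp (-(r * s))) (Ioi 0) := by
      have := integrableOn_rpow_mul_exp_neg_mul_rpow (p := 1) (s := σ - 1) (b := r)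
        (by linarith) one_pos hr
      simpa using this
    have e2 : ∫⁻ s in Ioi (0:ℝ), ENNReal.ofReal (s ^ (σ - 1)) * ENNReal.ofReal (Real.exp (-(r * s)))
        = ENNReal.ofReal (∫ s in Ioi (0:ℝ), s ^ (σ - 1) * Real.exp (-(r * s))) := by
      rw [ofReal_integral_eq_lintegral_ofReal hint]
      · refine setLIntegral_congr_fun measurableSet_Ioi fun s hs => ?_
        rw [ENNReal.ofReal_mul (Real.rpow_nonneg (le_of_lt hs) _)]
      · refine (ae_restrict_iff' measurableSet_Ioi).2 (Eventually.of_forall fun s hs => ?_)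
        exact mul_nonneg (Real.rpow_nonneg (le_of_lt hs) _) (Real.exp_pos _).le
    rw [e2, e, ← ENNReal.ofReal_mul (by positivity)]
    congr 1
    rw [Real.rpow_neg hr.le, one_div, Real.inv_rpow hr.le]
    field_simp
  rw [lintegral_congr_ae key, lintegral_const_mul', lintegral_lintegral_swap]
  rotate_left
  · exact Measurable.aemeasurable (by fun_prop)
  · exact ENNReal.ofReal_ne_top
  have e3 : ∀ s ∈ Ioi (0:ℝ), ∫⁻ r, ENNReal.ofReal (s ^ (σ - 1)) * ENNReal.ofReal (Real.exp (-(r * s))) ∂η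
      = ENNReal.ofReal (s ^ (σ - 1) * Real.exp (-s ^ α)) := by
    intro s hs
    have hs : 0 < s := hs
    rw [lintegral_const_mul' _ _ ENNReal.ofReal_ne_top,
      ← ofReal_integral_eq_lintegral_ofReal (h.integrable_exp hs.le)
        (Eventually.of_forall fun r => (Real.exp_pos _).le), h.laplace s hs,
      ← ENNReal.ofReal_mul (by positivity)]
  rw [setLIntegral_congr_fun measurableSet_Ioi e3]
  refine ENNReal.mul_lt_top ENNReal.ofReal_lt_top ?_
  have := integrableOn_rpow_mul_exp_neg_rpow (p := α) (s := σ - 1) (by linarith) hα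
  exact this.lintegral_lt_top

end IsStable

/-- The Gaussian `(π/ρ)^{n/2} exp(-π²‖x‖²/ρ)`, Fourier transform of `exp(-ρ‖ξ‖²)`. -/
def gauss (n : ℕ) (ρ : ℝ) (x : Rn n) : ℝ :=
  (Real.pi / ρ) ^ ((n:ℝ) / 2) * Real.exp (-(Real.pi ^ 2 * ‖x‖ ^ 2 / ρ))

/-- The partial derivative of `gauss`. -/
def dgauss (n : ℕ) (ρ : ℝ) (j : Fin n) (x : Rn n) : ℝ :=
  -(2 * Real.pi ^ 2 * x j / ρ) * gauss n ρ x

lemma gauss_measurable (n : ℕ) : Measurable (Function.uncurry (gauss n)) := by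
  unfold gauss Function.uncurry; fun_prop

lemma dgauss_measurable (n : ℕ) (j : Fin n) :
    Measurable (Function.uncurry (fun ρ x => dgauss n ρ j x)) := by
  unfold dgauss gauss Function.uncurry; fun_prop

lemma gauss_nonneg (n : ℕ) {ρ : ℝ} (hρ : 0 < ρ) (x : Rn n) : 0 ≤ gauss n ρ x := by
  unfold gauss; positivity

lemma fourierInv_exp_neg (n : ℕ) {ρ : ℝ} (hρ : 0 < ρ) (x : Rn n) :
    𝓕⁻ (fun ξ : Rn n => (Real.exp (-(ρ * ‖ξ‖ ^ 2)) : ℂ)) x = (gauss n ρ x : ℂ) := by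
  rw [Real.fourierInv_eq_fourier_neg]
  have := fourier_gaussian_innerProductSpace (V := Rn n) (b := (ρ:ℂ)) (by simpa using hρ) (-x)
  rw [show (fun ξ : Rn n => (Real.exp (-(ρ * ‖ξ‖ ^ 2)) : ℂ)) =
    fun v : Rn n => Complex.exp (-(ρ:ℂ) * ‖v‖ ^ 2) by ext v; push_cast; ring_nf, this]
  unfold gauss
  push_cast
  rw [Complex.ofReal_cpow (by positivity)]
  simp
  left; ring_nf

lemma gauss_le (n : ℕ) {ρ : ℝ} (hρ : 0 < ρ) (x : Rn n) :
    gauss n ρ x ≤ (Real.pi / ρ) ^ ((n:ℝ) / 2) := by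
  unfold gauss
  refine mul_le_of_le_one_right (by positivity) ?_
  rw [Real.exp_le_one_iff]
  have : 0 ≤ Real.pi ^ 2 * ‖x‖ ^ 2 / ρ := by positivity
  linarith

lemma hasFDerivAt_gauss (n : ℕ) (ρ : ℝ) (x : Rn n) :
    HasFDerivAt (gauss n ρ) ((-(2 * Real.pi ^ 2 / ρ) * gauss n ρ x) • innerSL ℝ x) x := by
  have h1 := (hasStrictFDerivAt_norm_sq x).hasFDerivAt
  have h2 := (((h1.const_mul (Real.pi ^ 2 / ρ)).neg).exp).const_mul ((Real.pi / ρ) ^ ((n:ℝ) / 2))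
  have e : gauss n ρ = fun y : Rn n => (Real.pi / ρ) ^ ((n:ℝ) / 2) *
      Real.exp (-(Real.pi ^ 2 / ρ * ‖y‖ ^ 2)) := by
    ext y; unfold gauss; congr 3; ring
  rw [e]
  convert! h2 using 1
  ext v
  simp
  ring

namespace IsStable
variable {α : ℝ} {η : Measure ℝ}

lemma integrable_scaled (h : IsStable α η) (hα : 0 < α) {σ c t : ℝ} (hσ : 0 ≤ σ) (hc : 0 ≤ c)
    (ht : 0 < t) : Integrable (fun r => (c / (r * t)) ^ σ) η := by
  refine ((h.integrable_rpow_neg hα hσ).const_mul ((c / t) ^ σ)).congr ?_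
  filter_upwards [h.pos] with r hr
  rw [Real.rpow_neg hr.le, ← Real.inv_rpow hr.le, ← Real.mul_rpow (by positivity) (by positivity)]
  congr 1; field_simp

lemma integrable_gauss (h : IsStable α η) (hα : 0 < α) (n : ℕ) {t : ℝ} (ht : 0 < t) (x : Rn n) :
    Integrable (fun r => gauss n (r * t) x) η := by
  refine Integrable.mono' (h.integrable_scaled hα (σ := (n:ℝ)/2) (by positivity) Real.pi_pos.le ht)
    ?_ ?_
  · exact ((gauss_measurable n).comp
      ((measurable_id.mul_const t).prodMk measurable_const)).aestronglyMeasurable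
  · filter_upwards [h.pos] with r hr
    rw [Real.norm_of_nonneg (gauss_nonneg n (by positivity) x)]
    exact gauss_le n (by positivity) x

/-- Subordination formula for the fractional heat kernel. -/
lemma gKer_eq (h : IsStable α η) (hα : 0 < α) (n : ℕ) {t : ℝ} (ht : 0 < t) (x : Rn n) :
    gKer n α t x = ∫ r, gauss n (r * t ^ (1 / α)) x ∂η := by
  have := h.prob
  set τ := t ^ (1 / α) with hτ
  have hτ0 : 0 < τ := Real.rpow_pos_of_pos ht _
  have e1 : ∀ ξ : Rn n, (Real.exp (-t * ‖ξ‖ ^ (2 * α)) : ℂ) =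
      ∫ r, (Real.exp (-((r * τ) * ‖ξ‖ ^ 2)) : ℂ) ∂η := by
    intro ξ
    rw [integral_complex_ofReal]
    congr 1
    have h1 := h.laplace_nonneg hα (s := τ * ‖ξ‖ ^ 2) (by positivity)
    simp_rw [mul_assoc]
    rw [h1]
    congr 1
    rw [Real.mul_rpow hτ0.le (by positivity), hτ, ← Real.rpow_mul ht.le,
      one_div_mul_cancel hα.ne', Real.rpow_one, Real.rpow_mul (norm_nonneg _), Real.rpow_two]
    ring
  have hI : Integrable (Function.uncurry fun (v : Rn n) (r : ℝ) =>
      Complex.exp (((2 * Real.pi * inner ℝ v x : ℝ) : ℂ) * Complex.I) •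
        (Real.exp (-((r * τ) * ‖v‖ ^ 2)) : ℂ)) ((volume : Measure (Rn n)).prod η) := by
    rw [integrable_prod_iff']
    · refine ⟨?_, ?_⟩
      · filter_upwards [h.pos] with r hr
        have hb : 0 < ((r * τ : ℝ) : ℂ).re := by simp; positivity
        have h2 := GaussianFourier.integrable_cexp_neg_mul_sq_norm_add hb 0 (0 : Rn n)
        refine h2.mono ?_ (Eventually.of_forall fun v => ?_)
        · exact Continuous.aestronglyMeasurable (by simp only [Function.uncurry]; fun_prop)
        · simp only [Function.uncurry, norm_smul, Complex.norm_exp_ofReal_mul_I, one_mul]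
          rw [← Complex.ofReal_pow, ← Complex.ofReal_neg, ← Complex.ofReal_mul]
          simp [Complex.norm_exp]
      · refine (h.integrable_scaled hα (σ := (n:ℝ)/2) (by positivity) Real.pi_pos.le hτ0).congr ?_
        filter_upwards [h.pos] with r hr
        have h2 := GaussianFourier.integral_rexp_neg_mul_sq_norm (V := Rn n) (b := r * τ)
          (by positivity)
        rw [finrank_euclideanSpace_fin] at h2
        rw [← h2]
        congr 1
        ext v
        simp only [Function.uncurry, norm_smul, Complex.norm_exp_ofReal_mul_I, one_mul]
        rw [Complex.norm_of_nonneg (Real.exp_pos _).le]; ring_nf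
    · refine Continuous.aestronglyMeasurable ?_
      unfold Function.uncurry
      fun_prop
  unfold gKer
  rw [Real.fourierInv_eq']
  simp_rw [e1, ← integral_smul]
  rw [integral_integral_swap hI]
  have e2 : ∀ᵐ r ∂η, ∫ v : Rn n, Complex.exp (((2 * Real.pi * inner ℝ v x : ℝ) : ℂ) * Complex.I) •
        (Real.exp (-((r * τ) * ‖v‖ ^ 2)) : ℂ) = (gauss n (r * τ) x : ℂ) := by
    filter_upwards [h.pos] with r hr
    rw [← fourierInv_exp_neg n (by positivity : 0 < r * τ) x, Real.fourierInv_eq']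
  rw [integral_congr_ae e2, integral_complex_ofReal, Complex.ofReal_re]

/-- Subordination formula for the derivative of the fractional heat kernel. -/
lemma dKer_eq (h : IsStable α η) (hα : 0 < α) (n : ℕ) {t : ℝ} (ht : 0 < t) (j : Fin n) (x : Rn n) :
    dKer n α t j x = ∫ r, dgauss n (r * t ^ (1 / α)) j x ∂η := by
  have := h.prob
  set τ := t ^ (1 / α) with hτ
  have hτ0 : 0 < τ := Real.rpow_pos_of_pos ht _
  have hg : gKer n α t = fun x => ∫ r, gauss n (r * τ) x ∂η := by
    ext y; exact h.gKer_eq hα n ht y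
  have hmeas : ∀ y : Rn n, Measurable fun r => gauss n (r * τ) y := fun y =>
    (gauss_measurable n).comp ((measurable_id.mul_const τ).prodMk measurable_const)
  have hi := (h.integrable_scaled hα (σ := (n:ℝ)/2 + 1) (by positivity) Real.pi_pos.le hτ0).const_mul
    (2 * Real.pi * (‖x‖ + 1))
  have hF'm : AEStronglyMeasurable
      (fun r => (-(2 * Real.pi ^ 2 / (r * τ)) * gauss n (r * τ) x) • innerSL ℝ x) η := by
    refine AEStronglyMeasurable.smul_const (Measurable.aestronglyMeasurable ?_) _
    exact Measurable.mul (by fun_prop) (hmeas x)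
  have hbd : ∀ᵐ r ∂η, ∀ y ∈ Metric.ball x 1,
      ‖(-(2 * Real.pi ^ 2 / (r * τ)) * gauss n (r * τ) y) • innerSL ℝ y‖ ≤
        2 * Real.pi * (‖x‖ + 1) * (Real.pi / (r * τ)) ^ ((n:ℝ) / 2 + 1) := by
    filter_upwards [h.pos] with r hr y hy
    have hy1 : ‖y‖ ≤ ‖x‖ + 1 := by
      have := norm_sub_norm_le y x
      rw [mem_ball_iff_norm] at hy
      linarith
    have h1 := gauss_le n (by positivity : 0 < r * τ) y
    rw [norm_smul, norm_mul, norm_neg, Real.norm_of_nonneg (by positivity),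
      Real.norm_of_nonneg (gauss_nonneg n (by positivity) y), innerSL_apply_norm,
      Real.rpow_add (by positivity), Real.rpow_one]
    calc 2 * Real.pi ^ 2 / (r * τ) * gauss n (r * τ) y * ‖y‖
        ≤ 2 * Real.pi ^ 2 / (r * τ) * (Real.pi / (r * τ)) ^ ((n:ℝ) / 2) * (‖x‖ + 1) := by gcongr
      _ = _ := by field_simp
  have key := hasFDerivAt_integral_of_dominated_of_fderiv_le (𝕜 := ℝ) (μ := η)
    (F := fun y r => gauss n (r * τ) y) (x₀ := x) (s := Metric.ball x 1)
    (F' := fun y r => (-(2 * Real.pi ^ 2 / (r * τ)) * gauss n (r * τ) y) • innerSL ℝ y)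
    (Metric.ball_mem_nhds x one_pos)
    (Eventually.of_forall fun y => (hmeas y).aestronglyMeasurable)
    (h.integrable_gauss hα n hτ0 x) hF'm hbd hi
    (Eventually.of_forall fun r y _ => hasFDerivAt_gauss n _ y)
  unfold dKer
  rw [hg, key.fderiv, ContinuousLinearMap.integral_apply]
  · refine integral_congr_ae (Eventually.of_forall fun r => ?_)
    simp [dgauss, EuclideanSpace.inner_single_right]
    ring
  · exact hi.mono' hF'm (by filter_upwards [hbd] with r hr using hr x (Metric.mem_ball_self one_pos))

end IsStable

lemma lnorm_gaussian (n : ℕ) {c ρ r : ℝ} (hc : 0 < c) (hρ : 0 < ρ) (hr : 0 < r) :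
    lnorm (volume : Measure (Rn n)) r (fun x => ENNReal.ofReal (Real.exp (-(c * ‖x‖ ^ 2 / ρ)))) =
      ENNReal.ofReal ((Real.pi / (r * c)) ^ ((n:ℝ) / (2 * r)) * ρ ^ ((n:ℝ) / (2 * r))) := by
  have hb : 0 < r * c / ρ := by positivity
  have h1 := GaussianFourier.integral_rexp_neg_mul_sq_norm (V := Rn n) hb
  have hi : Integrable (fun v : Rn n => Real.exp (-(r * c / ρ) * ‖v‖ ^ 2)) := by
    by_contra hcon
    rw [integral_undef hcon] at h1
    have : 0 < (Real.pi / (r * c / ρ)) ^ ((Module.finrank ℝ (Rn n):ℝ) / 2) := by positivity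
    linarith
  unfold lnorm
  have e : ∀ x : Rn n, ENNReal.ofReal (Real.exp (-(c * ‖x‖ ^ 2 / ρ))) ^ r =
      ENNReal.ofReal (Real.exp (-(r * c / ρ) * ‖x‖ ^ 2)) := fun x => by
    rw [ENNReal.ofReal_rpow_of_nonneg (Real.exp_pos _).le hr.le, ← Real.exp_mul]
    congr 2; ring
  simp_rw [e]
  rw [← ofReal_integral_eq_lintegral_ofReal hi (Eventually.of_forall fun x => (Real.exp_pos _).le),
    h1, ENNReal.ofReal_rpow_of_nonneg (by positivity) (by positivity),
    ← Real.rpow_mul (by positivity), finrank_euclideanSpace_fin,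
    ← Real.mul_rpow (by positivity) hρ.le]
  congr 2
  · field_simp
  · field_simp

lemma dgauss_abs_le (n : ℕ) {ρ : ℝ} (hρ : 0 < ρ) (j : Fin n) (x : Rn n) :
    |dgauss n ρ j x| ≤ (2 * Real.pi * Real.pi ^ ((n:ℝ) / 2)) * ρ ^ (-((n:ℝ) / 2 + 1 / 2)) *
      Real.exp (-(Real.pi ^ 2 / 2 * ‖x‖ ^ 2 / ρ)) := by
  have h2 := PiLp.norm_apply_le x j
  unfold dgauss gauss
  rw [abs_mul, abs_of_nonneg (by positivity : 0 ≤ (Real.pi / ρ) ^ ((n:ℝ) / 2) *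
    Real.exp (-(Real.pi ^ 2 * ‖x‖ ^ 2 / ρ))), abs_neg, abs_div, abs_mul, abs_of_pos hρ,
    abs_of_nonneg (by positivity : 0 ≤ 2 * Real.pi ^ 2)]
  set y := Real.pi * ‖x‖ / Real.sqrt ρ with hy
  have hs : Real.sqrt ρ * Real.sqrt ρ = ρ := Real.mul_self_sqrt hρ.le
  have hs0 : 0 < Real.sqrt ρ := Real.sqrt_pos.2 hρ
  have hy2 : Real.pi ^ 2 * ‖x‖ ^ 2 / ρ = y ^ 2 := by
    rw [hy, div_pow, mul_pow, Real.sq_sqrt hρ.le]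
  have hy3 : Real.pi ^ 2 / 2 * ‖x‖ ^ 2 / ρ = y ^ 2 / 2 := by rw [← hy2]; ring
  have hyb : y * Real.exp (-(y ^ 2)) ≤ Real.exp (-(y ^ 2 / 2)) := by
    have h3 : y ≤ Real.exp (y ^ 2 / 2) := by
      have := Real.add_one_le_exp (y ^ 2 / 2)
      nlinarith [sq_nonneg (y - 1)]
    calc y * Real.exp (-(y ^ 2)) ≤ Real.exp (y ^ 2 / 2) * Real.exp (-(y ^ 2)) := by gcongr
      _ = _ := by rw [← Real.exp_add]; congr 1; ring
  have e1 : ρ ^ (-((n:ℝ) / 2 + 1 / 2)) = (ρ ^ ((n:ℝ) / 2))⁻¹ * (Real.sqrt ρ)⁻¹ := by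
    rw [Real.rpow_neg hρ.le, Real.rpow_add hρ, ← Real.sqrt_eq_rpow, mul_inv]
  rw [hy2, hy3, e1, Real.div_rpow Real.pi_pos.le hρ.le]
  have h3 : |x j| ≤ ‖x‖ := h2
  calc 2 * Real.pi ^ 2 * |x j| / ρ * (Real.pi ^ ((n:ℝ) / 2) / ρ ^ ((n:ℝ) / 2) * Real.exp (-y ^ 2))
      ≤ 2 * Real.pi ^ 2 * ‖x‖ / ρ * (Real.pi ^ ((n:ℝ) / 2) / ρ ^ ((n:ℝ) / 2) * Real.exp (-y ^ 2)) := by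
        gcongr
    _ = (2 * Real.pi * Real.pi ^ ((n:ℝ) / 2)) * ((ρ ^ ((n:ℝ) / 2))⁻¹ * (Real.sqrt ρ)⁻¹) *
          (y * Real.exp (-(y ^ 2))) := by
        rw [hy]; nth_rewrite 1 [← hs]; field_simp
    _ ≤ _ := by gcongr

/-- The kernel as a mixture of Gaussians; equals `gKer` for `t > 0`. -/
def gMix (n : ℕ) (α : ℝ) (η : Measure ℝ) (t : ℝ) (x : Rn n) : ℝ :=
  ∫ r, gauss n (r * t ^ (1 / α)) x ∂η

/-- The derivative of the kernel as a mixture; equals `dKer` for `t > 0`. -/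
def dMix (n : ℕ) (α : ℝ) (η : Measure ℝ) (j : Fin n) (t : ℝ) (x : Rn n) : ℝ :=
  ∫ r, dgauss n (r * t ^ (1 / α)) j x ∂η

lemma gMix_measurable (n : ℕ) (α : ℝ) (η : Measure ℝ) [SFinite η] :
    Measurable (Function.uncurry (gMix n α η)) := by
  have h : Measurable (fun z : (ℝ × Rn n) × ℝ => gauss n (z.2 * z.1.1 ^ (1 / α)) z.1.2) :=
    (gauss_measurable n).comp (f := fun z : (ℝ × Rn n) × ℝ => (z.2 * z.1.1 ^ (1 / α), z.1.2))
      (by fun_prop)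
  exact (h.stronglyMeasurable.integral_prod_right' (ν := η)).measurable

lemma dMix_measurable (n : ℕ) (α : ℝ) (η : Measure ℝ) [SFinite η] (j : Fin n) :
    Measurable (Function.uncurry (dMix n α η j)) := by
  have h : Measurable (fun z : (ℝ × Rn n) × ℝ => dgauss n (z.2 * z.1.1 ^ (1 / α)) j z.1.2) :=
    (dgauss_measurable n j).comp (f := fun z : (ℝ × Rn n) × ℝ => (z.2 * z.1.1 ^ (1 / α), z.1.2))
      (by fun_prop)
  exact (h.stronglyMeasurable.integral_prod_right' (ν := η)).measurable

lemma IsStable.lnorm_mixture_le {α : ℝ} {η : Measure ℝ} (h : IsStable α η) (hα : 0 < α) (n : ℕ)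
    {Φ : ℝ → Rn n → ℝ} (hΦ : Measurable (Function.uncurry Φ)) {a e c r : ℝ} (ha : 0 < a)
    (hc : 0 < c) (hr : 1 ≤ r) (he : 0 ≤ e - n / (2 * r))
    (hbd : ∀ ρ, 0 < ρ → ∀ x, |Φ ρ x| ≤ a * ρ ^ (-e) * Real.exp (-(c * ‖x‖ ^ 2 / ρ))) :
    ∃ C > 0, ∀ t > 0, lnorm volume r (fun x => ‖∫ s, Φ (s * t ^ (1 / α)) x ∂η‖ₑ) ≤
      ENNReal.ofReal (C * t ^ (-(1 / α * (e - n / (2 * r))))) := by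
  have := h.prob
  have hr0 : 0 < r := by linarith
  set θ := e - n / (2 * r) with hθ
  have hI := h.integrable_rpow_neg hα he
  set J := ∫ s, s ^ (-θ) ∂η with hJ
  have hnn : 0 ≤ᵐ[η] fun s => s ^ (-θ) := by
    filter_upwards [h.pos] with s hs using Real.rpow_nonneg hs.le _
  have hJ0 : 0 ≤ J := integral_nonneg_of_ae hnn
  refine ⟨a * (Real.pi / (r * c)) ^ ((n:ℝ) / (2 * r)) * (J + 1), by positivity, fun t ht => ?_⟩
  set τ := t ^ (1 / α) with hτ
  have hτ0 : 0 < τ := Real.rpow_pos_of_pos ht _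
  have hm : Measurable (Function.uncurry fun (s : ℝ) (x : Rn n) => ‖Φ (s * τ) x‖ₑ) :=
    (hΦ.comp (f := fun z : ℝ × Rn n => (z.1 * τ, z.2)) (by fun_prop)).enorm
  have h1 : lnorm volume r (fun x => ‖∫ s, Φ (s * τ) x ∂η‖ₑ) ≤
      lnorm volume r (fun x => ∫⁻ s, ‖Φ (s * τ) x‖ₑ ∂η) :=
    lnorm_mono hr0.le (Eventually.of_forall fun x => enorm_integral_le_lintegral_enorm _)
  refine (h1.trans (minkowski_integral hr hm)).trans ?_
  have h2 : ∀ᵐ s ∂η, lnorm volume r (fun x => ‖Φ (s * τ) x‖ₑ) ≤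
      ENNReal.ofReal (a * (Real.pi / (r * c)) ^ ((n:ℝ) / (2 * r)) * τ ^ (-θ)) *
        ENNReal.ofReal (s ^ (-θ)) := by
    filter_upwards [h.pos] with s hs
    have hρ : 0 < s * τ := by positivity
    have h3 : lnorm volume r (fun x => ‖Φ (s * τ) x‖ₑ) ≤ lnorm volume r (fun x : Rn n =>
        ENNReal.ofReal (a * (s * τ) ^ (-e)) *
          ENNReal.ofReal (Real.exp (-(c * ‖x‖ ^ 2 / (s * τ))))) := by
      refine lnorm_mono hr0.le (Eventually.of_forall fun x => ?_)
      beta_reduce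
      rw [Real.enorm_eq_ofReal_abs, ← ENNReal.ofReal_mul (by positivity)]
      exact ENNReal.ofReal_le_ofReal (hbd _ hρ x)
    refine h3.trans ?_
    rw [lnorm_const_mul hr0 _ (by fun_prop), lnorm_gaussian n hc hρ hr0,
      ← ENNReal.ofReal_mul (by positivity), ← ENNReal.ofReal_mul (by positivity)]
    refine ENNReal.ofReal_le_ofReal (le_of_eq ?_)
    have : (s * τ) ^ (-e) * (s * τ) ^ ((n:ℝ) / (2 * r)) = τ ^ (-θ) * s ^ (-θ) := by
      rw [← Real.rpow_add hρ, mul_comm (τ ^ _), ← Real.mul_rpow hs.le hτ0.le]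
      congr 1; rw [hθ]; ring
    linear_combination a * (Real.pi / (r * c)) ^ ((n:ℝ) / (2 * r)) * this
  refine (lintegral_mono_ae h2).trans ?_
  rw [lintegral_const_mul' _ _ ENNReal.ofReal_ne_top,
    ← ofReal_integral_eq_lintegral_ofReal hI hnn, ← ENNReal.ofReal_mul (by positivity)]
  refine ENNReal.ofReal_le_ofReal ?_
  have e3 : t ^ (-(1 / α * θ)) = τ ^ (-θ) := by
    rw [hτ, ← Real.rpow_mul ht.le]; congr 1; ring
  rw [e3]
  have : 0 ≤ a * (Real.pi / (r * c)) ^ ((n:ℝ) / (2 * r)) * τ ^ (-θ) := by positivity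
  nlinarith

lemma IsStable.lnorm_gMix_le {α : ℝ} {η : Measure ℝ} (h : IsStable α η) (hα : 0 < α) (n : ℕ)
    {r : ℝ} (hr : 1 ≤ r) : ∃ C > 0, ∀ t > 0, lnorm volume r (fun x => ‖gMix n α η t x‖ₑ) ≤
      ENNReal.ofReal (C * t ^ (-(n / (2 * α) * (1 - 1 / r)))) := by
  have hr0 : 0 < r := by linarith
  obtain ⟨C, hC, H⟩ := h.lnorm_mixture_le hα n (gauss_measurable n) (a := Real.pi ^ ((n:ℝ) / 2))
    (e := n / 2) (c := Real.pi ^ 2) (by positivity) (by positivity) hr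
    (by
      have : (n:ℝ) / 2 - n / (2 * r) = n / 2 * (1 - 1 / r) := by field_simp
      rw [this]
      have : 1 / r ≤ 1 := by rw [div_le_one hr0]; exact hr
      have : 0 ≤ 1 - 1 / r := by linarith
      positivity)
    (fun ρ hρ x => by
      rw [abs_of_nonneg (gauss_nonneg n hρ x), gauss, Real.div_rpow Real.pi_pos.le hρ.le,
        Real.rpow_neg hρ.le, div_eq_mul_inv])
  refine ⟨C, hC, fun t ht => (H t ht).trans (le_of_eq ?_)⟩
  congr 3; field_simp

lemma IsStable.lnorm_dMix_le {α : ℝ} {η : Measure ℝ} (h : IsStable α η) (hα : 0 < α) (n : ℕ)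
    {r : ℝ} (hr : 1 ≤ r) : ∃ C > 0, ∀ j, ∀ t > 0, lnorm volume r (fun x => ‖dMix n α η j t x‖ₑ) ≤
      ENNReal.ofReal (C * t ^ (-(1 / (2 * α) + n / (2 * α) * (1 - 1 / r)))) := by
  have hr0 : 0 < r := by linarith
  have key : ∀ j : Fin n, ∃ C > 0, ∀ t > 0, lnorm volume r (fun x => ‖dMix n α η j t x‖ₑ) ≤
      ENNReal.ofReal (C * t ^ (-(1 / (2 * α) + n / (2 * α) * (1 - 1 / r)))) := by
    intro j
    obtain ⟨C, hC, H⟩ := h.lnorm_mixture_le hα n (dgauss_measurable n j)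
      (a := 2 * Real.pi * Real.pi ^ ((n:ℝ) / 2))
      (e := n / 2 + 1 / 2) (c := Real.pi ^ 2 / 2) (by positivity) (by positivity) hr
      (by
        have : (n:ℝ) / 2 + 1 / 2 - n / (2 * r) = n / 2 * (1 - 1 / r) + 1 / 2 := by field_simp; ring
        rw [this]
        have : 1 / r ≤ 1 := by rw [div_le_one hr0]; exact hr
        have : 0 ≤ 1 - 1 / r := by linarith
        positivity)
      (fun ρ hρ x => dgauss_abs_le n hρ j x)
    refine ⟨C, hC, fun t ht => (H t ht).trans (le_of_eq ?_)⟩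
    congr 3; field_simp; ring
  choose C hC H using key
  refine ⟨1 + ∑ j, C j, by have := Finset.sum_nonneg (fun j (_ : j ∈ Finset.univ) => (hC j).le); linarith,
    fun j t ht => (H j t ht).trans (ENNReal.ofReal_le_ofReal ?_)⟩
  have := Finset.single_le_sum (fun j _ => (hC j).le) (Finset.mem_univ j)
  gcongr
  linarith

lemma IsPembq.log_bound {n : ℕ} (hn : 1 ≤ n) {q : ℝ} (hq : 1 < q) {qb : Rn n → ℝ}
    (h : IsPembq n q qb) :
    ∃ C > 0, ∀ x, |1 / qb x - 1 / q| ≤ C / Real.log (Real.exp 1 + ‖x‖) := by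
  obtain ⟨⟨-, h1, C₁, -, C₂, hC₂, pinf, -, hdec⟩, -, -, hlim⟩ := h
  have : Nonempty (Fin n) := ⟨⟨0, hn⟩⟩
  have : Nontrivial (Rn n) := inferInstance
  have : NoncompactSpace (Rn n) := NormedSpace.noncompactSpace ℝ (Rn n)
  have hlog : Tendsto (fun x : Rn n => C₂ / Real.log (Real.exp 1 + ‖x‖)) (cocompact (Rn n)) (𝓝 0) :=
    (Real.tendsto_log_atTop.comp (tendsto_atTop_add_const_left _ _
      (tendsto_norm_cocompact_atTop (E := Rn n)))).const_div_atTop C₂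
  have t1 : Tendsto (fun x => 1 / qb x) (cocompact (Rn n)) (𝓝 (1 / pinf)) := by
    rw [tendsto_iff_norm_sub_tendsto_zero]
    exact squeeze_zero (fun x => norm_nonneg _) (fun x => hdec x (mem_univ x)) hlog
  have t2 : Tendsto (fun x => 1 / qb x) (cocompact (Rn n)) (𝓝 (1 / q)) := by
    have h3 := hlim.inv_tendsto_atTop.const_sub (1 / q)
    rw [sub_zero] at h3
    refine h3.congr' ?_
    filter_upwards [hlim.eventually_gt_atTop 0] with x hx
    have hx1 := h1 x (mem_univ x)
    have hne : qb x - q ≠ 0 := fun h0 => by rw [h0] at hx; simp at hx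
    simp only [Pi.inv_apply]
    field_simp
    ring
  have e := tendsto_nhds_unique t1 t2
  exact ⟨C₂, hC₂, fun x => by rw [← e]; exact hdec x (mem_univ x)⟩

/-- `L^{q̄(·)}` embeds into `L^q`. -/
lemma IsPembq.embedding {n : ℕ} (hn : 1 ≤ n) {q : ℝ} (hq : 1 < q) {qb : Rn n → ℝ}
    (h : IsPembq n q qb) :
    ∃ C : ℝ≥0∞, C ≠ ⊤ ∧ ∀ g : Rn n → ℝ≥0∞, Measurable g →
      lnorm volume q g ≤ C * luxNorm volume qb g := by
  obtain ⟨C₂, hC₂, hdec⟩ := h.log_bound hn hq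
  obtain ⟨⟨hqm, h1, -⟩, hess, ⟨M, hM⟩, -⟩ := h
  have hq0 : 0 < q := by linarith
  have hge : ∀ᵐ x ∂(volume : Measure (Rn n)), q ≤ qb x := by
    have := ae_essInf_le (f := qb) (μ := (volume : Measure (Rn n)))
      (isBoundedUnder_of_eventually_ge (a := 1) (Eventually.of_forall fun x => h1 x (mem_univ x)))
    filter_upwards [this] with x hx using hess.trans hx
  have hM0 : 0 < M := by
    obtain ⟨x, hx1, hx2⟩ := (hM.and hge).exists
    linarith
  set K : ℝ := Real.exp (C₂ * M * (n + 1)) with hK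
  have hK1 : 1 ≤ K := Real.one_le_exp (by positivity)
  set w : Rn n → ℝ := fun x => (1 + ‖x‖) ^ (-((n:ℝ) + 1)) with hw
  have hwi : Integrable w := integrable_one_add_norm (by simp)
  have hpt : ∀ᵐ x ∂(volume : Measure (Rn n)), ∀ v : ℝ≥0∞,
      v ^ q ≤ ENNReal.ofReal K * v ^ qb x + ENNReal.ofReal (w x) := by
    filter_upwards [hge, hM] with x hx1 hx2 v
    have hK1' : 1 ≤ ENNReal.ofReal K := by simpa using hK1
    by_cases hc : v ^ q ≤ ENNReal.ofReal K * v ^ qb x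
    · exact hc.trans le_self_add
    rw [not_le] at hc
    have hvt : v ≠ ⊤ := by
      rintro rfl
      rw [ENNReal.top_rpow_of_pos (by linarith), ENNReal.mul_top (by positivity)] at hc
      exact not_top_lt hc
    have hv0 : v ≠ 0 := by
      rintro rfl
      rw [ENNReal.zero_rpow_of_pos hq0] at hc
      exact not_lt_bot hc
    lift v to NNReal using hvt
    have hv0 : (0:ℝ) < v := by
      have : v ≠ 0 := by simpa using hv0
      positivity
    have hlt : K * (v:ℝ) ^ qb x < (v:ℝ) ^ q := by
      rw [← ENNReal.ofReal_coe_nnreal, ENNReal.ofReal_rpow_of_pos hv0,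
        ENNReal.ofReal_rpow_of_pos hv0, ← ENNReal.ofReal_mul (by positivity)] at hc
      exact (ENNReal.ofReal_lt_ofReal_iff (by positivity)).1 hc
    have hgt : q < qb x := by
      refine lt_of_le_of_ne hx1 fun heq => ?_
      rw [← heq] at hlt
      have : 0 < (v:ℝ) ^ q := by positivity
      nlinarith
    refine le_trans ?_ le_add_self
    rw [← ENNReal.ofReal_coe_nnreal, ENNReal.ofReal_rpow_of_pos hv0]
    refine ENNReal.ofReal_le_ofReal ?_
    have hlog := Real.log_lt_log (by positivity) hlt
    rw [Real.log_mul (by positivity) (by positivity), Real.log_rpow hv0, Real.log_rpow hv0, hK,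
      Real.log_exp] at hlog
    have hL : 1 ≤ Real.log (Real.exp 1 + ‖x‖) := by
      rw [Real.le_log_iff_exp_le (by positivity)]
      linarith [norm_nonneg x]
    have hd := hdec x
    rw [abs_sub_comm, abs_of_nonneg (by
      rw [sub_nonneg]; exact one_div_le_one_div_of_le hq0 hx1), le_div_iff₀ (by linarith)] at hd
    have hd2 : (qb x - q) * Real.log (Real.exp 1 + ‖x‖) ≤ C₂ * M * q := by
      have hqx : 0 < qb x := by linarith
      have e : 1 / q - 1 / qb x = (qb x - q) / (q * qb x) := by field_simp
      rw [e, div_mul_eq_mul_div, div_le_iff₀ (by positivity)] at hd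
      refine hd.trans ?_
      have : C₂ * q * qb x ≤ C₂ * q * M := by gcongr
      linarith
    have hL2 : Real.log (1 + ‖x‖) ≤ Real.log (Real.exp 1 + ‖x‖) := by
      refine Real.log_le_log (by positivity) ?_
      have := Real.add_one_le_exp (1:ℝ)
      linarith
    have hfin : q * Real.log v ≤ -((n:ℝ) + 1) * Real.log (1 + ‖x‖) := by
      have hpos : 0 < qb x - q := by linarith
      have h5 : (qb x - q) * Real.log v < -(C₂ * M * (n + 1)) := by linarith
      have h6 : (qb x - q) * (q * Real.log v) ≤
          (qb x - q) * (-((n:ℝ) + 1) * Real.log (Real.exp 1 + ‖x‖)) := by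
        nlinarith [mul_le_mul_of_nonneg_left hd2 (by positivity : 0 ≤ (n:ℝ) + 1),
          mul_lt_mul_of_pos_left h5 hq0]
      have h7 := le_of_mul_le_mul_left h6 hpos
      have h8 := mul_le_mul_of_nonneg_left hL2 (by positivity : 0 ≤ (n:ℝ) + 1)
      linarith
    rw [hw]
    simp only
    rw [Real.rpow_def_of_pos hv0, Real.rpow_def_of_pos (by positivity)]
    refine Real.exp_le_exp.2 ?_
    linarith
  set D : ℝ≥0∞ := ENNReal.ofReal K + ∫⁻ x, ENNReal.ofReal (w x) with hD
  have hDt : D ≠ ⊤ := ENNReal.add_ne_top.2 ⟨ENNReal.ofReal_ne_top, hwi.lintegral_lt_top.ne⟩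
  have hD0 : D ≠ 0 := by
    have : 0 < ENNReal.ofReal K := by rw [ENNReal.ofReal_pos]; linarith
    exact (lt_of_lt_of_le this le_self_add).ne'
  have hC0 : D ^ (1 / q) ≠ 0 := by
    rw [Ne, ENNReal.rpow_eq_zero_iff_of_pos (by positivity)]; exact hD0
  have hCt : D ^ (1 / q) ≠ ⊤ := ENNReal.rpow_ne_top_of_nonneg (by positivity) hDt
  refine ⟨D ^ (1 / q), hCt, fun g hg => ?_⟩
  rw [mul_comm, ← ENNReal.div_le_iff hC0 hCt]
  refine le_sInf fun lam hlam => ?_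
  obtain ⟨hl0, hl⟩ := hlam
  rw [ENNReal.div_le_iff hC0 hCt]
  by_cases hlt : lam = ⊤
  · rw [hlt, ENNReal.top_mul hC0]; exact le_top
  have e : g = fun x => lam * (g x / lam) := by
    ext x; rw [ENNReal.mul_div_cancel hl0.ne' hlt]
  rw [e, lnorm_const_mul hq0 _ (hg.div_const lam).aemeasurable]
  gcongr
  rw [lnorm_le_iff hq0, ← ENNReal.rpow_mul, one_div_mul_cancel hq0.ne', ENNReal.rpow_one]
  calc ∫⁻ x, (g x / lam) ^ q ≤ ∫⁻ x, (ENNReal.ofReal K * (g x / lam) ^ qb x + ENNReal.ofReal (w x)) :=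
        lintegral_mono_ae (by filter_upwards [hpt] with x hx using hx _)
    _ = ENNReal.ofReal K * (∫⁻ x, (g x / lam) ^ qb x) + ∫⁻ x, ENNReal.ofReal (w x) := by
        rw [lintegral_add_right _ (by fun_prop), lintegral_const_mul' _ _ ENNReal.ofReal_ne_top]
    _ ≤ D := by
        rw [hD]; gcongr
        exact mul_le_of_le_one_right (by positivity) hl

/-- The one-sided Riemann–Liouville potential on the line. -/
def fracInt (δ : ℝ) (D : ℝ → ℝ≥0∞) (t : ℝ) : ℝ≥0∞ :=
  ∫⁻ τ in Ioi (0:ℝ), ENNReal.ofReal (τ ^ (δ - 1)) * D (t - τ)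

/-- Weak-type bound `∫_E D ≤ N |E|^θ` for all sets of finite measure. -/
def WeakBound (θ N : ℝ) (D : ℝ → ℝ≥0∞) : Prop :=
  ∀ E : Set ℝ, MeasurableSet E → volume E ≠ ⊤ →
    ∫⁻ t in E, D t ≤ ENNReal.ofReal (N * (volume E).toReal ^ θ)

lemma fracInt_measurable (δ : ℝ) {D : ℝ → ℝ≥0∞} (hD : Measurable D) : Measurable (fracInt δ D) := by
  unfold fracInt
  exact Measurable.lintegral_prod_right'
    (f := fun z : ℝ × ℝ => ENNReal.ofReal (z.2 ^ (δ - 1)) * D (z.1 - z.2)) (by fun_prop)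

lemma setLIntegral_comp_sub_right (D : ℝ → ℝ≥0∞) (hD : Measurable D) (F : Set ℝ)
    (hF : MeasurableSet F) (τ : ℝ) :
    ∫⁻ t in F, D (t - τ) = ∫⁻ s in (fun s => s + τ) ⁻¹' F, D s := by
  have h := (measurePreserving_sub_right (volume : Measure ℝ) τ).setLIntegral_comp_preimage
    (s := (fun s => s + τ) ⁻¹' F) (measurable_add_const τ hF) hD
  rw [← h, ← preimage_comp]
  congr 2
  ext x; simp

lemma lintegral_Ioi_rpow {a R : ℝ} (ha : a < -1) (hR : 0 < R) :
    ∫⁻ u in Ioi R, ENNReal.ofReal (u ^ a) = ENNReal.ofReal (-R ^ (a + 1) / (a + 1)) := by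
  rw [← integral_Ioi_rpow_of_lt ha hR,
    ofReal_integral_eq_lintegral_ofReal (integrableOn_Ioi_rpow_of_lt ha hR)]
  exact (ae_restrict_iff' measurableSet_Ioi).2
    (Eventually.of_forall fun u hu => Real.rpow_nonneg (hR.trans hu).le _)

lemma lintegral_Ioc_rpow {a R : ℝ} (ha : -1 < a) (hR : 0 ≤ R) :
    ∫⁻ u in Ioc 0 R, ENNReal.ofReal (u ^ a) = ENNReal.ofReal (R ^ (a + 1) / (a + 1)) := by
  have hi := intervalIntegral.intervalIntegrable_rpow' (a := 0) (b := R) ha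
  rw [intervalIntegrable_iff_integrableOn_Ioc_of_le hR] at hi
  have e := integral_rpow (a := 0) (b := R) (r := a) (Or.inl ha)
  rw [intervalIntegral.integral_of_le hR, Real.zero_rpow (by linarith), sub_zero] at e
  rw [← e, ofReal_integral_eq_lintegral_ofReal hi]
  exact (ae_restrict_iff' measurableSet_Ioc).2
    (Eventually.of_forall fun u hu => Real.rpow_nonneg hu.1.le _)

lemma WeakBound.far {θ N δ : ℝ} {D : ℝ → ℝ≥0∞} (hD : Measurable D) (hN : 0 ≤ N)
    (hθ : 0 < θ) (hθδ : θ + δ < 1) (h : WeakBound θ N D) {R : ℝ} (hR : 0 < R) (t : ℝ) :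
    ∫⁻ τ in Ioi R, ENNReal.ofReal (τ ^ (δ - 1)) * D (t - τ) ≤
      ENNReal.ofReal ((1 - δ) / (1 - δ - θ) * N * R ^ (θ + δ - 1)) := by
  have e1 : ∀ τ ∈ Ioi R, ENNReal.ofReal (τ ^ (δ - 1)) * D (t - τ) =
      ENNReal.ofReal (1 - δ) * ∫⁻ u in Ioi R,
        (if τ < u then ENNReal.ofReal (u ^ (δ - 2)) * D (t - τ) else 0) := by
    intro τ hτ
    have hτ0 : 0 < τ := hR.trans hτ
    have e2 : ∫⁻ u in Ioi R, (if τ < u then ENNReal.ofReal (u ^ (δ - 2)) * D (t - τ) else 0) =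
        ∫⁻ u in Ioi τ, ENNReal.ofReal (u ^ (δ - 2)) * D (t - τ) := by
      rw [← lintegral_indicator measurableSet_Ioi, ← lintegral_indicator measurableSet_Ioi]
      congr 1; ext u
      by_cases hu : τ < u
      · rw [indicator_of_mem (show u ∈ Ioi R from lt_trans hτ hu), indicator_of_mem (show u ∈ Ioi τ from hu), if_pos hu]
      · rw [indicator_of_notMem (show u ∉ Ioi τ from hu)]
        simp [indicator, hu]
    rw [e2, lintegral_mul_const _ (by fun_prop), lintegral_Ioi_rpow (by linarith) hτ0, ← mul_assoc,
      ← ENNReal.ofReal_mul (by linarith)]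
    congr 2
    rw [show δ - 2 + 1 = δ - 1 by ring]
    have : δ - 1 ≠ 0 := by linarith
    field_simp
    ring
  rw [setLIntegral_congr_fun measurableSet_Ioi e1, lintegral_const_mul' _ _ ENNReal.ofReal_ne_top,
    lintegral_lintegral_swap]
  rotate_left
  · refine Measurable.aemeasurable ?_
    refine Measurable.ite (measurableSet_lt measurable_fst measurable_snd) (by fun_prop) (by fun_prop)
  have e3 : ∀ u ∈ Ioi R, ∫⁻ τ in Ioi R, (if τ < u then ENNReal.ofReal (u ^ (δ - 2)) * D (t - τ) else 0)
      ≤ ENNReal.ofReal N * ENNReal.ofReal (u ^ (θ + δ - 2)) := by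
    intro u hu
    have hu0 : 0 < u := hR.trans hu
    have h1 : ∫⁻ τ in Ioi R, (if τ < u then ENNReal.ofReal (u ^ (δ - 2)) * D (t - τ) else 0) ≤
        ∫⁻ τ in Ioo 0 u, ENNReal.ofReal (u ^ (δ - 2)) * D (t - τ) := by
      rw [← lintegral_indicator measurableSet_Ioi, ← lintegral_indicator measurableSet_Ioo]
      refine lintegral_mono fun τ => ?_
      by_cases h2 : R < τ ∧ τ < u
      · rw [indicator_of_mem (show τ ∈ Ioi R from h2.1), if_pos h2.2,
          indicator_of_mem (show τ ∈ Ioo 0 u from ⟨hR.trans h2.1, h2.2⟩)]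
      · by_cases h3 : R < τ
        · rw [indicator_of_mem (show τ ∈ Ioi R from h3), if_neg (fun h4 => h2 ⟨h3, h4⟩)]
          exact bot_le
        · rw [indicator_of_notMem (show τ ∉ Ioi R from h3)]
          exact bot_le
    refine h1.trans ?_
    rw [lintegral_const_mul' _ _ ENNReal.ofReal_ne_top]
    have h2 : ∫⁻ τ in Ioo 0 u, D (t - τ) = ∫⁻ s in Ioo (t - u) t, D s := by
      have := (Measure.measurePreserving_sub_left (volume : Measure ℝ) t).setLIntegral_comp_preimage
        (s := Ioo (t - u) t) measurableSet_Ioo hD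
      rw [← this]
      congr 2
      ext x; simp [and_comm]
    have h3 := h (Ioo (t - u) t) measurableSet_Ioo (by simp)
    rw [Real.volume_Ioo, show t - (t - u) = u by ring, ENNReal.toReal_ofReal hu0.le] at h3
    rw [h2]
    refine (mul_le_mul_right h3 _).trans (le_of_eq ?_)
    rw [← ENNReal.ofReal_mul (by positivity), ← ENNReal.ofReal_mul hN]
    congr 1
    rw [show θ + δ - 2 = (δ - 2) + θ by ring, Real.rpow_add hu0]; ring
  refine (mul_le_mul_right (setLIntegral_mono' measurableSet_Ioi e3) _).trans ?_
  rw [lintegral_const_mul' _ _ ENNReal.ofReal_ne_top, lintegral_Ioi_rpow (by linarith) hR,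
    ← ENNReal.ofReal_mul hN, ← ENNReal.ofReal_mul (by linarith)]
  refine ENNReal.ofReal_le_ofReal (le_of_eq ?_)
  rw [show θ + δ - 2 + 1 = θ + δ - 1 by ring]
  have h4 : θ + δ - 1 ≠ 0 := by linarith
  have h5 : 1 - δ - θ ≠ 0 := by linarith
  field_simp
  ring

lemma WeakBound.potential {θ N δ : ℝ} {D : ℝ → ℝ≥0∞} (hD : Measurable D) (hN : 0 ≤ N)
    (hθ : 0 < θ) (hδ : 0 < δ) (hθδ : θ + δ < 1) (h : WeakBound θ N D) :
    WeakBound (θ + δ) ((1 / δ + (1 - δ) / (1 - δ - θ)) * N) (fracInt δ D) := by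
  intro F hF hFt
  set R := (volume F).toReal with hR
  rcases (ENNReal.toReal_nonneg : 0 ≤ (volume F).toReal).eq_or_lt with h0 | hR0
  · have : volume F = 0 := by
      rcases (ENNReal.toReal_eq_zero_iff _).1 h0.symm with h | h
      · exact h
      · exact absurd h hFt
    rw [Measure.restrict_eq_zero.2 this]
    simp
  rw [← hR] at hR0
  have hvol : volume F = ENNReal.ofReal R := by rw [hR, ENNReal.ofReal_toReal hFt]
  have e0 : ∀ t, fracInt δ D t = (∫⁻ τ in Ioc 0 R, ENNReal.ofReal (τ ^ (δ - 1)) * D (t - τ)) +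
      ∫⁻ τ in Ioi R, ENNReal.ofReal (τ ^ (δ - 1)) * D (t - τ) := by
    intro t
    unfold fracInt
    rw [← lintegral_union measurableSet_Ioi (Ioc_disjoint_Ioi le_rfl), Ioc_union_Ioi_eq_Ioi hR0.le]
  have hm1 : Measurable fun t => ∫⁻ τ in Ioc 0 R, ENNReal.ofReal (τ ^ (δ - 1)) * D (t - τ) :=
    Measurable.lintegral_prod_right'
      (f := fun z : ℝ × ℝ => ENNReal.ofReal (z.2 ^ (δ - 1)) * D (z.1 - z.2)) (by fun_prop)
  simp_rw [e0]
  rw [lintegral_add_left hm1]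
  have near : ∫⁻ t in F, ∫⁻ τ in Ioc 0 R, ENNReal.ofReal (τ ^ (δ - 1)) * D (t - τ) ≤
      ENNReal.ofReal (N * R ^ θ * (R ^ δ / δ)) := by
    rw [lintegral_lintegral_swap (Measurable.aemeasurable (by fun_prop))]
    calc ∫⁻ τ in Ioc 0 R, ∫⁻ t in F, ENNReal.ofReal (τ ^ (δ - 1)) * D (t - τ)
        ≤ ∫⁻ τ in Ioc 0 R, ENNReal.ofReal (N * R ^ θ) * ENNReal.ofReal (τ ^ (δ - 1)) := by
          refine lintegral_mono fun τ => ?_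
          rw [lintegral_const_mul' _ _ ENNReal.ofReal_ne_top, setLIntegral_comp_sub_right D hD F hF,
            mul_comm (ENNReal.ofReal (N * R ^ θ))]
          have hv : volume ((fun s => s + τ) ⁻¹' F) = volume F :=
            measure_preimage_add_right volume τ F
          have := h _ (measurable_add_const τ hF) (by rw [hv]; exact hFt)
          rw [hv] at this
          gcongr
      _ = _ := by
          rw [lintegral_const_mul' _ _ ENNReal.ofReal_ne_top, lintegral_Ioc_rpow (by linarith) hR0.le,
            ← ENNReal.ofReal_mul (by positivity), show δ - 1 + 1 = δ by ring]
  have far : ∫⁻ t in F, ∫⁻ τ in Ioi R, ENNReal.ofReal (τ ^ (δ - 1)) * D (t - τ) ≤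
      ENNReal.ofReal ((1 - δ) / (1 - δ - θ) * N * R ^ (θ + δ - 1) * R) := by
    refine (lintegral_mono fun t => h.far hD hN hθ hθδ hR0 t).trans ?_
    rw [lintegral_const, Measure.restrict_apply MeasurableSet.univ, univ_inter, hvol,
      ← ENNReal.ofReal_mul]
    have : 0 < 1 - δ - θ := by linarith
    have : 0 < 1 - δ := by linarith
    positivity
  refine (add_le_add near far).trans ?_
  rw [← ENNReal.ofReal_add (by positivity)]
  · refine ENNReal.ofReal_le_ofReal (le_of_eq ?_)
    have e1 : R ^ (θ + δ - 1) * R = R ^ (θ + δ) := by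
      nth_rewrite 2 [← Real.rpow_one R]
      rw [← Real.rpow_add hR0]; ring_nf
    have e2 : R ^ θ * R ^ δ = R ^ (θ + δ) := (Real.rpow_add hR0 _ _).symm
    rw [mul_assoc _ _ R, e1, add_mul, add_mul, ← e2]; ring
  · have : 0 < 1 - δ - θ := by linarith
    have : 0 < 1 - δ := by linarith
    positivity

lemma WeakBound.superlevel {P B : ℝ} {Y : ℝ → ℝ≥0∞} (hP : 1 < P) (hB : 0 < B)
    (h : WeakBound (1 - 1 / P) B Y) {F : Set ℝ} (hF : MeasurableSet F) (hFt : volume F ≠ ⊤)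
    {lam : ℝ} (hlam : 0 < lam) (hle : ∀ t ∈ F, ENNReal.ofReal lam ≤ Y t) :
    volume F ≤ ENNReal.ofReal ((B / lam) ^ P) := by
  have h1 : ENNReal.ofReal lam * volume F ≤ ∫⁻ t in F, Y t := by
    rw [← setLIntegral_const]; exact setLIntegral_mono' hF hle
  have h2 := h1.trans (h F hF hFt)
  set e := (volume F).toReal with he
  have hv : volume F = ENNReal.ofReal e := by rw [he, ENNReal.ofReal_toReal hFt]
  have he0 : 0 ≤ e := ENNReal.toReal_nonneg
  rcases he0.eq_or_lt with h0 | h0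
  · rw [hv, ← h0]; simp
  rw [hv, ← ENNReal.ofReal_mul hlam.le, ENNReal.ofReal_le_ofReal_iff (by positivity)] at h2
  rw [hv]
  refine ENNReal.ofReal_le_ofReal ?_
  have h3 : e ^ (1 / P) ≤ B / lam := by
    rw [le_div_iff₀ hlam]
    have h4 : e = e ^ (1 / P) * e ^ (1 - 1 / P) := by
      rw [← Real.rpow_add h0]; simp
    have h5 : (e ^ (1 / P) * lam) * e ^ (1 - 1 / P) ≤ B * e ^ (1 - 1 / P) := by
      calc _ = lam * (e ^ (1 / P) * e ^ (1 - 1 / P)) := by ring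
        _ = lam * e := by rw [← h4]
        _ ≤ _ := h2
    exact le_of_mul_le_mul_right h5 (by positivity)
  calc e = (e ^ (1 / P)) ^ P := by
        rw [← Real.rpow_mul he0, one_div, inv_mul_cancel₀ (by linarith), Real.rpow_one]
    _ ≤ _ := Real.rpow_le_rpow (by positivity) h3 (by linarith)

lemma WeakBound.setLIntegral_rpow_le {P B s : ℝ} {Y : ℝ → ℝ≥0∞} (hY : Measurable Y) (hP : 1 < P)
    (hB : 0 < B) (hs : 0 < s) (hsP : s < P) (h : WeakBound (1 - 1 / P) B Y) {E : Set ℝ}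
    (hE : MeasurableSet E) (hEt : volume E ≠ ⊤) :
    ∫⁻ t in E, Y t ^ s ≤
      ENNReal.ofReal ((1 + s / (P - s)) * B ^ s * (volume E).toReal ^ (1 - s / P)) := by
  set e := (volume E).toReal with he
  have hv : volume E = ENNReal.ofReal e := by rw [he, ENNReal.ofReal_toReal hEt]
  have he0 : 0 ≤ e := ENNReal.toReal_nonneg
  rcases he0.eq_or_lt with h0 | h0
  · have : volume E = 0 := by rw [hv, ← h0]; simp
    rw [Measure.restrict_eq_zero.2 this]; simp
  have hfin : ∀ᵐ t ∂(volume.restrict E), Y t < ⊤ :=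
    ae_lt_top hY ((h E hE hEt).trans_lt ENNReal.ofReal_lt_top).ne
  have h1 : ∫⁻ t in E, Y t ^ s = ∫⁻ t in E, ENNReal.ofReal ((Y t).toReal ^ s) := by
    refine lintegral_congr_ae (hfin.mono fun t ht => ?_)
    beta_reduce
    rw [← ENNReal.ofReal_rpow_of_nonneg ENNReal.toReal_nonneg hs.le, ENNReal.ofReal_toReal ht.ne]
  rw [h1, lintegral_rpow_eq_lintegral_meas_lt_mul _
    (Eventually.of_forall fun t => ENNReal.toReal_nonneg) hY.ennreal_toReal.aemeasurable hs]
  set l := B * e ^ (-(1 / P)) with hl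
  have hl0 : 0 < l := by positivity
  rw [← Ioc_union_Ioi_eq_Ioi hl0.le, lintegral_union measurableSet_Ioi (Ioc_disjoint_Ioi le_rfl)]
  have a1 : ∫⁻ t in Ioc 0 l, (volume.restrict E) {a | t < (Y a).toReal} * ENNReal.ofReal (t ^ (s - 1))
      ≤ ENNReal.ofReal (e * (l ^ s / s)) := by
    calc _ ≤ ∫⁻ t in Ioc 0 l, ENNReal.ofReal e * ENNReal.ofReal (t ^ (s - 1)) := by
          refine lintegral_mono fun t => ?_
          refine mul_le_mul_left ?_ _
          rw [← hv, ← Measure.restrict_apply_univ E]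
          exact measure_mono (subset_univ _)
      _ = _ := by
          rw [lintegral_const_mul' _ _ ENNReal.ofReal_ne_top, lintegral_Ioc_rpow (by linarith) hl0.le,
            ← ENNReal.ofReal_mul he0]
          simp
  have a2 : ∫⁻ t in Ioi l, (volume.restrict E) {a | t < (Y a).toReal} * ENNReal.ofReal (t ^ (s - 1))
      ≤ ENNReal.ofReal (B ^ P * (l ^ (s - P) / (P - s))) := by
    calc _ ≤ ∫⁻ t in Ioi l, ENNReal.ofReal (B ^ P) * ENNReal.ofReal (t ^ (s - 1 - P)) := by
          refine setLIntegral_mono' measurableSet_Ioi fun t ht => ?_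
          have ht0 : 0 < t := hl0.trans ht
          have hm : MeasurableSet {a | t < (Y a).toReal} :=
            measurableSet_lt measurable_const hY.ennreal_toReal
          rw [Measure.restrict_apply hm]
          have := h.superlevel hP hB (hm.inter hE)
            (measure_ne_top_of_subset inter_subset_right hEt) ht0 (fun a ha => by
              rw [ENNReal.ofReal_le_iff_le_toReal]
              · exact ha.1.le
              · intro h9
                have := ha.1
                simp [h9] at this
                linarith)
          refine (mul_le_mul_left this _).trans (le_of_eq ?_)
          rw [← ENNReal.ofReal_mul (by positivity), ← ENNReal.ofReal_mul (by positivity),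
            Real.div_rpow hB.le ht0.le, Real.rpow_sub ht0 (s - 1) P]
          congr 1
          ring
      _ = _ := by
          rw [lintegral_const_mul' _ _ ENNReal.ofReal_ne_top, lintegral_Ioi_rpow (by linarith) hl0,
            ← ENNReal.ofReal_mul (by positivity)]
          congr 2
          rw [show s - 1 - P + 1 = s - P by ring, ← neg_sub P s, div_neg, neg_div, neg_neg]
  refine (mul_le_mul_right (add_le_add a1 a2) _).trans ?_
  have hPs : 0 < P - s := by linarith
  rw [← ENNReal.ofReal_add (by positivity) (by positivity), ← ENNReal.ofReal_mul hs.le]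
  refine ENNReal.ofReal_le_ofReal (le_of_eq ?_)
  have b1 : e * l ^ s = B ^ s * e ^ (1 - s / P) := by
    rw [hl, Real.mul_rpow hB.le (by positivity), ← Real.rpow_mul he0]
    nth_rewrite 1 [← Real.rpow_one e]
    rw [mul_left_comm, ← Real.rpow_add h0]
    congr 2; ring
  have b2 : B ^ P * l ^ (s - P) = B ^ s * e ^ (1 - s / P) := by
    rw [hl, Real.mul_rpow hB.le (by positivity), ← Real.rpow_mul he0, ← mul_assoc,
      ← Real.rpow_add hB]
    congr 2
    · ring
    · field_simp; ring
  have b3 : s * (e * (l ^ s / s) + B ^ P * (l ^ (s - P) / (P - s))) =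
      e * l ^ s + s / (P - s) * (B ^ P * l ^ (s - P)) := by
    field_simp
  rw [b3, b1, b2]; ring

lemma WeakBound.halve {δ m : ℝ} (hδ : 0 < δ) (hm : 1 < m) (hmδ : m * δ < 1) :
    ∃ ε > (0:ℝ), ∀ (A D : ℝ → ℝ≥0∞) (N : ℝ), Measurable A → Measurable D → 0 < N →
      (∀ᵐ t, D t ≤ A t * fracInt δ D t) → ∫⁻ t, A t ^ (1 / δ) ≤ ENNReal.ofReal (ε ^ (1 / δ)) →
      WeakBound (1 - 1 / m) N D → WeakBound (1 - 1 / m) (N / 2) D := by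
  have hm0 : 0 < m := by linarith
  have hδm : δ < 1 / m := by rw [lt_div_iff₀ hm0]; linarith
  have hm1 : 1 / m < 1 := by rw [div_lt_one hm0]; exact hm
  have hδ1 : δ < 1 := hδm.trans hm1
  obtain ⟨P, hP⟩ : ∃ P, P = 1 / (1 / m - δ) := ⟨_, rfl⟩
  have hPi : 1 / P = 1 / m - δ := by rw [hP, one_div_one_div]
  have hP1 : 1 < P := by rw [hP, lt_div_iff₀ (by linarith)]; linarith
  obtain ⟨s, hs⟩ : ∃ s, s = 1 / (1 - δ) := ⟨_, rfl⟩
  have hs0 : 0 < s := by rw [hs]; have : 0 < 1 - δ := by linarith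
                         positivity
  have hsi : 1 / s = 1 - δ := by rw [hs, one_div_one_div]
  have hsP : s < P := by rw [hs, hP]; exact one_div_lt_one_div_of_lt (by linarith) (by linarith)
  set θ := 1 - 1 / m with hθ
  have hθ0 : 0 < θ := by linarith
  set C1 := 1 / δ + (1 - δ) / (1 - δ - θ) with hC1
  have hC10 : 0 < C1 := by
    have : 0 < 1 - δ := by linarith
    have : 0 < 1 - δ - θ := by linarith
    positivity
  set C3 := 1 + s / (P - s) with hC3
  have hC30 : 0 < C3 := by
    have : 0 < P - s := by linarith
    positivity
  refine ⟨1 / (2 * C3 ^ (1 - δ) * C1), by positivity, fun A D N hA hD hN hAD hAε hW => ?_⟩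
  intro E hE hEt
  have hW2 : WeakBound (1 - 1 / P) (C1 * N) (fracInt δ D) := by
    have := hW.potential hD hN.le hθ0 hδ (by linarith)
    rwa [show θ + δ = 1 - 1 / P by rw [hPi]; ring] at this
  have hW3 := hW2.setLIntegral_rpow_le (fracInt_measurable δ hD) hP1 (by positivity) hs0 hsP hE hEt
  have hconj : (1 / δ).HolderConjugate s := by
    rw [Real.holderConjugate_iff]
    refine ⟨by rw [lt_div_iff₀ hδ]; linarith, ?_⟩
    rw [← one_div, ← one_div, hsi, one_div_one_div]; ring
  set e := (volume E).toReal with he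
  have he0 : 0 ≤ e := ENNReal.toReal_nonneg
  calc ∫⁻ t in E, D t ≤ ∫⁻ t in E, (A * fracInt δ D) t :=
        lintegral_mono_ae (ae_restrict_of_ae hAD)
    _ ≤ (∫⁻ t in E, A t ^ (1 / δ)) ^ (1 / (1 / δ)) * (∫⁻ t in E, fracInt δ D t ^ s) ^ (1 / s) :=
        ENNReal.lintegral_mul_le_Lp_mul_Lq _ hconj hA.aemeasurable
          (fracInt_measurable δ hD).aemeasurable
    _ ≤ ENNReal.ofReal ((1 / (2 * C3 ^ (1 - δ) * C1)) ^ (1 / δ)) ^ (1 / (1 / δ)) *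
        ENNReal.ofReal (C3 * (C1 * N) ^ s * e ^ (1 - s / P)) ^ (1 / s) := by
        gcongr
        exact (setLIntegral_le_lintegral _ _).trans hAε
    _ = ENNReal.ofReal (N / 2 * e ^ θ) := by
        rw [ENNReal.ofReal_rpow_of_nonneg (by positivity) (by positivity),
          ENNReal.ofReal_rpow_of_nonneg (by positivity) (by positivity),
          ← ENNReal.ofReal_mul (by positivity)]
        congr 1
        rw [← Real.rpow_mul (by positivity), mul_one_div_cancel (by positivity), Real.rpow_one,
          Real.mul_rpow (by positivity) (by positivity), Real.mul_rpow (by positivity) (by positivity),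
          ← Real.rpow_mul (by positivity), ← Real.rpow_mul he0, mul_one_div_cancel (by positivity),
          Real.rpow_one, hsi]
        have e1 : (1 - s / P) * (1 - δ) = θ := by
          rw [← hsi, sub_mul, one_mul, show s / P * (1 / s) = 1 / P by field_simp, hPi, hsi, hθ]; ring
        rw [e1]
        field_simp

/-- A fractional Volterra inequality with small scaling-critical coefficient has only the zero
solution. -/
lemma ae_eq_zero_of_le_mul_fracInt {δ m : ℝ} (hδ : 0 < δ) (hm : 1 < m) (hmδ : m * δ < 1) :
    ∃ ε > (0:ℝ), ∀ A D : ℝ → ℝ≥0∞, Measurable A → Measurable D → ∫⁻ t, D t ^ m ≠ ⊤ →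
      (∀ᵐ t, D t ≤ A t * fracInt δ D t) → ∫⁻ t, A t ^ (1 / δ) ≤ ENNReal.ofReal (ε ^ (1 / δ)) →
      ∀ᵐ t, D t = 0 := by
  obtain ⟨ε, hε, H⟩ := WeakBound.halve hδ hm hmδ
  refine ⟨ε, hε, fun A D hA hD hDm hAD hAε => ?_⟩
  have hm0 : 0 < m := by linarith
  set N := ((∫⁻ t, D t ^ m) ^ (1 / m)).toReal + 1 with hN
  have hN0 : 0 < N := by positivity
  have hfin : (∫⁻ t, D t ^ m) ^ (1 / m) ≠ ⊤ := ENNReal.rpow_ne_top_of_nonneg (by positivity) hDm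
  have hW0 : WeakBound (1 - 1 / m) N D := by
    intro E hE hEt
    have hconj : m.HolderConjugate (Real.conjExponent m) := Real.HolderConjugate.conjExponent hm
    have h1 := ENNReal.lintegral_mul_le_Lp_mul_Lq (volume.restrict E) hconj
      hD.aemeasurable (g := fun _ => 1) aemeasurable_const
    have h2 : 1 / Real.conjExponent m = 1 - 1 / m := by
      rw [one_div, one_div]; linarith [hconj.inv_add_inv_eq_one]
    simp only [ENNReal.one_rpow, lintegral_const, one_mul, Measure.restrict_apply MeasurableSet.univ,
      univ_inter, Pi.mul_apply, mul_one, h2] at h1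
    refine h1.trans ?_
    rw [ENNReal.ofReal_mul hN0.le, ← ENNReal.ofReal_rpow_of_nonneg ENNReal.toReal_nonneg (by
      rw [sub_nonneg, div_le_one hm0]; exact hm.le), ENNReal.ofReal_toReal hEt]
    gcongr
    refine le_trans ?_ (ENNReal.ofReal_le_ofReal (le_add_of_nonneg_right zero_le_one))
    rw [ENNReal.ofReal_toReal hfin]
    gcongr
    exact Measure.restrict_le_self
  have hWk : ∀ k : ℕ, WeakBound (1 - 1 / m) (N / 2 ^ k) D := by
    intro k
    induction k with
    | zero => simpa using hW0
    | succ k ih =>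
      have := H A D (N / 2 ^ k) hA hD (by positivity) hAD hAε ih
      rwa [div_div, ← pow_succ] at this
  have hz : ∀ E : Set ℝ, MeasurableSet E → volume E ≠ ⊤ → ∫⁻ t in E, D t = 0 := by
    intro E hE hEt
    refine le_antisymm (ge_of_tendsto' (x := atTop) (f := fun k : ℕ =>
      ENNReal.ofReal (N / 2 ^ k * (volume E).toReal ^ (1 - 1 / m))) ?_ fun k => hWk k E hE hEt) bot_le
    rw [← ENNReal.ofReal_zero]
    refine ENNReal.tendsto_ofReal ?_
    have h3 : Tendsto (fun k : ℕ => N * (1 / 2 : ℝ) ^ k * (volume E).toReal ^ (1 - 1 / m)) atTop (𝓝 0) := by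
      have := ((tendsto_pow_atTop_nhds_zero_of_lt_one (r := (1 / 2 : ℝ)) (by norm_num)
        (by norm_num)).const_mul N).mul_const ((volume E).toReal ^ (1 - 1 / m))
      simpa using this
    refine h3.congr fun k => ?_
    rw [one_div, inv_pow]; rfl
  have : ∫⁻ t, D t = 0 := by
    rw [← setLIntegral_univ, ← iUnion_Icc_intCast]
    refine le_antisymm ((lintegral_iUnion_le _ _).trans (le_of_eq ?_)) bot_le
    exact ENNReal.tsum_eq_zero.2 fun k => hz _ measurableSet_Icc (by simp)
  exact (lintegral_eq_zero_iff hD).1 this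

/-- Positive space-time convolution on `(0,t)` with kernel `κ`. -/
def duh {n : ℕ} (κ : ℝ → Rn n → ℝ≥0∞) (H : ℝ → Rn n → ℝ≥0∞) (t : ℝ) (x : Rn n) : ℝ≥0∞ :=
  ∫⁻ s in Ioo 0 t, ∫⁻ y, κ (t - s) (x - y) * H s y

/-- Volterra operator with kernel `C τ^{-β}`. -/
def volt (C β : ℝ) (G : ℝ → ℝ≥0∞) (t : ℝ) : ℝ≥0∞ :=
  ∫⁻ s in Ioo 0 t, ENNReal.ofReal (C * (t - s) ^ (-β)) * G s

section
variable {n : ℕ} {κ : ℝ → Rn n → ℝ≥0∞} {H : ℝ → Rn n → ℝ≥0∞}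

lemma lintegral_kernel_measurable (hκ : Measurable (Function.uncurry κ))
    (hH : Measurable (Function.uncurry H)) :
    Measurable (fun z : (ℝ × Rn n) × ℝ => ∫⁻ y, κ (z.1.1 - z.2) (z.1.2 - y) * H z.2 y) := by
  refine Measurable.lintegral_prod_right'
    (f := fun w : ((ℝ × Rn n) × ℝ) × Rn n => κ (w.1.1.1 - w.1.2) (w.1.1.2 - w.2) * H w.1.2 w.2) ?_
  exact (hκ.comp (f := fun w : ((ℝ × Rn n) × ℝ) × Rn n => (w.1.1.1 - w.1.2, w.1.1.2 - w.2))
    (by fun_prop)).mul (hH.comp (f := fun w : ((ℝ × Rn n) × ℝ) × Rn n => (w.1.2, w.2)) (by fun_prop))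

lemma duh_measurable (hκ : Measurable (Function.uncurry κ)) (hH : Measurable (Function.uncurry H)) :
    Measurable (Function.uncurry (duh κ H)) := by
  have h1 : Function.uncurry (duh κ H) = fun z : ℝ × Rn n => ∫⁻ s, ({w : (ℝ × Rn n) × ℝ | w.2 ∈ Ioo 0 w.1.1}.indicator
      (fun w => ∫⁻ y, κ (w.1.1 - w.2) (w.1.2 - y) * H w.2 y)) (z, s) := by
    ext z
    rw [Function.uncurry, duh, ← lintegral_indicator measurableSet_Ioo]
    rfl
  rw [h1]
  refine Measurable.lintegral_prod_right' ((lintegral_kernel_measurable hκ hH).indicator ?_)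
  exact (measurableSet_lt measurable_const measurable_snd).inter
    (measurableSet_lt measurable_snd measurable_fst.fst)

lemma volt_measurable (C β : ℝ) {G : ℝ → ℝ≥0∞} (hG : Measurable G) : Measurable (volt C β G) := by
  have h1 : volt C β G = fun t => ∫⁻ s, ({w : ℝ × ℝ | w.2 ∈ Ioo 0 w.1}.indicator
      (fun w => ENNReal.ofReal (C * (w.1 - w.2) ^ (-β)) * G w.2)) (t, s) := by
    ext t
    rw [volt, ← lintegral_indicator measurableSet_Ioo]
    rfl
  rw [h1]
  refine Measurable.lintegral_prod_right' (Measurable.indicator (by fun_prop) ?_)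
  exact (measurableSet_lt measurable_const measurable_snd).inter
    (measurableSet_lt measurable_snd measurable_fst)

lemma lnorm_conv_le {g F : Rn n → ℝ≥0∞} (hg : Measurable g) (hF : Measurable F) {r m ρ : ℝ}
    (hr : 1 ≤ r) (hm : 1 ≤ m) (hρ : 0 < ρ) (hexp : 1 + 1 / ρ = 1 / r + 1 / m) :
    lnorm volume ρ (fun x => ∫⁻ y, g (x - y) * F y) ≤ lnorm volume r g * lnorm volume m F := by
  refine schur_young hr hm hρ hexp (κ := fun x y => g (x - y)) (by
    exact hg.comp (measurable_fst.sub measurable_snd)) hF ?_ ?_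
  · intro x
    refine le_of_eq ?_
    unfold lnorm
    rw [lintegral_sub_left_eq_self (fun y => g y ^ r) x]
  · intro y
    refine le_of_eq ?_
    unfold lnorm
    rw [lintegral_sub_right_eq_self (fun x => g x ^ r) y]

lemma lnorm_duh_le (hκ : Measurable (Function.uncurry κ)) (hH : Measurable (Function.uncurry H))
    {r m ρ C β : ℝ} (hr : 1 ≤ r) (hm : 1 ≤ m) (hρ : 1 ≤ ρ) (hexp : 1 + 1 / ρ = 1 / r + 1 / m)
    (hb : ∀ t > 0, lnorm volume r (κ t) ≤ ENNReal.ofReal (C * t ^ (-β))) (t : ℝ) :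
    lnorm volume ρ (duh κ H t) ≤ volt C β (fun s => lnorm volume m (H s)) t := by
  unfold duh volt
  refine (minkowski_integral hρ (σ := volume.restrict (Ioo 0 t))
    (F := fun s x => ∫⁻ y, κ (t - s) (x - y) * H s y) ?_).trans ?_
  · exact (lintegral_kernel_measurable hκ hH).comp
      (g := fun z : (ℝ × Rn n) × ℝ => ∫⁻ y, κ (z.1.1 - z.2) (z.1.2 - y) * H z.2 y)
      (f := fun z : ℝ × Rn n => ((t, z.2), z.1)) (by fun_prop)
  · refine setLIntegral_mono' measurableSet_Ioo fun s hs => ?_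
    refine (lnorm_conv_le hκ.of_uncurry_left hH.of_uncurry_left hr hm (by linarith) hexp).trans ?_
    exact mul_le_mul_left (hb _ (sub_pos.2 hs.2)) _

lemma lintegral_Ioo_rpow {a R : ℝ} (ha : -1 < a) (hR : 0 ≤ R) :
    ∫⁻ u in Ioo 0 R, ENNReal.ofReal (u ^ a) = ENNReal.ofReal (R ^ (a + 1) / (a + 1)) := by
  rw [← lintegral_Ioc_rpow ha hR, Measure.restrict_congr_set Ioo_ae_eq_Ioc]

lemma lnorm_powKer {C β r T : ℝ} (hC : 0 ≤ C) (hr : 1 ≤ r) (hβr : β * r < 1) (hT : 0 < T) :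
    lnorm (volume.restrict (Ioo 0 T)) r (fun τ => ENNReal.ofReal (C * τ ^ (-β))) =
      ENNReal.ofReal (C * (T ^ (1 - β * r) / (1 - β * r)) ^ (1 / r)) := by
  have h0 : 0 < 1 - β * r := by linarith
  have hr0 : 0 < r := by linarith
  have h1 : ∀ τ ∈ Ioo 0 T, ENNReal.ofReal (C * τ ^ (-β)) ^ r =
      ENNReal.ofReal (C ^ r) * ENNReal.ofReal (τ ^ (-(β * r))) := by
    intro τ hτ
    have := hτ.1
    rw [ENNReal.ofReal_rpow_of_nonneg (by positivity) hr0.le, ← ENNReal.ofReal_mul (by positivity),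
      Real.mul_rpow hC (by positivity), ← Real.rpow_mul hτ.1.le, neg_mul]
  unfold lnorm
  rw [setLIntegral_congr_fun measurableSet_Ioo h1, lintegral_const_mul' _ _ ENNReal.ofReal_ne_top,
    lintegral_Ioo_rpow (by linarith) hT.le, ← ENNReal.ofReal_mul (by positivity),
    show -(β * r) + 1 = 1 - β * r by ring,
    ENNReal.ofReal_rpow_of_nonneg (by positivity) (by positivity),
    Real.mul_rpow (by positivity) (by positivity), ← Real.rpow_mul hC, mul_one_div_cancel hr0.ne',
    Real.rpow_one]

lemma lnorm_volt_le {C β r m a T : ℝ} {G : ℝ → ℝ≥0∞} (hG : Measurable G) (hC : 0 ≤ C) (hr : 1 ≤ r)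
    (hm : 1 ≤ m) (ha : 0 < a) (hexp : 1 + 1 / a = 1 / r + 1 / m) (hβr : β * r < 1) (hT : 0 < T) :
    lnorm (volume.restrict (Ioo 0 T)) a (volt C β G) ≤
      ENNReal.ofReal (C * (T ^ (1 - β * r) / (1 - β * r)) ^ (1 / r)) *
        lnorm (volume.restrict (Ioo 0 T)) m G := by
  rw [← lnorm_powKer hC hr hβr hT]
  have hr0 : 0 < r := by linarith
  set φ : ℝ → ℝ≥0∞ := (Ioo 0 T).indicator (fun τ => ENNReal.ofReal (C * τ ^ (-β))) with hφ
  have hφm : Measurable φ := Measurable.indicator (by fun_prop) measurableSet_Ioo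
  have hn : ∫⁻ τ, φ τ ^ r = ∫⁻ τ in Ioo 0 T, ENNReal.ofReal (C * τ ^ (-β)) ^ r := by
    rw [← lintegral_indicator measurableSet_Ioo]
    congr 1; ext τ
    by_cases h : τ ∈ Ioo 0 T
    · simp [hφ, h]
    · simp [hφ, h, hr0]
  refine le_trans (lnorm_mono ha.le ?_) (schur_young hr hm ha hexp (μ := volume.restrict (Ioo 0 T))
    (ν := volume.restrict (Ioo 0 T)) (κ := fun t s => φ (t - s)) ?_ hG ?_ ?_)
  · refine (ae_restrict_iff' measurableSet_Ioo).2 (Eventually.of_forall fun t ht => ?_)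
    unfold volt
    beta_reduce
    rw [← lintegral_indicator measurableSet_Ioo, ← lintegral_indicator measurableSet_Ioo]
    refine lintegral_mono fun s => ?_
    by_cases h : s ∈ Ioo 0 t
    · rw [indicator_of_mem h, indicator_of_mem (show s ∈ Ioo 0 T from ⟨h.1, h.2.trans ht.2⟩), hφ,
        indicator_of_mem (show t - s ∈ Ioo 0 T from ⟨by linarith [h.2], by linarith [h.1, ht.2]⟩)]
    · rw [indicator_of_notMem h]; exact bot_le
  · exact hφm.comp (measurable_fst.sub measurable_snd)
  · intro t
    refine (lnorm_mono_measure hr0.le Measure.restrict_le_self _).trans (le_of_eq ?_)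
    unfold lnorm
    rw [lintegral_sub_left_eq_self (fun y => φ y ^ r) t, hn]
  · intro s
    refine (lnorm_mono_measure hr0.le Measure.restrict_le_self _).trans (le_of_eq ?_)
    unfold lnorm
    rw [lintegral_sub_right_eq_self (fun x => φ x ^ r) s, hn]

lemma lnorm_iSup {X : Type*} [MeasurableSpace X] {μ : Measure X} {r : ℝ} (hr : 0 < r)
    {F : ℕ → X → ℝ≥0∞} (hF : ∀ k, Measurable (F k)) (hm : Monotone F) :
    lnorm μ r (fun x => ⨆ k, F k x) = ⨆ k, lnorm μ r (F k) := by
  unfold lnorm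
  have h1 : ∀ x, (⨆ k, F k x) ^ r = ⨆ k, F k x ^ r := fun x =>
    (ENNReal.orderIsoRpow r hr).map_iSup _
  simp_rw [h1]
  rw [lintegral_iSup (fun k => (hF k).pow_const r)
    (fun i j hij x => ENNReal.rpow_le_rpow (hm hij x) hr.le)]
  exact (ENNReal.orderIsoRpow (1 / r) (by positivity)).map_iSup _

end

lemma lnorm_mul_le {X : Type*} [MeasurableSpace X] {μ : Measure X} {r p q : ℝ} (hr : 0 < r)
    (hp : 0 < p) (hq : 0 < q) (h : 1 / r = 1 / p + 1 / q) {F G : X → ℝ≥0∞} (hF : AEMeasurable F μ)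
    (hG : AEMeasurable G μ) :
    lnorm μ r (fun x => F x * G x) ≤ lnorm μ p F * lnorm μ q G := by
  refine ENNReal.lintegral_Lp_mul_le_Lq_mul_Lr hr ?_ h μ hF hG
  have : 0 < 1 / q := by positivity
  rw [← one_div_lt_one_div hp hr]
  linarith

lemma lnorm_pow_mul_le {X : Type*} [MeasurableSpace X] {μ : Measure X} {b ρ : ℝ} (hb : 0 < b)
    (hρ : 0 < ρ) {F G : X → ℝ≥0∞} (hF : AEMeasurable F μ) (hG : AEMeasurable G μ) :
    lnorm μ (ρ / (b + 1)) (fun x => F x ^ b * G x) ≤ lnorm μ ρ F ^ b * lnorm μ ρ G := by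
  refine (lnorm_mul_le (p := ρ / b) (q := ρ) (by positivity) (by positivity) hρ ?_
    (hF.pow_const b) hG).trans (le_of_eq ?_)
  · field_simp
  · rw [lnorm_pow (by positivity) hb, mul_div_cancel₀ _ hb.ne']

lemma lnorm_measurable {X Y : Type*} [MeasurableSpace X] [MeasurableSpace Y] {μ : Measure X}
    [SFinite μ] (r : ℝ) {F : Y → X → ℝ≥0∞} (hF : Measurable (Function.uncurry F)) :
    Measurable (fun t => lnorm μ r (F t)) :=
  (Measurable.lintegral_prod_right' (f := fun z : Y × X => F z.1 z.2 ^ r)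
    (hF.pow_const r)).pow_const _

/-- Mixed space-time norm `L^a(0,T; L^ρ)`. -/
def xnorm {n : ℕ} (a ρ T : ℝ) (F : ℝ → Rn n → ℝ≥0∞) : ℝ≥0∞ :=
  lnorm (volume.restrict (Ioo 0 T)) a (fun t => lnorm volume ρ (F t))

section
variable {n : ℕ} {κ : ℝ → Rn n → ℝ≥0∞} {F G : ℝ → Rn n → ℝ≥0∞} {a ρ T : ℝ}

lemma volt_mono (C β : ℝ) {F G : ℝ → ℝ≥0∞} (h : ∀ s, F s ≤ G s) (t : ℝ) :
    volt C β F t ≤ volt C β G t :=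
  lintegral_mono fun s => mul_le_mul_right (h s) _

lemma xnorm_duh_le (hκ : Measurable (Function.uncurry κ)) (hF : Measurable (Function.uncurry F))
    (hG : Measurable (Function.uncurry G)) {b C β r r' : ℝ} (hb : 0 < b) (hC : 0 ≤ C) (hr : 1 ≤ r)
    (hr' : 1 ≤ r') (hρ : b + 1 ≤ ρ) (ha : b + 1 ≤ a) (hexp : 1 / r = 1 - b / ρ)
    (hexp' : 1 / r' = 1 - b / a) (hβ : β * r' < 1) (hT : 0 < T)
    (hbd : ∀ t > 0, lnorm volume r (κ t) ≤ ENNReal.ofReal (C * t ^ (-β))) :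
    xnorm a ρ T (duh κ (fun s y => F s y ^ b * G s y)) ≤
      ENNReal.ofReal (C * (T ^ (1 - β * r') / (1 - β * r')) ^ (1 / r')) *
        (xnorm a ρ T F ^ b * xnorm a ρ T G) := by
  have hρ0 : 0 < ρ := by linarith
  have ha0 : 0 < a := by linarith
  have hH : Measurable (Function.uncurry (fun s y => F s y ^ b * G s y)) := (hF.pow_const b).mul hG
  have hFt := lnorm_measurable (μ := (volume : Measure (Rn n))) ρ hF
  have hGt := lnorm_measurable (μ := (volume : Measure (Rn n))) ρ hG
  have h1 : ∀ t, lnorm volume ρ (duh κ (fun s y => F s y ^ b * G s y) t) ≤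
      volt C β (fun s => lnorm volume ρ (F s) ^ b * lnorm volume ρ (G s)) t := fun t =>
    (lnorm_duh_le hκ hH hr (m := ρ / (b + 1)) (by rw [le_div_iff₀ (by positivity)]; linarith)
      (by linarith) (by rw [hexp]; field_simp; ring) hbd t).trans
      (volt_mono _ _ (fun s => lnorm_pow_mul_le hb hρ0 hF.of_uncurry_left.aemeasurable
        hG.of_uncurry_left.aemeasurable) t)
  refine (lnorm_mono ha0.le (Eventually.of_forall h1)).trans ?_
  refine (lnorm_volt_le ((hFt.pow_const b).mul hGt) hC hr' (m := a / (b + 1))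
    (by rw [le_div_iff₀ (by positivity)]; linarith) ha0 (by rw [hexp']; field_simp; ring) hβ
    hT).trans ?_
  exact mul_le_mul_right (lnorm_pow_mul_le hb ha0 hFt.aemeasurable hGt.aemeasurable) _

lemma exists_time_small {C c d ε : ℝ} (hc : 0 < c) (hd : 0 < d) (hε : 0 < ε) :
    ∃ T > 0, T ≤ 1 ∧ C * (T ^ c / c) ^ d ≤ ε := by
  have h : Tendsto (fun T : ℝ => C * (T ^ c / c) ^ d) (𝓝[>] 0) (𝓝 (C * (0 ^ c / c) ^ d)) := by
    have h1 : ContinuousAt (fun T : ℝ => C * (T ^ c / c) ^ d) 0 := by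
      refine continuousAt_const.mul (ContinuousAt.rpow_const ?_ (Or.inr hd.le))
      exact (Real.continuousAt_rpow_const _ _ (Or.inr hc.le)).div_const _
    exact h1.tendsto.mono_left nhdsWithin_le_nhds
  rw [Real.zero_rpow hc.ne', zero_div, Real.zero_rpow hd.ne', mul_zero] at h
  have h2 := (h.eventually (ge_mem_nhds hε)).and (Ioo_mem_nhdsGT (zero_lt_one' ℝ))
  obtain ⟨T, h3, h4⟩ := h2.exists
  exact ⟨T, h4.1, h4.2.le, h3⟩

lemma xnorm_add_le (ha : 1 ≤ a) (hρ : 1 ≤ ρ) (hF : Measurable (Function.uncurry F))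
    (hG : Measurable (Function.uncurry G)) :
    xnorm a ρ T (fun t x => F t x + G t x) ≤ xnorm a ρ T F + xnorm a ρ T G := by
  refine (lnorm_mono (by linarith) (Eventually.of_forall fun t => lnorm_add_le hρ
    hF.of_uncurry_left.aemeasurable hG.of_uncurry_left.aemeasurable)).trans ?_
  exact lnorm_add_le ha (lnorm_measurable ρ hF).aemeasurable (lnorm_measurable ρ hG).aemeasurable

lemma xnorm_mono (ha : 0 ≤ a) (hρ : 0 ≤ ρ)
    (h : ∀ᵐ z ∂((volume.restrict (Ioo 0 T)).prod (volume : Measure (Rn n))), F z.1 z.2 ≤ G z.1 z.2) :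
    xnorm a ρ T F ≤ xnorm a ρ T G := by
  refine lnorm_mono ha ?_
  filter_upwards [Measure.ae_ae_of_ae_prod h] with t ht
  exact lnorm_mono hρ ht

lemma xnorm_const_mul (ha : 0 < a) (hρ : 0 < ρ) (c : ℝ≥0∞) (hF : Measurable (Function.uncurry F)) :
    xnorm a ρ T (fun t x => c * F t x) = c * xnorm a ρ T F := by
  unfold xnorm
  rw [← lnorm_const_mul ha c (lnorm_measurable ρ hF).aemeasurable]
  congr 1; ext t
  rw [lnorm_const_mul hρ c hF.of_uncurry_left.aemeasurable]

lemma xnorm_iSup (ha : 0 < a) (hρ : 0 < ρ) {F : ℕ → ℝ → Rn n → ℝ≥0∞}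
    (hF : ∀ k, Measurable (Function.uncurry (F k))) (hm : Monotone F) :
    xnorm a ρ T (fun t x => ⨆ k, F k t x) = ⨆ k, xnorm a ρ T (F k) := by
  unfold xnorm
  rw [← lnorm_iSup ha (fun k => lnorm_measurable ρ (hF k))
    (fun i j hij t => lnorm_mono hρ.le (Eventually.of_forall fun x => hm hij t x))]
  congr 1; ext t
  rw [lnorm_iSup hρ (fun k => (hF k).of_uncurry_left) (fun i j hij => hm hij t)]

lemma xnorm_tsum_le (ha : 1 ≤ a) (hρ : 1 ≤ ρ) {F : ℕ → ℝ → Rn n → ℝ≥0∞}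
    (hF : ∀ k, Measurable (Function.uncurry (F k))) :
    xnorm a ρ T (fun t x => ∑' k, F k t x) ≤ ∑' k, xnorm a ρ T (F k) := by
  unfold xnorm
  have h1 : ∀ t, lnorm volume ρ (fun x => ∑' k, F k t x) ≤ ∑' k, lnorm volume ρ (F k t) := fun t => by
    have := minkowski_integral (μ := (volume : Measure (Rn n))) (σ := (Measure.count : Measure ℕ)) hρ
      (F := fun k x => F k t x) (measurable_from_prod_countable_right fun k => (hF k).of_uncurry_left)
    simpa only [lintegral_count] using this
  refine (lnorm_mono (by linarith) (Eventually.of_forall h1)).trans ?_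
  have := minkowski_integral (μ := volume.restrict (Ioo 0 T)) (σ := (Measure.count : Measure ℕ)) ha
      (F := fun k t => lnorm volume ρ (F k t))
      (measurable_from_prod_countable_right fun k => lnorm_measurable ρ (hF k))
  simpa only [lintegral_count] using this

lemma ae_lt_top_of_xnorm (ha : 0 < a) (hρ : 0 < ρ) (hF : Measurable (Function.uncurry F))
    (h : xnorm a ρ T F ≠ ⊤) :
    ∀ᵐ z ∂((volume.restrict (Ioo 0 T)).prod (volume : Measure (Rn n))), F z.1 z.2 ≠ ⊤ := by
  have h1 := lnorm_lt_top_ae ha (lnorm_measurable ρ hF).aemeasurable h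
  rw [Measure.ae_prod_iff_ae_ae]
  · filter_upwards [h1] with t ht
    exact lnorm_lt_top_ae hρ hF.of_uncurry_left.aemeasurable ht
  · exact (measurableSet_eq_fun hF measurable_const).compl

end

lemma abs_pow_mul_sub_le (b : ℕ) {x y m : ℝ} (hx : |x| ≤ m) (hy : |y| ≤ m) :
    |(|x| ^ b * x) - |y| ^ b * y| ≤ (b + 1) * m ^ b * |x - y| := by
  have hm : 0 ≤ m := (abs_nonneg x).trans hx
  induction b with
  | zero => simp
  | succ b ih =>
    have e : |x| ^ (b + 1) * x - |y| ^ (b + 1) * y =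
        |x| * (|x| ^ b * x - |y| ^ b * y) + (|x| - |y|) * (|y| ^ b * y) := by ring
    rw [e]
    refine (abs_add_le _ _).trans ?_
    rw [abs_mul, abs_mul, abs_mul, abs_abs, abs_pow, abs_abs]
    calc |x| * |(|x| ^ b * x) - |y| ^ b * y| + |(|x| - |y|)| * (|y| ^ b * |y|)
        ≤ m * ((b + 1) * m ^ b * |x - y|) + |x - y| * (m ^ b * m) := by
          have h1 : |y| ^ b * |y| ≤ m ^ b * m := by gcongr
          have h2 := abs_abs_sub_abs_le x y
          exact add_le_add (mul_le_mul hx ih (abs_nonneg _) hm)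
            (mul_le_mul h2 h1 (by positivity) (abs_nonneg _))
      _ = _ := by push_cast; ring

lemma enorm_abs_pow_mul (b : ℕ) (x : ℝ) : ‖|x| ^ b * x‖ₑ = ‖x‖ₑ ^ (b:ℝ) * ‖x‖ₑ := by
  rw [enorm_mul, enorm_pow, ENNReal.rpow_natCast]
  simp

lemma enorm_abs_pow_mul_sub_le (b : ℕ) {x y : ℝ} {U : ℝ≥0∞} (hx : ‖x‖ₑ ≤ U) (hy : ‖y‖ₑ ≤ U) :
    ‖|x| ^ b * x - |y| ^ b * y‖ₑ ≤ ENNReal.ofReal (b + 1) * (U ^ (b:ℝ) * ‖x - y‖ₑ) := by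
  have h1 := abs_pow_mul_sub_le b (le_max_left |x| |y|) (le_max_right |x| |y|)
  have h2 : ENNReal.ofReal (max |x| |y|) ≤ U := by
    rw [Real.enorm_eq_ofReal_abs] at hx hy
    rcases max_cases |x| |y| with h | h <;> rw [h.1] <;> assumption
  have hm : 0 ≤ max |x| |y| := (abs_nonneg x).trans (le_max_left _ _)
  rw [Real.enorm_eq_ofReal_abs, Real.enorm_eq_ofReal_abs]
  refine (ENNReal.ofReal_le_ofReal h1).trans ?_
  rw [ENNReal.ofReal_mul (by positivity), ENNReal.ofReal_mul (by positivity), mul_assoc,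
    ENNReal.ofReal_pow hm, ENNReal.rpow_natCast]
  gcongr

section
variable {n : ℕ} {ι : Type*} [Fintype ι]

/-- Total absolute kernel of a family of signed kernels. -/
def absKer (k : ι → ℝ → Rn n → ℝ) (t : ℝ) (z : Rn n) : ℝ≥0∞ := ∑ j, ‖k j t z‖ₑ

/-- Signed Duhamel operator associated with a family of kernels. -/
def sduh (k : ι → ℝ → Rn n → ℝ) (H : ℝ → Rn n → ℝ) (t : ℝ) (x : Rn n) : ℝ :=
  ∑ j, ∫ z, k j (t - z.1) (x - z.2) * H z.1 z.2 ∂((volume.restrict (Ioo 0 t)).prod volume)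

variable {k : ι → ℝ → Rn n → ℝ} {H H' : ℝ → Rn n → ℝ}

lemma absKer_measurable (hk : ∀ j, Measurable (Function.uncurry (k j))) :
    Measurable (Function.uncurry (absKer k)) := by
  have : Function.uncurry (absKer k) = fun z => ∑ j, ‖Function.uncurry (k j) z‖ₑ := rfl
  rw [this]
  exact Finset.measurable_sum _ fun j _ => (hk j).enorm

lemma kernel_mul_measurable (hk : ∀ j, Measurable (Function.uncurry (k j)))
    (hH : Measurable (Function.uncurry H)) (j : ι) :
    Measurable (fun w : (ℝ × Rn n) × (ℝ × Rn n) =>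
      k j (w.1.1 - w.2.1) (w.1.2 - w.2.2) * H w.2.1 w.2.2) :=
  ((hk j).comp (f := fun w : (ℝ × Rn n) × (ℝ × Rn n) => (w.1.1 - w.2.1, w.1.2 - w.2.2))
    (by fun_prop)).mul (hH.comp (f := fun w : (ℝ × Rn n) × (ℝ × Rn n) => w.2) (by fun_prop))

lemma kernel_mul_measurable' (hk : ∀ j, Measurable (Function.uncurry (k j)))
    (hH : Measurable (Function.uncurry H)) (j : ι) (t : ℝ) (x : Rn n) :
    Measurable (fun z : ℝ × Rn n => k j (t - z.1) (x - z.2) * H z.1 z.2) :=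
  (kernel_mul_measurable hk hH j).comp (measurable_prodMk_left (x := (t, x)))

lemma sum_lintegral_eq_duh (hk : ∀ j, Measurable (Function.uncurry (k j)))
    (hH : Measurable (Function.uncurry H)) (t : ℝ) (x : Rn n) :
    ∑ j, ∫⁻ z, ‖k j (t - z.1) (x - z.2) * H z.1 z.2‖ₑ ∂((volume.restrict (Ioo 0 t)).prod volume) =
      duh (absKer k) (fun s y => ‖H s y‖ₑ) t x := by
  rw [← lintegral_finsetSum _ (fun j _ => (kernel_mul_measurable' hk hH j t x).enorm),
    lintegral_prod _ (Finset.measurable_sum _ fun j _ =>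
      (kernel_mul_measurable' hk hH j t x).enorm).aemeasurable]
  unfold duh absKer
  simp_rw [Finset.sum_mul, enorm_mul]

lemma enorm_sduh_le (hk : ∀ j, Measurable (Function.uncurry (k j)))
    (hH : Measurable (Function.uncurry H)) (t : ℝ) (x : Rn n) :
    ‖sduh k H t x‖ₑ ≤ duh (absKer k) (fun s y => ‖H s y‖ₑ) t x := by
  rw [← sum_lintegral_eq_duh hk hH]
  refine (enorm_sum_le Finset.univ _).trans (Finset.sum_le_sum fun j _ => ?_)
  exact enorm_integral_le_lintegral_enorm _

lemma integrable_of_duh (hk : ∀ j, Measurable (Function.uncurry (k j)))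
    (hH : Measurable (Function.uncurry H)) {t : ℝ} {x : Rn n}
    (h : duh (absKer k) (fun s y => ‖H s y‖ₑ) t x ≠ ⊤) (j : ι) :
    Integrable (fun z : ℝ × Rn n => k j (t - z.1) (x - z.2) * H z.1 z.2)
      ((volume.restrict (Ioo 0 t)).prod volume) := by
  refine ⟨(kernel_mul_measurable' hk hH j t x).aestronglyMeasurable, ?_⟩
  rw [← sum_lintegral_eq_duh hk hH] at h
  exact (ENNReal.sum_lt_top.1 (lt_top_iff_ne_top.2 h)) j (Finset.mem_univ j)

lemma duh_mono {κ : ℝ → Rn n → ℝ≥0∞} {F G : ℝ → Rn n → ℝ≥0∞} (h : ∀ s y, F s y ≤ G s y)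
    (t : ℝ) (x : Rn n) : duh κ F t x ≤ duh κ G t x :=
  lintegral_mono fun s => lintegral_mono fun y => mul_le_mul_right (h s y) _

lemma sduh_sub (hk : ∀ j, Measurable (Function.uncurry (k j)))
    (hH : Measurable (Function.uncurry H)) (hH' : Measurable (Function.uncurry H')) {t : ℝ} {x : Rn n}
    (h : duh (absKer k) (fun s y => ‖H s y‖ₑ) t x ≠ ⊤)
    (h' : duh (absKer k) (fun s y => ‖H' s y‖ₑ) t x ≠ ⊤) :
    sduh k H t x - sduh k H' t x = sduh k (fun s y => H s y - H' s y) t x := by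
  unfold sduh
  rw [← Finset.sum_sub_distrib]
  refine Finset.sum_congr rfl fun j _ => ?_
  rw [← integral_sub (integrable_of_duh hk hH h j) (integrable_of_duh hk hH' h' j)]
  simp_rw [mul_sub]

lemma sduh_measurable (hk : ∀ j, Measurable (Function.uncurry (k j)))
    (hH : Measurable (Function.uncurry H)) : Measurable (Function.uncurry (sduh k H)) := by
  have h1 : Function.uncurry (sduh k H) = fun w : ℝ × Rn n => ∑ j, ∫ z,
      ({v : (ℝ × Rn n) × (ℝ × Rn n) | v.2.1 ∈ Ioo 0 v.1.1}.indicator (fun v =>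
        k j (v.1.1 - v.2.1) (v.1.2 - v.2.2) * H v.2.1 v.2.2)) (w, z) ∂(volume.prod volume) := by
    ext ⟨t, x⟩
    rw [Function.uncurry_apply_pair, sduh]
    refine Finset.sum_congr rfl fun j _ => ?_
    have h2 : (volume.restrict (Ioo 0 t)).prod (volume : Measure (Rn n)) =
        (volume.prod volume).restrict (Ioo 0 t ×ˢ univ) := by
      rw [← Measure.prod_restrict, Measure.restrict_univ]
    rw [h2, ← integral_indicator (measurableSet_Ioo.prod MeasurableSet.univ)]
    congr 1; ext z
    simp [indicator]
  rw [h1]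
  refine Finset.measurable_sum _ fun j _ => StronglyMeasurable.measurable ?_
  refine StronglyMeasurable.integral_prod_right' (Measurable.stronglyMeasurable ?_)
  refine (kernel_mul_measurable hk hH j).indicator ?_
  exact (measurableSet_lt measurable_const measurable_snd.fst).inter
    (measurableSet_lt measurable_snd.fst measurable_fst.fst)

end

section
variable {n : ℕ} {ι : Type*} [Fintype ι] {k : ι → ℝ → Rn n → ℝ} {κ : ℝ → Rn n → ℝ≥0∞} {T : ℝ}

lemma prod_restrict_Ioo_le {t : ℝ} (ht : t ≤ T) :
    (volume.restrict (Ioo 0 t)).prod (volume : Measure (Rn n)) ≤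
      (volume.restrict (Ioo 0 T)).prod volume := by
  have h : ∀ s : ℝ, (volume.restrict (Ioo 0 s)).prod (volume : Measure (Rn n)) =
      (volume.prod volume).restrict (Ioo 0 s ×ˢ univ) := fun s => by
    rw [← Measure.prod_restrict, Measure.restrict_univ]
  rw [h, h]
  exact Measure.restrict_mono (prod_mono (Ioo_subset_Ioo_right ht) le_rfl) le_rfl

lemma duh_mono_ae {F G : ℝ → Rn n → ℝ≥0∞} {t : ℝ} (ht : t ≤ T)
    (h : ∀ᵐ z ∂((volume.restrict (Ioo 0 T)).prod (volume : Measure (Rn n))), F z.1 z.2 ≤ G z.1 z.2)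
    (x : Rn n) : duh κ F t x ≤ duh κ G t x := by
  have h' := Measure.ae_ae_of_ae_prod (ae_mono (prod_restrict_Ioo_le ht) h)
  refine lintegral_mono_ae (h'.mono fun s hs => lintegral_mono_ae (hs.mono fun y hy => ?_))
  exact mul_le_mul_right hy _

lemma duh_const_mul {F : ℝ → Rn n → ℝ≥0∞} {c : ℝ≥0∞} (hc : c ≠ ⊤) (t : ℝ) (x : Rn n) :
    duh κ (fun s y => c * F s y) t x = c * duh κ F t x := by
  unfold duh
  simp_rw [mul_left_comm _ c]
  rw [← lintegral_const_mul' _ _ hc]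
  simp_rw [lintegral_const_mul' _ _ hc]

/-- Monotone iteration producing a majorant for the Picard iterates. -/
def majIter (κ : ℝ → Rn n → ℝ≥0∞) (L : ℝ → Rn n → ℝ≥0∞) (b : ℝ) : ℕ → ℝ → Rn n → ℝ≥0∞
  | 0 => fun _ _ => 0
  | i + 1 => fun t x => L t x + duh κ (fun s y => majIter κ L b i s y ^ b * majIter κ L b i s y) t x

/-- Picard iterates. -/
def picIter (k : ι → ℝ → Rn n → ℝ) (l : ℝ → Rn n → ℝ) (b : ℕ) : ℕ → ℝ → Rn n → ℝ
  | 0 => fun _ _ => 0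
  | i + 1 => fun t x => l t x - sduh k (fun s y => |picIter k l b i s y| ^ b * picIter k l b i s y) t x

lemma majIter_measurable (hκ : Measurable (Function.uncurry κ)) {L : ℝ → Rn n → ℝ≥0∞}
    (hL : Measurable (Function.uncurry L)) (b : ℝ) (i : ℕ) :
    Measurable (Function.uncurry (majIter κ L b i)) := by
  induction i with
  | zero => exact measurable_const
  | succ i ih => exact hL.add (duh_measurable hκ ((ih.pow_const b).mul ih))

lemma abs_pow_mul_measurable (b : ℕ) {u : ℝ → Rn n → ℝ} (hu : Measurable (Function.uncurry u)) :
    Measurable (Function.uncurry fun s y => |u s y| ^ b * u s y) :=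
  ((continuous_abs.measurable.comp hu).pow_const b).mul hu

lemma picIter_measurable (hk : ∀ j, Measurable (Function.uncurry (k j))) {l : ℝ → Rn n → ℝ}
    (hl : Measurable (Function.uncurry l)) (b i : ℕ) :
    Measurable (Function.uncurry (picIter k l b i)) := by
  induction i with
  | zero => exact measurable_const
  | succ i ih => exact hl.sub (sduh_measurable hk (abs_pow_mul_measurable b ih))

lemma majIter_mono {L : ℝ → Rn n → ℝ≥0∞} {b : ℝ} (hb : 0 ≤ b) : Monotone (majIter κ L b) := by
  refine monotone_nat_of_le_succ fun i => ?_
  induction i with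
  | zero => intro t x; exact bot_le
  | succ i ih =>
    intro t x
    refine add_le_add le_rfl (duh_mono (fun s y => ?_) t x)
    exact mul_le_mul' (ENNReal.rpow_le_rpow (ih s y) hb) (ih s y)

lemma picIter_le_majIter (hk : ∀ j, Measurable (Function.uncurry (k j))) {l : ℝ → Rn n → ℝ}
    (hl : Measurable (Function.uncurry l)) {L : ℝ → Rn n → ℝ≥0∞} (hlL : ∀ t x, ‖l t x‖ₑ ≤ L t x)
    (b i : ℕ) (t : ℝ) (x : Rn n) : ‖picIter k l b i t x‖ₑ ≤ majIter (absKer k) L b i t x := by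
  induction i generalizing t x with
  | zero => simp [picIter, majIter]
  | succ i ih =>
    refine (enorm_sub_le).trans (add_le_add (hlL t x) ?_)
    refine (enorm_sduh_le hk (abs_pow_mul_measurable b (picIter_measurable hk hl b i)) t x).trans
      (duh_mono (fun s y => ?_) t x)
    rw [enorm_abs_pow_mul]
    exact mul_le_mul' (ENNReal.rpow_le_rpow (ih s y) (by positivity)) (ih s y)

variable {a ρ : ℝ}

lemma tendsto_sduh (hk : ∀ j, Measurable (Function.uncurry (k j))) {F : ℕ → ℝ → Rn n → ℝ}
    {f : ℝ → Rn n → ℝ} {W : ℝ → Rn n → ℝ≥0∞} (hF : ∀ i, Measurable (Function.uncurry (F i)))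
    (hW : Measurable (Function.uncurry W)) (hFW : ∀ i t x, ‖F i t x‖ₑ ≤ W t x) {t : ℝ} (ht : t ≤ T)
    (hlim : ∀ᵐ z ∂((volume.restrict (Ioo 0 T)).prod (volume : Measure (Rn n))),
      Tendsto (fun i => F i z.1 z.2) atTop (𝓝 (f z.1 z.2))) {x : Rn n}
    (hfin : duh (absKer k) W t x ≠ ⊤) :
    Tendsto (fun i => sduh k (F i) t x) atTop (𝓝 (sduh k f t x)) := by
  unfold sduh
  refine tendsto_finsetSum _ fun j _ => ?_
  have hm : Measurable fun z : ℝ × Rn n => ‖k j (t - z.1) (x - z.2)‖ₑ * W z.1 z.2 :=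
    ((hk j).comp (f := fun z : ℝ × Rn n => (t - z.1, x - z.2)) (by fun_prop)).enorm.mul hW
  have hI : ∫⁻ z, ‖k j (t - z.1) (x - z.2)‖ₑ * W z.1 z.2
      ∂((volume.restrict (Ioo 0 t)).prod (volume : Measure (Rn n))) ≠ ⊤ := by
    refine ne_top_of_le_ne_top hfin ?_
    rw [lintegral_prod _ hm.aemeasurable]
    refine lintegral_mono fun s => lintegral_mono fun y => mul_le_mul_left ?_ _
    exact Finset.single_le_sum (f := fun j => ‖k j (t - s) (x - y)‖ₑ) (fun _ _ => bot_le)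
      (Finset.mem_univ j)
  refine tendsto_integral_of_dominated_convergence
    (fun z => (‖k j (t - z.1) (x - z.2)‖ₑ * W z.1 z.2).toReal) (fun i =>
      (kernel_mul_measurable' hk (hF i) j t x).aestronglyMeasurable)
    (integrable_toReal_of_lintegral_ne_top hm.aemeasurable hI) (fun i => ?_) ?_
  · filter_upwards [ae_lt_top hm hI] with z hz
    rw [← toReal_enorm, enorm_mul]
    exact ENNReal.toReal_mono hz.ne (mul_le_mul_right (hFW i _ _) _)
  · filter_upwards [ae_mono (prod_restrict_Ioo_le ht) hlim] with z hz
    exact hz.const_mul _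

theorem exists_picard_limit (hk : ∀ j, Measurable (Function.uncurry (k j))) {l : ℝ → Rn n → ℝ}
    (hl : Measurable (Function.uncurry l)) {L : ℝ → Rn n → ℝ≥0∞}
    (hL : Measurable (Function.uncurry L)) (hlL : ∀ t x, ‖l t x‖ₑ ≤ L t x) {b : ℕ}
    (ha : 1 ≤ a) (hρ : 1 ≤ ρ) {Λ ε : ℝ≥0∞} (hΛ : Λ ≠ ⊤) (hLΛ : xnorm a ρ T L ≤ Λ)
    (hcontr : ∀ F G : ℝ → Rn n → ℝ≥0∞, Measurable (Function.uncurry F) →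
      Measurable (Function.uncurry G) → xnorm a ρ T (duh (absKer k) (fun s y => F s y ^ (b:ℝ) * G s y))
        ≤ ε * (xnorm a ρ T F ^ (b:ℝ) * xnorm a ρ T G))
    (hε : ENNReal.ofReal (b + 1) * (ε * (2 * Λ) ^ (b:ℝ)) ≤ 2⁻¹) :
    ∃ u : ℝ → Rn n → ℝ, Measurable (Function.uncurry u) ∧
      xnorm a ρ T (fun t x => ‖u t x‖ₑ) ≤ 2 * Λ ∧
      ∀ᵐ z ∂((volume.restrict (Ioo 0 T)).prod (volume : Measure (Rn n))),
        duh (absKer k) (fun s y => ‖|u s y| ^ b * u s y‖ₑ) z.1 z.2 ≠ ⊤ ∧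
        u z.1 z.2 = l z.1 z.2 - sduh k (fun s y => |u s y| ^ b * u s y) z.1 z.2 := by
  have ha0 : 0 < a := by linarith
  have hρ0 : 0 < ρ := by linarith
  have hκ := absKer_measurable hk
  set V := majIter (absKer k) L b with hV
  set w := picIter k l b with hw
  have hVm := majIter_measurable hκ hL (b:ℝ)
  have hwm := picIter_measurable hk hl b
  have hVmono : Monotone V := majIter_mono (by positivity)
  have hε1 : ε * (2 * Λ) ^ (b:ℝ) ≤ 2⁻¹ := by
    refine le_trans ?_ hε
    refine le_mul_of_one_le_left bot_le ?_
    rw [ENNReal.one_le_ofReal]; linarith [(Nat.cast_nonneg b : (0:ℝ) ≤ b)]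
  have h2Λ : 2⁻¹ * (2 * Λ) = Λ := by
    rw [← mul_assoc, ENNReal.inv_mul_cancel (by norm_num) (by norm_num), one_mul]
  have hVn : ∀ i, xnorm a ρ T (V i) ≤ 2 * Λ := by
    intro i
    induction i with
    | zero =>
      have : xnorm a ρ T (V 0) = 0 := by
        simp [hV, majIter, xnorm, lnorm, hρ0, ha0]
      rw [this]; exact bot_le
    | succ i ih =>
      refine (xnorm_add_le ha hρ hL (duh_measurable hκ
        (H := fun s y => V i s y ^ (b:ℝ) * V i s y) (((hVm i).pow_const _).mul (hVm i)))).trans ?_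
      calc _ ≤ Λ + ε * ((2 * Λ) ^ (b:ℝ) * (2 * Λ)) := by
            refine add_le_add hLΛ ((hcontr _ _ (hVm i) (hVm i)).trans ?_)
            gcongr
        _ ≤ Λ + 2⁻¹ * (2 * Λ) := by
            rw [← mul_assoc]; gcongr
        _ = 2 * Λ := by rw [h2Λ, two_mul]
  set U : ℝ → Rn n → ℝ≥0∞ := fun t x => ⨆ i, V i t x with hU
  have hUm : Measurable (Function.uncurry U) := by
    have : Function.uncurry U = fun z => ⨆ i, Function.uncurry (V i) z := rfl
    rw [this]; exact Measurable.iSup hVm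
  have hUn : xnorm a ρ T U ≤ 2 * Λ := by
    rw [hU, xnorm_iSup ha0 hρ0 hVm hVmono]; exact iSup_le hVn
  have hwU : ∀ i t x, ‖w i t x‖ₑ ≤ U t x := fun i t x =>
    (picIter_le_majIter hk hl hlL b i t x).trans (le_iSup (fun i => V i t x) i)
  set W : ℝ → Rn n → ℝ≥0∞ := fun s y => U s y ^ (b:ℝ) * U s y with hWdef
  have hWm : Measurable (Function.uncurry W) := (hUm.pow_const _).mul hUm
  have h2Λt : 2 * Λ ≠ ⊤ := ENNReal.mul_ne_top (by norm_num) hΛ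
  have hWfin : ∀ᵐ z ∂((volume.restrict (Ioo 0 T)).prod (volume : Measure (Rn n))),
      duh (absKer k) W z.1 z.2 ≠ ⊤ := by
    refine ae_lt_top_of_xnorm ha0 hρ0 (duh_measurable hκ hWm) (ne_top_of_le_ne_top hΛ ?_)
    refine (hcontr _ _ hUm hUm).trans ?_
    calc _ ≤ ε * ((2 * Λ) ^ (b:ℝ) * (2 * Λ)) := by gcongr
      _ ≤ 2⁻¹ * (2 * Λ) := by rw [← mul_assoc]; gcongr
      _ = Λ := h2Λ
  have hnm : ∀ i, Measurable (Function.uncurry fun s y => |w i s y| ^ b * w i s y) := fun i =>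
    abs_pow_mul_measurable b (hwm i)
  have hnW : ∀ i s y, ‖|w i s y| ^ b * w i s y‖ₑ ≤ W s y := fun i s y => by
    rw [enorm_abs_pow_mul]
    exact mul_le_mul' (ENNReal.rpow_le_rpow (hwU i s y) (by positivity)) (hwU i s y)
  set D : ℕ → ℝ → Rn n → ℝ≥0∞ := fun i t x => ‖w (i + 1) t x - w i t x‖ₑ with hD
  have hDm : ∀ i, Measurable (Function.uncurry (D i)) := fun i => ((hwm (i + 1)).sub (hwm i)).enorm
  have hD0 : xnorm a ρ T (D 0) ≤ 2 * Λ := by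
    refine (xnorm_mono ha0.le hρ0.le (Eventually.of_forall fun z => ?_)).trans hUn
    have : w 0 z.1 z.2 = 0 := rfl
    simp only [hD, this, sub_zero]
    exact hwU _ _ _
  have hDs : ∀ i, xnorm a ρ T (D (i + 1)) ≤ 2⁻¹ * xnorm a ρ T (D i) := by
    intro i
    have h1 : xnorm a ρ T (D (i + 1)) ≤ xnorm a ρ T (fun t x => ENNReal.ofReal (b + 1) *
        duh (absKer k) (fun s y => U s y ^ (b:ℝ) * D i s y) t x) := by
      refine xnorm_mono ha0.le hρ0.le ?_
      filter_upwards [hWfin] with z hz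
      have hf : ∀ i, duh (absKer k) (fun s y => ‖|w i s y| ^ b * w i s y‖ₑ) z.1 z.2 ≠ ⊤ := fun i =>
        ne_top_of_le_ne_top hz (duh_mono (hnW i) _ _)
      have e : w (i + 1 + 1) z.1 z.2 - w (i + 1) z.1 z.2 =
          -(sduh k (fun s y => |w (i + 1) s y| ^ b * w (i + 1) s y - |w i s y| ^ b * w i s y) z.1 z.2) := by
        rw [← sduh_sub hk (hnm (i + 1)) (hnm i) (hf (i + 1)) (hf i)]
        simp only [hw, picIter]
        ring
      simp only [hD]
      rw [e, enorm_neg, ← duh_const_mul ENNReal.ofReal_ne_top]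
      refine (enorm_sduh_le hk (H := fun s y => |w (i + 1) s y| ^ b * w (i + 1) s y -
        |w i s y| ^ b * w i s y) ((hnm (i + 1)).sub (hnm i)) _ _).trans (duh_mono (fun s y => ?_) _ _)
      exact enorm_abs_pow_mul_sub_le b (hwU (i + 1) s y) (hwU i s y)
    refine h1.trans ?_
    rw [xnorm_const_mul ha0 hρ0 _ (duh_measurable hκ
      (H := fun s y => U s y ^ (b:ℝ) * D i s y) ((hUm.pow_const _).mul (hDm i)))]
    calc _ ≤ ENNReal.ofReal (b + 1) * (ε * ((2 * Λ) ^ (b:ℝ) * xnorm a ρ T (D i))) := by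
          refine mul_le_mul_right ((hcontr _ _ hUm (hDm i)).trans ?_) _
          gcongr
      _ = ENNReal.ofReal (b + 1) * (ε * (2 * Λ) ^ (b:ℝ)) * xnorm a ρ T (D i) := by ring
      _ ≤ _ := by gcongr
  have hDi : ∀ i, xnorm a ρ T (D i) ≤ 2⁻¹ ^ i * (2 * Λ) := by
    intro i
    induction i with
    | zero => simpa using hD0
    | succ i ih =>
      refine (hDs i).trans ((mul_le_mul_right ih _).trans (le_of_eq ?_))
      rw [pow_succ']; ring
  have hsum : ∀ᵐ z ∂((volume.restrict (Ioo 0 T)).prod (volume : Measure (Rn n))),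
      ∑' i, D i z.1 z.2 ≠ ⊤ := by
    refine ae_lt_top_of_xnorm (F := fun t x => ∑' i, D i t x) ha0 hρ0 (Measurable.tsum hDm) ?_
    refine ne_top_of_le_ne_top ?_ ((xnorm_tsum_le ha hρ hDm).trans (ENNReal.tsum_le_tsum hDi))
    rw [ENNReal.tsum_mul_right, ENNReal.tsum_geometric, ENNReal.one_sub_inv_two, inv_inv]
    exact ENNReal.mul_ne_top (by norm_num) h2Λt
  have hconv : ∀ᵐ z ∂((volume.restrict (Ioo 0 T)).prod (volume : Measure (Rn n))),
      ∃ c, Tendsto (fun i => Function.uncurry (w i) z) atTop (𝓝 c) := by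
    filter_upwards [hsum] with z hz
    refine cauchySeq_tendsto_of_complete (cauchySeq_of_edist_le_of_tsum_ne_top _ (fun i => ?_) hz)
    rw [edist_comm, edist_eq_enorm_sub]; rfl
  obtain ⟨u, hum, hu⟩ := measurable_limit_of_tendsto_metrizable_ae
    (fun i => (hwm i).aemeasurable) hconv
  have huU : ∀ᵐ z ∂((volume.restrict (Ioo 0 T)).prod (volume : Measure (Rn n))),
      ‖u z‖ₑ ≤ U z.1 z.2 := by
    filter_upwards [hu] with z hz
    exact le_of_tendsto' ((continuous_enorm.tendsto _).comp hz) fun i => hwU i _ _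
  refine ⟨fun t x => u (t, x), hum, (xnorm_mono ha0.le hρ0.le huU).trans hUn, ?_⟩
  have hT : ∀ᵐ z ∂((volume.restrict (Ioo 0 T)).prod (volume : Measure (Rn n))), z.1 ≤ T := by
    refine Measure.quasiMeasurePreserving_fst.ae (p := fun t => t ≤ T) ?_
    exact (ae_restrict_iff' measurableSet_Ioo).2 (Eventually.of_forall fun t ht => ht.2.le)
  filter_upwards [hWfin, hu, hT] with z hz hzu hzT
  constructor
  · refine ne_top_of_le_ne_top hz (duh_mono_ae hzT ?_ _)
    filter_upwards [huU] with y hy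
    rw [enorm_abs_pow_mul]
    exact mul_le_mul' (ENNReal.rpow_le_rpow hy (by positivity)) hy
  · have h1 := tendsto_sduh hk (F := fun i s y => |w i s y| ^ b * w i s y)
      (f := fun s y => |u (s, y)| ^ b * u (s, y)) hnm hWm hnW hzT
      (hu.mono fun y hy => (hy.abs.pow b).mul hy) hz
    have h2 : Tendsto (fun i => w (i + 1) z.1 z.2) atTop (𝓝 (l z.1 z.2 -
      sduh k (fun s y => |u (s, y)| ^ b * u (s, y)) z.1 z.2)) := h1.const_sub _
    exact tendsto_nhds_unique ((tendsto_add_atTop_iff_nat 1).2 hzu) h2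

end

section
variable {n : ℕ} {α : ℝ} {η : Measure ℝ}

lemma lnorm_sum_le {X ι : Type*} [MeasurableSpace X] {μ : Measure X} {r : ℝ} (hr : 1 ≤ r)
    (s : Finset ι) {F : ι → X → ℝ≥0∞} (hF : ∀ j, Measurable (F j)) :
    lnorm μ r (fun x => ∑ j ∈ s, F j x) ≤ ∑ j ∈ s, lnorm μ r (F j) := by
  classical
  induction s using Finset.induction_on with
  | empty => simp [lnorm, show 0 < r by linarith]
  | insert j s hj ih =>
    simp only [Finset.sum_insert hj]
    exact (lnorm_add_le hr (hF j).aemeasurable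
      (Finset.measurable_sum s fun j _ => hF j).aemeasurable).trans (add_le_add le_rfl ih)

lemma IsStable.lnorm_absKer_le (h : IsStable α η) (hα : 0 < α) (n : ℕ) {r : ℝ} (hr : 1 ≤ r) :
    ∃ C > 0, ∀ t > 0, lnorm volume r (absKer (dMix n α η) t) ≤
      ENNReal.ofReal (C * t ^ (-(1 / (2 * α) + n / (2 * α) * (1 - 1 / r)))) := by
  have := h.prob
  obtain ⟨C, hC, H⟩ := h.lnorm_dMix_le hα n hr
  refine ⟨(n + 1) * C, by positivity, fun t ht => ?_⟩
  refine (lnorm_sum_le hr Finset.univ (F := fun j z => ‖dMix n α η j t z‖ₑ)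
    fun j => (dMix_measurable n α η j).of_uncurry_left.enorm).trans ?_
  refine (Finset.sum_le_sum fun j _ => H j t ht).trans ?_
  rw [Finset.sum_const, Finset.card_univ, Fintype.card_fin, nsmul_eq_mul, mul_assoc,
    ENNReal.ofReal_mul (p := (n:ℝ) + 1) (by positivity)]
  refine mul_le_mul_left (?_ : (n : ℝ≥0∞) ≤ ENNReal.ofReal (n + 1)) _
  rw [← ENNReal.ofReal_natCast]
  exact ENNReal.ofReal_le_ofReal (by linarith)

/-- Linear part of the Duhamel formula. -/
def linPart (n : ℕ) (α : ℝ) (η : Measure ℝ) (u₀ : Rn n → ℝ) (f : ℝ → Rn n → ℝ) (t : ℝ) (x : Rn n) : ℝ :=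
  (∫ y, gMix n α η t (x - y) * u₀ y) + sduh (fun _ : Unit => gMix n α η) f t x

/-- Absolute majorant of `linPart`. -/
def linMaj (n : ℕ) (α : ℝ) (η : Measure ℝ) (u₀ : Rn n → ℝ) (f : ℝ → Rn n → ℝ) (t : ℝ) (x : Rn n) : ℝ≥0∞ :=
  (∫⁻ y, ‖gMix n α η t (x - y)‖ₑ * ‖u₀ y‖ₑ) +
    duh (absKer (fun _ : Unit => gMix n α η)) (fun s y => ‖f s y‖ₑ) t x

variable {u₀ : Rn n → ℝ} {f : ℝ → Rn n → ℝ}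

lemma gMix_mul_measurable [SFinite η] (hu₀ : Measurable u₀) :
    Measurable (fun w : (ℝ × Rn n) × Rn n => gMix n α η w.1.1 (w.1.2 - w.2) * u₀ w.2) :=
  ((gMix_measurable n α η).comp (f := fun w : (ℝ × Rn n) × Rn n => (w.1.1, w.1.2 - w.2))
    (by fun_prop)).mul (hu₀.comp measurable_snd)

lemma initMaj_measurable [SFinite η] (hu₀ : Measurable u₀) :
    Measurable (Function.uncurry fun t x => ∫⁻ y, ‖gMix n α η t (x - y)‖ₑ * ‖u₀ y‖ₑ) := by
  refine Measurable.lintegral_prod_right'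
    (f := fun w : (ℝ × Rn n) × Rn n => ‖gMix n α η w.1.1 (w.1.2 - w.2)‖ₑ * ‖u₀ w.2‖ₑ) ?_
  simp_rw [← enorm_mul]
  exact (gMix_mul_measurable hu₀).enorm

lemma linMaj_measurable [SFinite η] (hu₀ : Measurable u₀) (hf : Measurable (Function.uncurry f)) :
    Measurable (Function.uncurry (linMaj n α η u₀ f)) :=
  (initMaj_measurable hu₀).add
    (duh_measurable (absKer_measurable fun _ => gMix_measurable n α η) (H := fun s y => ‖f s y‖ₑ) hf.enorm)

lemma linPart_measurable [SFinite η] (hu₀ : Measurable u₀) (hf : Measurable (Function.uncurry f)) :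
    Measurable (Function.uncurry (linPart n α η u₀ f)) := by
  refine Measurable.add ?_ (sduh_measurable (fun _ => gMix_measurable n α η) hf)
  exact (StronglyMeasurable.integral_prod_right'
    (f := fun w : (ℝ × Rn n) × Rn n => gMix n α η w.1.1 (w.1.2 - w.2) * u₀ w.2)
    (gMix_mul_measurable hu₀).stronglyMeasurable).measurable

lemma enorm_linPart_le [SFinite η] (hf : Measurable (Function.uncurry f)) (t : ℝ) (x : Rn n) :
    ‖linPart n α η u₀ f t x‖ₑ ≤ linMaj n α η u₀ f t x := by
  refine (enorm_add_le _ _).trans (add_le_add ?_ (enorm_sduh_le (fun _ => gMix_measurable n α η) hf t x))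
  refine (enorm_integral_le_lintegral_enorm _).trans (le_of_eq ?_)
  simp_rw [enorm_mul]

lemma absKer_unit (t : ℝ) (z : Rn n) :
    absKer (fun _ : Unit => gMix n α η) t z = ‖gMix n α η t z‖ₑ := by simp [absKer]

lemma IsStable.lnorm_linMaj_le (h : IsStable α η) (hα : 0 < α) (hu₀ : Measurable u₀)
    (hf : Measurable (Function.uncurry f)) {q ρ : ℝ} (hq : 1 ≤ q) (hqρ : q ≤ ρ) :
    ∃ C > 0, ∀ t > 0, lnorm volume ρ (linMaj n α η u₀ f t) ≤
      ENNReal.ofReal (C * t ^ (-(n / (2 * α) * (1 / q - 1 / ρ)))) * lnorm volume q (fun x => ‖u₀ x‖ₑ) +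
        volt C (n / (2 * α) * (1 / q - 1 / ρ)) (fun s => lnorm volume q (fun x => ‖f s x‖ₑ)) t := by
  have := h.prob
  have hq0 : 0 < q := by linarith
  have hρ0 : 0 < ρ := by linarith
  have hd : 0 ≤ 1 / q - 1 / ρ := by
    rw [sub_nonneg]; exact one_div_le_one_div_of_le hq0 hqρ
  have hd1 : 1 / q - 1 / ρ < 1 := by
    have : 1 / q ≤ 1 := by rw [div_le_one hq0]; exact hq
    have : 0 < 1 / ρ := by positivity
    linarith
  obtain ⟨r, hr⟩ : ∃ r, r = 1 / (1 - (1 / q - 1 / ρ)) := ⟨_, rfl⟩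
  have hri : 1 / r = 1 - (1 / q - 1 / ρ) := by rw [hr, one_div_one_div]
  have hr1 : 1 ≤ r := by rw [hr, le_div_iff₀ (by linarith)]; linarith
  obtain ⟨C, hC, H⟩ := h.lnorm_gMix_le hα n hr1
  have e1 : (1 - 1 / r) = 1 / q - 1 / ρ := by rw [hri]; ring
  rw [e1] at H
  have hfe : Measurable (Function.uncurry fun s y => ‖f s y‖ₑ) := hf.enorm
  have hg := absKer_measurable (fun _ : Unit => gMix_measurable n α η)
  have hexp : 1 + 1 / ρ = 1 / r + 1 / q := by rw [hri]; ring
  refine ⟨C, hC, fun t ht => ?_⟩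
  refine (lnorm_add_le (by linarith) (initMaj_measurable hu₀).of_uncurry_left.aemeasurable
    (duh_measurable hg hfe).of_uncurry_left.aemeasurable).trans (add_le_add ?_ ?_)
  · exact (lnorm_conv_le (g := fun x => ‖gMix n α η t x‖ₑ)
      (gMix_measurable n α η).of_uncurry_left.enorm hu₀.enorm hr1 hq hρ0 hexp).trans
      (mul_le_mul_left (H t ht) _)
  · refine lnorm_duh_le hg hfe hr1 hq (by linarith) hexp (fun t ht => ?_) t
    have : absKer (fun _ : Unit => gMix n α η) t = fun x => ‖gMix n α η t x‖ₑ :=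
      funext fun z => absKer_unit t z
    rw [this]
    exact H t ht

lemma volt_le_holder {C β r m t : ℝ} {G : ℝ → ℝ≥0∞} (hG : Measurable G) (hC : 0 ≤ C) (hr : 1 ≤ r)
    (hm : 0 < m) (hexp : 1 = 1 / r + 1 / m) (hβr : β * r < 1) (ht : 0 < t) :
    volt C β G t ≤ ENNReal.ofReal (C * (t ^ (1 - β * r) / (1 - β * r)) ^ (1 / r)) *
        lnorm (volume.restrict (Ioo 0 t)) m G := by
  have hr0 : 0 < r := by linarith
  rw [← lnorm_powKer hC hr hβr ht]
  unfold volt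
  rw [← lnorm_one]
  refine (lnorm_mul_le one_pos hr0 hm (by rw [← hexp, div_one])
    (Measurable.aemeasurable (by fun_prop)) hG.aemeasurable).trans (le_of_eq ?_)
  congr 1
  unfold lnorm
  congr 1
  have := (Measure.measurePreserving_sub_left (volume : Measure ℝ) t).setLIntegral_comp_preimage
    (s := Ioo 0 t) measurableSet_Ioo (f := fun τ => ENNReal.ofReal (C * τ ^ (-β)) ^ r) (by fun_prop)
  rw [← this]
  congr 2
  ext x; simp [and_comm]

end

section
variable {n : ℕ} {α : ℝ} {η : Measure ℝ} {u₀ : Rn n → ℝ} {f : ℝ → Rn n → ℝ} {q : ℝ}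

lemma IsStable.xnorm_linMaj_ne_top (h : IsStable α η) (hα : 0 < α) (hu₀m : Measurable u₀)
    (hfm : Measurable (Function.uncurry f)) (hq : 1 ≤ q)
    (hu₀ : lnorm volume q (fun x => ‖u₀ x‖ₑ) ≠ ⊤)
    (hf : ∫⁻ s in Ioo (0:ℝ) 1, lnorm volume q (fun x => ‖f s x‖ₑ) ≠ ⊤) {a ρ : ℝ} (ha : 1 ≤ a)
    (hρ : q ≤ ρ) (hκ : n / (2 * α) * (1 / q - 1 / ρ) * a < 1) :
    xnorm a ρ 1 (linMaj n α η u₀ f) ≠ ⊤ := by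
  have := h.prob
  obtain ⟨C, hC, H⟩ := h.lnorm_linMaj_le (n := n) hα hu₀m hfm hq hρ
  have hφ : Measurable fun s => lnorm volume q (fun x => ‖f s x‖ₑ) :=
    lnorm_measurable q (F := fun s x => ‖f s x‖ₑ) hfm.enorm
  set U := lnorm volume q (fun x => ‖u₀ x‖ₑ) with hU
  set κ := n / (2 * α) * (1 / q - 1 / ρ) with hκd
  have ha0 : 0 < a := by linarith
  have h1 : xnorm a ρ 1 (linMaj n α η u₀ f) ≤ lnorm (volume.restrict (Ioo 0 1)) a
      (fun t => U * ENNReal.ofReal (C * t ^ (-κ)) +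
        volt C κ (fun s => lnorm volume q (fun x => ‖f s x‖ₑ)) t) := by
    refine lnorm_mono ha0.le ?_
    filter_upwards [ae_restrict_mem measurableSet_Ioo] with t ht
    refine (H t ht.1).trans (le_of_eq ?_)
    rw [mul_comm U]
  refine ne_top_of_le_ne_top ?_ (h1.trans (lnorm_add_le ha (Measurable.aemeasurable (by fun_prop))
    (volt_measurable C κ hφ).aemeasurable))
  rw [lnorm_const_mul ha0 _ (Measurable.aemeasurable (by fun_prop)), lnorm_powKer hC.le ha hκ one_pos]
  refine ENNReal.add_ne_top.2 ⟨ENNReal.mul_ne_top hu₀ ENNReal.ofReal_ne_top, ?_⟩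
  refine ne_top_of_le_ne_top ?_ (lnorm_volt_le hφ hC.le ha le_rfl ha0 (by rw [one_div_one]; ring) hκ one_pos)
  rw [lnorm_one]
  exact ENNReal.mul_ne_top ENNReal.ofReal_ne_top hf

lemma IsStable.lnorm_linMaj_bound (h : IsStable α η) (hα : 0 < α) (hu₀m : Measurable u₀)
    (hfm : Measurable (Function.uncurry f)) (hq : 1 ≤ q)
    (hu₀ : lnorm volume q (fun x => ‖u₀ x‖ₑ) ≠ ⊤)
    (hf : ∫⁻ s in Ioo (0:ℝ) 1, lnorm volume q (fun x => ‖f s x‖ₑ) ≠ ⊤) :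
    ∃ M : ℝ≥0∞, M ≠ ⊤ ∧ ∀ t ∈ Ioo (0:ℝ) 1, lnorm volume q (linMaj n α η u₀ f t) ≤ M := by
  obtain ⟨C, hC, H⟩ := h.lnorm_linMaj_le (n := n) hα hu₀m hfm hq le_rfl
  refine ⟨ENNReal.ofReal C * lnorm volume q (fun x => ‖u₀ x‖ₑ) +
    ENNReal.ofReal C * ∫⁻ s in Ioo (0:ℝ) 1, lnorm volume q (fun x => ‖f s x‖ₑ),
    ENNReal.add_ne_top.2 ⟨ENNReal.mul_ne_top ENNReal.ofReal_ne_top hu₀,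
      ENNReal.mul_ne_top ENNReal.ofReal_ne_top hf⟩, fun t ht => ?_⟩
  have h1 := H t ht.1
  simp only [sub_self, mul_zero, neg_zero, Real.rpow_zero, mul_one] at h1
  refine h1.trans (add_le_add le_rfl ?_)
  unfold volt
  simp only [neg_zero, Real.rpow_zero, mul_one]
  rw [lintegral_const_mul' _ _ ENNReal.ofReal_ne_top]
  exact mul_le_mul_right (lintegral_mono_set (Ioo_subset_Ioo_right ht.2.le)) _

lemma xnorm_mono_time {a ρ T T' : ℝ} (ha : 0 ≤ a) (hT : T ≤ T') (F : ℝ → Rn n → ℝ≥0∞) :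
    xnorm a ρ T F ≤ xnorm a ρ T' F :=
  lnorm_mono_measure ha (Measure.restrict_mono (Ioo_subset_Ioo_right hT) le_rfl) _

/-- Space-time bound for the Duhamel term in `L^∞(L^q)`. -/
lemma lnorm_duh_pow_le {κ F : ℝ → Rn n → ℝ≥0∞} {a ρ T : ℝ} (hκ : Measurable (Function.uncurry κ))
    (hF : Measurable (Function.uncurry F)) {b C β r r' : ℝ} (hb : 0 < b) (hC : 0 ≤ C) (hr : 1 ≤ r)
    (hr' : 1 ≤ r') (hρ : b + 1 ≤ ρ) (ha : b + 1 ≤ a) (hq : 1 ≤ q)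
    (hexp : 1 + 1 / q = 1 / r + (b + 1) / ρ)
    (hexp' : 1 = 1 / r' + (b + 1) / a) (hβ : β * r' < 1) (hT : T ≤ 1)
    (hbd : ∀ t > 0, lnorm volume r (κ t) ≤ ENNReal.ofReal (C * t ^ (-β))) {t : ℝ} (ht : t ∈ Ioo 0 T) :
    lnorm volume q (duh κ (fun s y => F s y ^ b * F s y) t) ≤
      ENNReal.ofReal (C * (1 / (1 - β * r')) ^ (1 / r')) * (xnorm a ρ T F) ^ (b + 1) := by
  have hρ0 : 0 < ρ := by linarith
  have ha0 : 0 < a := by linarith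
  have hH : Measurable (Function.uncurry (fun s y => F s y ^ b * F s y)) := (hF.pow_const b).mul hF
  have hFt := lnorm_measurable (μ := (volume : Measure (Rn n))) ρ hF
  refine (lnorm_duh_le hκ hH hr (m := ρ / (b + 1)) (by rw [le_div_iff₀ (by linarith)]; linarith) hq
    (by rw [hexp, one_div_div]) hbd t).trans ?_
  refine (volt_mono C β (G := fun s => lnorm volume ρ (F s) ^ (b + 1)) (fun s => ?_) t).trans ?_
  · refine (lnorm_pow_mul_le hb hρ0 hF.of_uncurry_left.aemeasurable
      hF.of_uncurry_left.aemeasurable).trans (le_of_eq ?_)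
    rw [ENNReal.rpow_add_of_nonneg _ _ hb.le zero_le_one, ENNReal.rpow_one]
  refine (volt_le_holder (hFt.pow_const _) hC hr' (m := a / (b + 1)) (by positivity)
    (by rw [one_div_div]; exact hexp') hβ ht.1).trans ?_
  rw [lnorm_pow (by positivity) (by linarith), mul_div_cancel₀ _ (by linarith)]
  refine mul_le_mul' (ENNReal.ofReal_le_ofReal ?_) (ENNReal.rpow_le_rpow ?_ (by linarith))
  · have h1 : 0 < 1 - β * r' := by linarith
    refine mul_le_mul_of_nonneg_left ?_ hC
    refine Real.rpow_le_rpow (div_nonneg (Real.rpow_nonneg ht.1.le _) h1.le) ?_ (by positivity)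
    refine div_le_div_of_nonneg_right ?_ h1.le
    exact Real.rpow_le_one ht.1.le (by linarith [ht.2]) h1.le
  · exact xnorm_mono_time ha0.le ht.2.le F

end

section
variable {n : ℕ} {α : ℝ} {η : Measure ℝ} {u₀ : Rn n → ℝ} {f : ℝ → Rn n → ℝ} {q : ℝ} {b : ℕ}

set_option maxHeartbeats 1000000 in
theorem IsStable.exists_solution (h : IsStable α η) (hα : 1 / 2 < α) (hb : 1 ≤ b)
    (hq : 1 < q) (hδ : 0 < 1 - 1 / (2 * α) - n / (2 * α) * (b / q)) (hu₀m : Measurable u₀)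
    (hu₀ : lnorm volume q (fun x => ‖u₀ x‖ₑ) ≠ ⊤) (hfm : Measurable (Function.uncurry f))
    (hf : ∫⁻ s in Ioo (0:ℝ) 1, lnorm volume q (fun x => ‖f s x‖ₑ) ≠ ⊤) :
    ∃ T > 0, T ≤ 1 ∧ ∃ u : ℝ → Rn n → ℝ, Measurable (Function.uncurry u) ∧
      (∃ M : ℝ≥0∞, M ≠ ⊤ ∧ ∀ᵐ t ∂(volume.restrict (Ioo 0 T)),
        lnorm volume q (fun x => ‖u t x‖ₑ) ≤ M) ∧
      ∀ᵐ z ∂((volume.restrict (Ioo 0 T)).prod (volume : Measure (Rn n))),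
        linMaj n α η u₀ f z.1 z.2 ≠ ⊤ ∧
        duh (absKer (dMix n α η)) (fun s y => ‖|u s y| ^ b * u s y‖ₑ) z.1 z.2 ≠ ⊤ ∧
        u z.1 z.2 = linPart n α η u₀ f z.1 z.2 -
          sduh (dMix n α η) (fun s y => |u s y| ^ b * u s y) z.1 z.2 := by
  have := h.prob
  have hα0 : 0 < α := by linarith
  have hb1 : (1:ℝ) ≤ b := by exact_mod_cast hb
  have hq0 : 0 < q := by linarith
  obtain ⟨e, he⟩ : ∃ e, e = 1 / (2 * α) := ⟨_, rfl⟩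
  obtain ⟨c, hc⟩ : ∃ c, c = n / (2 * α) := ⟨_, rfl⟩
  have he0 : 0 < e := by rw [he]; positivity
  have hc0 : 0 ≤ c := by rw [hc]; positivity
  obtain ⟨ρ, hρd⟩ : ∃ ρ, ρ = max q (b + 1) := ⟨_, rfl⟩
  have hρq : q ≤ ρ := by rw [hρd]; exact le_max_left _ _
  have hρb : (b:ℝ) + 1 ≤ ρ := by rw [hρd]; exact le_max_right _ _
  have hρ0 : 0 < ρ := by linarith
  obtain ⟨x, hx⟩ : ∃ x, x = 1 / q := ⟨_, rfl⟩
  obtain ⟨y, hy⟩ : ∃ y, y = 1 / ρ := ⟨_, rfl⟩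
  have hx0 : 0 < x := by rw [hx]; positivity
  have hx1 : x < 1 := by rw [hx, div_lt_one hq0]; exact hq
  have hy0 : 0 < y := by rw [hy]; positivity
  have hbx0 : 0 ≤ b * x := by positivity
  have hby0 : 0 ≤ b * y := by positivity
  have hyx : y ≤ x := by rw [hx, hy]; exact one_div_le_one_div_of_le hq0 hρq
  have hyb : (b + 1) * y ≤ 1 := by
    rw [hy, mul_one_div, div_le_one hρ0]; exact hρb
  have hxy : x ≤ (b + 1) * y := by
    rcases le_total q (b + 1) with h1 | h1
    · rw [max_eq_right h1] at hρd
      rw [hy, hρd, mul_one_div, div_self (by linarith)]; exact hx1.le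
    · rw [max_eq_left h1] at hρd
      have : y = x := by rw [hx, hy, hρd]
      rw [this]; linarith
  obtain ⟨δ, hδd⟩ : ∃ δ, δ = 1 - e - c * (b * x) := ⟨_, rfl⟩
  have hδ0 : 0 < δ := by
    rw [hδd, he, hc, hx, mul_one_div]; exact hδ
  obtain ⟨κ, hκd⟩ : ∃ κ, κ = c * (x - y) := ⟨_, rfl⟩
  have hκ0 : 0 ≤ κ := by rw [hκd]; exact mul_nonneg hc0 (by linarith)
  obtain ⟨w, hw⟩ : ∃ w, w = δ / (2 * (b + 1)) := ⟨_, rfl⟩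
  have hw0 : 0 < w := by rw [hw]; positivity
  have hwδ : (b + 1) * w = δ / 2 := by rw [hw]; field_simp
  obtain ⟨A, hA⟩ : ∃ A, A = κ + w := ⟨_, rfl⟩
  have hA0 : 0 < A := by linarith
  have hbA0 : 0 ≤ b * A := by positivity
  have hκδ : (b + 1) * κ + δ ≤ 1 := by
    have : 0 ≤ c * ((b + 1) * y - x) := mul_nonneg hc0 (by linarith)
    rw [hκd, hδd]; linarith
  have hAb : (b + 1) * A ≤ 1 - δ / 2 := by rw [hA]; linarith
  obtain ⟨a, ha⟩ : ∃ a, a = 1 / A := ⟨_, rfl⟩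
  have haA : 1 / a = A := by rw [ha, one_div_one_div]
  have ha0 : 0 < a := by rw [ha]; positivity
  have hab : (b:ℝ) + 1 ≤ a := by rw [ha, le_div_iff₀ hA0]; linarith
  have hκa : κ * a < 1 := by rw [ha, mul_one_div, div_lt_one hA0]; linarith
  -- the linear part
  have hL := h.xnorm_linMaj_ne_top (n := n) hα0 hu₀m hfm hq.le hu₀ hf (a := a) (ρ := ρ) (by linarith) hρq
    (by rw [← hc, ← hx, ← hy, ← hκd]; exact hκa)
  obtain ⟨M₁, hM₁, hM₁'⟩ := h.lnorm_linMaj_bound (n := n) hα0 hu₀m hfm hq.le hu₀ hf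
  -- the bilinear estimate
  have hby : b * y < 1 := by linarith
  obtain ⟨r, hr⟩ : ∃ r, r = 1 / (1 - b * y) := ⟨_, rfl⟩
  have hri : 1 / r = 1 - b * y := by rw [hr, one_div_one_div]
  have hr1 : 1 ≤ r := by
    rw [hr, le_div_iff₀ (by linarith)]; linarith
  have hbA : b * A < 1 := by linarith
  obtain ⟨r', hr'⟩ : ∃ r', r' = 1 / (1 - b * A) := ⟨_, rfl⟩
  have hri' : 1 / r' = 1 - b * A := by rw [hr', one_div_one_div]
  have hr1' : 1 ≤ r' := by
    rw [hr', le_div_iff₀ (by linarith)]; linarith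
  obtain ⟨C, hC, hK⟩ := h.lnorm_absKer_le hα0 n hr1
  obtain ⟨β, hβ⟩ : ∃ β, β = e + c * (b * y) := ⟨_, rfl⟩
  have hK' : ∀ t > 0, lnorm volume r (absKer (dMix n α η) t) ≤ ENNReal.ofReal (C * t ^ (-β)) := by
    intro t ht
    refine (hK t ht).trans (le_of_eq ?_)
    rw [hri, hβ, he, hc]; congr 4; ring
  have hβr : β * r' < 1 := by
    rw [hr', mul_one_div, div_lt_one (by linarith), hβ, hA]
    have : c * (b * y) = c * (b * x) - b * κ := by rw [hκd]; ring
    linarith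
  -- the L^∞ L^q estimate
  obtain ⟨r₂, hr₂⟩ : ∃ r₂, r₂ = 1 / (1 + x - (b + 1) * y) := ⟨_, rfl⟩
  have hri₂ : 1 / r₂ = 1 + x - (b + 1) * y := by rw [hr₂, one_div_one_div]
  have hr1₂ : 1 ≤ r₂ := by
    rw [hr₂, le_div_iff₀ (by linarith)]; linarith
  obtain ⟨s₂, hs₂⟩ : ∃ s₂, s₂ = 1 / (1 - (b + 1) * A) := ⟨_, rfl⟩
  have hsi₂ : 1 / s₂ = 1 - (b + 1) * A := by rw [hs₂, one_div_one_div]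
  have hs1₂ : 1 ≤ s₂ := by
    rw [hs₂, le_div_iff₀ (by linarith)]; linarith
  obtain ⟨C₂, hC₂, hK₂⟩ := h.lnorm_absKer_le hα0 n hr1₂
  obtain ⟨β₂, hβ₂⟩ : ∃ β₂, β₂ = e + c * ((b + 1) * y - x) := ⟨_, rfl⟩
  have hK₂' : ∀ t > 0, lnorm volume r₂ (absKer (dMix n α η) t) ≤
      ENNReal.ofReal (C₂ * t ^ (-β₂)) := by
    intro t ht
    refine (hK₂ t ht).trans (le_of_eq ?_)
    rw [hri₂, hβ₂, he, hc]; congr 4; ring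
  have hβs : β₂ * s₂ < 1 := by
    rw [hs₂, mul_one_div, div_lt_one (by linarith), hβ₂, hA]
    have : c * ((b + 1) * y - x) = c * (b * x) - (b + 1) * κ := by rw [hκd]; ring
    linarith
  -- choice of the existence time
  obtain ⟨Λ, hΛ⟩ : ∃ Λ : ℝ, Λ = (xnorm a ρ 1 (linMaj n α η u₀ f)).toReal + 1 := ⟨_, rfl⟩
  have hΛ0 : 0 < Λ := by rw [hΛ]; positivity
  have hLΛ : xnorm a ρ 1 (linMaj n α η u₀ f) ≤ ENNReal.ofReal Λ := by
    rw [← ENNReal.ofReal_toReal hL, hΛ]; exact ENNReal.ofReal_le_ofReal (by linarith)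
  obtain ⟨T, hT0, hT1, hTε⟩ := exists_time_small (C := C) (c := 1 - β * r') (d := 1 / r')
    (ε := 1 / (2 * (b + 1) * (2 * Λ) ^ (b:ℝ))) (by linarith) (by positivity) (by positivity)
  have hdm : ∀ j, Measurable (Function.uncurry (dMix n α η j)) := dMix_measurable n α η
  obtain ⟨u, hum, hux, hu⟩ := exists_picard_limit (k := dMix n α η) (T := T) (a := a) (ρ := ρ) hdm
    (linPart_measurable (n := n) (α := α) (η := η) hu₀m hfm) (linMaj_measurable hu₀m hfm)
    (fun t x => enorm_linPart_le hfm t x) (b := b) (by linarith) (by linarith)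
    (Λ := ENNReal.ofReal Λ) (ε := ENNReal.ofReal (1 / (2 * (b + 1) * (2 * Λ) ^ (b:ℝ))))
    ENNReal.ofReal_ne_top ((xnorm_mono_time ha0.le hT1 _).trans hLΛ)
    (fun F G hF hG => (xnorm_duh_le (absKer_measurable hdm) hF hG (by linarith) hC.le hr1 hr1' hρb hab
      (by rw [hri, hy]; ring) (by rw [hri', ← haA]; ring) hβr hT0 hK').trans
      (mul_le_mul_left (ENNReal.ofReal_le_ofReal hTε) _))
    (by
      rw [show (2:ℝ≥0∞) = ENNReal.ofReal 2 by simp, ← ENNReal.ofReal_mul (by norm_num),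
        ENNReal.ofReal_rpow_of_nonneg (by positivity) (by positivity),
        ← ENNReal.ofReal_mul (by positivity), ← ENNReal.ofReal_mul (by positivity),
        ← ENNReal.ofReal_inv_of_pos (by norm_num)]
      refine ENNReal.ofReal_le_ofReal (le_of_eq ?_)
      have : (2 * Λ) ^ (b:ℝ) ≠ 0 := by positivity
      field_simp)
  have hLfin : ∀ᵐ z ∂((volume.restrict (Ioo 0 T)).prod (volume : Measure (Rn n))),
      linMaj n α η u₀ f z.1 z.2 ≠ ⊤ :=
    ae_lt_top_of_xnorm ha0 hρ0 (linMaj_measurable hu₀m hfm)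
      (ne_top_of_le_ne_top hL (xnorm_mono_time ha0.le hT1 _))
  have hue : Measurable (Function.uncurry fun t x => ‖u t x‖ₑ) := hum.enorm
  refine ⟨T, hT0, hT1, u, hum, ⟨M₁ + ENNReal.ofReal (C₂ * (1 / (1 - β₂ * s₂)) ^ (1 / s₂)) *
      (2 * ENNReal.ofReal Λ) ^ ((b:ℝ) + 1), ?_, ?_⟩, ?_⟩
  · refine ENNReal.add_ne_top.2 ⟨hM₁, ENNReal.mul_ne_top ENNReal.ofReal_ne_top ?_⟩
    exact ENNReal.rpow_ne_top_of_nonneg (by positivity)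
      (ENNReal.mul_ne_top (by simp) ENNReal.ofReal_ne_top)
  · filter_upwards [Measure.ae_ae_of_ae_prod hu, ae_restrict_mem measurableSet_Ioo] with t ht htT
    have h1 : lnorm volume q (fun x => ‖u t x‖ₑ) ≤ lnorm volume q (fun x => linMaj n α η u₀ f t x +
        duh (absKer (dMix n α η)) (fun s y => ‖u s y‖ₑ ^ (b:ℝ) * ‖u s y‖ₑ) t x) := by
      refine lnorm_mono hq0.le ?_
      filter_upwards [ht] with x hx
      rw [hx.2]
      refine (enorm_sub_le).trans (add_le_add (enorm_linPart_le hfm t x) ?_)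
      refine (enorm_sduh_le hdm (abs_pow_mul_measurable b hum) t x).trans (le_of_eq ?_)
      simp_rw [enorm_abs_pow_mul]
    refine h1.trans ((lnorm_add_le hq.le (linMaj_measurable hu₀m hfm).of_uncurry_left.aemeasurable
      (duh_measurable (absKer_measurable hdm)
        (H := fun s y => ‖u s y‖ₑ ^ (b:ℝ) * ‖u s y‖ₑ)
        ((hue.pow_const _).mul hue)).of_uncurry_left.aemeasurable).trans (add_le_add ?_ ?_))
    · exact hM₁' t ⟨htT.1, htT.2.trans_le hT1⟩
    · refine (lnorm_duh_pow_le (absKer_measurable hdm) hue (a := a) (ρ := ρ) (by linarith) hC₂.le hr1₂ hs1₂ hρb hab hq.le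
        ?_ ?_ hβs hT1 hK₂' htT).trans ?_
      · rw [hri₂, ← hx, div_eq_mul_one_div, ← hy]; ring
      · rw [hsi₂, div_eq_mul_one_div, haA]; ring
      · exact mul_le_mul_right (ENNReal.rpow_le_rpow hux (by positivity)) _
  · filter_upwards [hu, hLfin] with z h1 h2 using ⟨h2, h1⟩

end

section
variable {n : ℕ} {α : ℝ} {η : Measure ℝ}

lemma IsStable.gKer_eq_gMix (h : IsStable α η) (hα : 0 < α) {t : ℝ} (ht : 0 < t) :
    gKer n α t = gMix n α η t := funext fun x => h.gKer_eq hα n ht x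

lemma IsStable.dKer_eq_dMix (h : IsStable α η) (hα : 0 < α) {t : ℝ} (ht : 0 < t) (j : Fin n) :
    dKer n α t j = dMix n α η j t := funext fun x => h.dKer_eq hα n ht j x

variable {K k H : ℝ → Rn n → ℝ}

lemma restrict_Ioc_prod_univ (t : ℝ) :
    ((volume : Measure ℝ).prod (volume : Measure (Rn n))).restrict (Ioc 0 t ×ˢ univ) =
      (volume.restrict (Ioo 0 t)).prod volume := by
  rw [← Measure.prod_restrict, Measure.restrict_univ, Measure.restrict_congr_set Ioo_ae_eq_Ioc]

lemma kernel_congr_ae (hK : ∀ τ > 0, K τ = k τ) (t : ℝ) (x : Rn n) :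
    (fun z : ℝ × Rn n => K (t - z.1) (x - z.2) * H z.1 z.2)
      =ᵐ[(volume.restrict (Ioo 0 t)).prod volume]
      fun z => k (t - z.1) (x - z.2) * H z.1 z.2 := by
  have h1 : ∀ᵐ z ∂((volume.restrict (Ioo 0 t)).prod (volume : Measure (Rn n))), z.1 ∈ Ioo 0 t :=
    Measure.quasiMeasurePreserving_fst.ae (ae_restrict_mem measurableSet_Ioo)
  filter_upwards [h1] with z hz
  rw [hK _ (by linarith [hz.2])]

lemma integrableOn_kernel_iff (hK : ∀ τ > 0, K τ = k τ) (t : ℝ) (x : Rn n) :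
    IntegrableOn (fun z : ℝ × Rn n => K (t - z.1) (x - z.2) * H z.1 z.2)
      (Ioc 0 t ×ˢ univ) (volume.prod volume) ↔
    Integrable (fun z : ℝ × Rn n => k (t - z.1) (x - z.2) * H z.1 z.2)
      ((volume.restrict (Ioo 0 t)).prod volume) := by
  rw [IntegrableOn, restrict_Ioc_prod_univ]
  exact integrable_congr (kernel_congr_ae hK t x)

lemma integral_conv_eq (hK : ∀ τ > 0, K τ = k τ) {t : ℝ} {x : Rn n}
    (hi : Integrable (fun z : ℝ × Rn n => k (t - z.1) (x - z.2) * H z.1 z.2)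
      ((volume.restrict (Ioo 0 t)).prod volume)) :
    ∫ s in Ioc (0:ℝ) t, conv n (K (t - s)) (H s) x =
      ∫ z, k (t - z.1) (x - z.2) * H z.1 z.2 ∂((volume.restrict (Ioo 0 t)).prod volume) := by
  rw [integral_prod _ hi, ← Measure.restrict_congr_set Ioo_ae_eq_Ioc]
  refine setIntegral_congr_fun measurableSet_Ioo fun s hs => ?_
  simp only [conv, hK (t - s) (by linarith [hs.2])]

lemma ae_prod_restrict_Ioc_iff {T : ℝ} {P : ℝ × Rn n → Prop} :
    (∀ᵐ z ∂((volume.restrict (Ioc 0 T)).prod (volume : Measure (Rn n))), P z) ↔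
      ∀ᵐ z ∂((volume.restrict (Ioo 0 T)).prod (volume : Measure (Rn n))), P z := by
  rw [Measure.restrict_congr_set Ioo_ae_eq_Ioc]

lemma ae_fst_mem_Ioo (S T : ℝ) :
    ∀ᵐ z ∂((volume.restrict (Ioo S T)).prod (volume : Measure (Rn n))), z.1 ∈ Ioo S T :=
  Measure.quasiMeasurePreserving_fst.ae (ae_restrict_mem measurableSet_Ioo)

variable {b : ℕ} {u₀ : Rn n → ℝ} {f u : ℝ → Rn n → ℝ} {T : ℝ}

theorem IsStable.isMildSol_of_ae (h : IsStable α η) (hα : 0 < α) (hu₀ : Measurable u₀)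
    (hf : Measurable (Function.uncurry f)) (hu : Measurable (Function.uncurry u))
    (H : ∀ᵐ z ∂((volume.restrict (Ioo 0 T)).prod (volume : Measure (Rn n))),
      linMaj n α η u₀ f z.1 z.2 ≠ ⊤ ∧
      duh (absKer (dMix n α η)) (fun s y => ‖|u s y| ^ b * u s y‖ₑ) z.1 z.2 ≠ ⊤ ∧
      u z.1 z.2 = linPart n α η u₀ f z.1 z.2 -
        sduh (dMix n α η) (fun s y => |u s y| ^ b * u s y) z.1 z.2) :
    IsMildSol1' n α b (Ioc 0 T) f u₀ u := by
  have := h.prob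
  refine ae_prod_restrict_Ioc_iff.2 ?_
  filter_upwards [H, ae_fst_mem_Ioo 0 T] with z hz hzT
  obtain ⟨h1, h2, h3⟩ := hz
  obtain ⟨t, x⟩ := z
  dsimp only at h1 h2 h3 hzT ⊢
  have hg : ∀ τ > 0, gKer n α τ = gMix n α η τ := fun τ hτ => h.gKer_eq_gMix hα hτ
  have hd : ∀ j, ∀ τ > 0, dKer n α τ j = dMix n α η j τ := fun j τ hτ => h.dKer_eq_dMix hα hτ j
  rw [linMaj, ENNReal.add_ne_top] at h1
  have i1 : Integrable (fun y => gMix n α η t (x - y) * u₀ y) volume := by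
    refine ⟨((gMix_mul_measurable hu₀).comp (measurable_const (a := (t, x)).prodMk measurable_id)).aestronglyMeasurable, ?_⟩
    rw [HasFiniteIntegral, lt_top_iff_ne_top]
    simpa only [enorm_mul] using h1.1
  have i2 := integrable_of_duh (fun _ : Unit => gMix_measurable n α η) hf h1.2 ()
  have i3 := integrable_of_duh (dMix_measurable n α η) (abs_pow_mul_measurable b hu) h2
  refine ⟨by rw [hg t hzT.1]; exact i1, (integrableOn_kernel_iff hg t x).2 i2,
    fun j => (integrableOn_kernel_iff (K := fun τ => dKer n α τ j)
      (H := fun s y => |u s y| ^ b * u s y) (hd j) t x).2 (i3 j), ?_⟩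
  rw [integral_conv_eq hg i2, h3, linPart, conv, hg t hzT.1]
  congr 1
  · simp [sduh]
  · refine Finset.sum_congr rfl fun j _ => ?_
    exact (integral_conv_eq (K := fun τ => dKer n α τ j)
      (H := fun s y => |u s y| ^ b * u s y) (hd j) (i3 j)).symm

theorem IsStable.ae_of_isMildSol (h : IsStable α η) (hα : 0 < α)
    (hu : Measurable (Function.uncurry u))
    (H : IsMildSol1' n α b (Ioc 0 T) f u₀ u) :
    ∀ᵐ z ∂((volume.restrict (Ioo 0 T)).prod (volume : Measure (Rn n))),
      duh (absKer (dMix n α η)) (fun s y => ‖|u s y| ^ b * u s y‖ₑ) z.1 z.2 ≠ ⊤ ∧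
      u z.1 z.2 = linPart n α η u₀ f z.1 z.2 -
        sduh (dMix n α η) (fun s y => |u s y| ^ b * u s y) z.1 z.2 := by
  have := h.prob
  filter_upwards [ae_prod_restrict_Ioc_iff.1 H, ae_fst_mem_Ioo 0 T] with z hz hzT
  obtain ⟨h1, h2, h3, h4⟩ := hz
  obtain ⟨t, x⟩ := z
  dsimp only at h1 h2 h3 h4 hzT ⊢
  have hg : ∀ τ > 0, gKer n α τ = gMix n α η τ := fun τ hτ => h.gKer_eq_gMix hα hτ
  have hd : ∀ j, ∀ τ > 0, dKer n α τ j = dMix n α η j τ := fun j τ hτ => h.dKer_eq_dMix hα hτ j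
  have i2 := (integrableOn_kernel_iff hg t x).1 h2
  have i3 : ∀ j, Integrable (fun z : ℝ × Rn n => dMix n α η j (t - z.1) (x - z.2) *
      (|u z.1 z.2| ^ b * u z.1 z.2)) ((volume.restrict (Ioo 0 t)).prod volume) := fun j =>
    (integrableOn_kernel_iff (K := fun τ => dKer n α τ j)
      (H := fun s y => |u s y| ^ b * u s y) (hd j) t x).1 (h3 j)
  constructor
  · rw [← sum_lintegral_eq_duh (dMix_measurable n α η) (abs_pow_mul_measurable b hu)]
    exact (ENNReal.sum_lt_top.2 fun j _ => (i3 j).2).ne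
  · rw [h4, integral_conv_eq hg i2, linPart, conv, hg t hzT.1]
    congr 1
    · simp [sduh]
    · refine Finset.sum_congr rfl fun j _ => ?_
      exact (integral_conv_eq (K := fun τ => dKer n α τ j)
        (H := fun s y => |u s y| ^ b * u s y) (hd j) (i3 j))

end

lemma eLpNorm_eq_lnorm {X : Type*} [MeasurableSpace X] {μ : Measure X} {q : ℝ} (hq : 0 < q) (g : X → ℝ) :
    eLpNorm g (ENNReal.ofReal q) μ = lnorm μ q (fun x => ‖g x‖ₑ) := by
  rw [eLpNorm_eq_lintegral_rpow_enorm_toReal (by simpa using hq) ENNReal.ofReal_ne_top,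
    ENNReal.toReal_ofReal hq.le, lnorm]

lemma lnorm_le_of_eNormT_le {n : ℕ} {p : ℝ → ℝ} {q T R P : ℝ} {v : ℝ → Rn n → ℝ} (hq : 0 < q)
    (hT1 : T ≤ 1) (hR : 0 < R) (hP : 1 ≤ P) (hp : ∀ᵐ t ∂(volume.restrict (Ioc 0 T)), P ≤ p t)
    (hv : eNormT n p q T v ≤ ENNReal.ofReal R) :
    lnorm (volume.restrict (Ioo 0 T)) P (fun t => lnorm volume q (fun x => ‖v t x‖ₑ)) ≤
      ENNReal.ofReal (4 * R) := by
  have hP0 : 0 < P := by linarith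
  have hlt : eNormT n p q T v < ENNReal.ofReal (2 * R) :=
    hv.trans_lt ((ENNReal.ofReal_lt_ofReal_iff (by linarith)).2 (by linarith))
  obtain ⟨lam, ⟨hl0, hl⟩, hlR⟩ := sInf_lt_iff.1 hlt
  have h2R : ENNReal.ofReal (2 * R) ≠ 0 := by simpa using hR
  simp_rw [eLpNorm_eq_lnorm hq] at hl
  have h1 : ∫⁻ t in Ioo 0 T, (lnorm volume q (fun x => ‖v t x‖ₑ) / ENNReal.ofReal (2 * R)) ^ P ≤ 2 := by
    rw [Measure.restrict_congr_set Ioo_ae_eq_Ioc]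
    have h2 : ∫⁻ t in Ioc 0 T, (lnorm volume q (fun x => ‖v t x‖ₑ) / ENNReal.ofReal (2 * R)) ^ P ≤
        ∫⁻ t in Ioc 0 T, (1 + (lnorm volume q (fun x => ‖v t x‖ₑ) / lam) ^ p t) := by
      refine lintegral_mono_ae ?_
      filter_upwards [hp] with t ht
      have h3 : lnorm volume q (fun x => ‖v t x‖ₑ) / ENNReal.ofReal (2 * R) ≤
        lnorm volume q (fun x => ‖v t x‖ₑ) / lam := ENNReal.div_le_div_left hlR.le _
      rcases le_total (lnorm volume q (fun x => ‖v t x‖ₑ) / ENNReal.ofReal (2 * R)) 1 with h4 | h4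
      · exact (ENNReal.rpow_le_one h4 hP0.le).trans le_self_add
      · refine le_trans ?_ le_add_self
        exact (ENNReal.rpow_le_rpow_of_exponent_le h4 ht).trans
          (ENNReal.rpow_le_rpow h3 (by linarith))
    refine h2.trans ?_
    rw [lintegral_add_left measurable_const, lintegral_const, Measure.restrict_apply_univ, one_mul,
      Real.volume_Ioc]
    refine (add_le_add (?_ : _ ≤ (1:ℝ≥0∞)) hl).trans (by norm_num)
    rw [ENNReal.ofReal_le_one]; linarith
  rw [lnorm_le_iff hP0]
  have h5 : ∀ t, lnorm volume q (fun x => ‖v t x‖ₑ) ^ P =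
      ENNReal.ofReal (2 * R) ^ P * (lnorm volume q (fun x => ‖v t x‖ₑ) / ENNReal.ofReal (2 * R)) ^ P := by
    intro t
    rw [← ENNReal.mul_rpow_of_nonneg _ _ hP0.le, ENNReal.mul_div_cancel h2R ENNReal.ofReal_ne_top]
  simp_rw [h5]
  rw [lintegral_const_mul' _ _ (ENNReal.rpow_ne_top_of_nonneg hP0.le ENNReal.ofReal_ne_top)]
  refine (mul_le_mul_right h1 _).trans ?_
  have h6 : ENNReal.ofReal (4 * R) = ENNReal.ofReal (2 * R) * 2 := by
    rw [show 4 * R = 2 * R * 2 by ring, ENNReal.ofReal_mul (by positivity), ENNReal.ofReal_ofNat]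
  rw [h6, ENNReal.mul_rpow_of_nonneg _ _ hP0.le]
  refine mul_le_mul_right (?_ : (2:ℝ≥0∞) ≤ _) _
  exact ENNReal.le_rpow_self_of_one_le (by norm_num) hP

lemma exists_eNormT_le {n : ℕ} {p : ℝ → ℝ} {q T R P : ℝ} {u : ℝ → Rn n → ℝ} {M : ℝ≥0∞} (hq : 0 < q)
    (hT : 0 < T) (hR : 0 < R) (hp0 : ∀ᵐ t ∂(volume.restrict (Ioc 0 T)), 0 ≤ p t)
    (hp : ∀ᵐ t ∂(volume.restrict (Ioc 0 T)), p t ≤ P) (hP : 0 ≤ P) (hM : M ≠ ⊤)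
    (hu : ∀ᵐ t ∂(volume.restrict (Ioo 0 T)), lnorm volume q (fun x => ‖u t x‖ₑ) ≤ M) :
    ∃ T' > 0, T' ≤ T ∧ eNormT n p q T' u ≤ ENNReal.ofReal R := by
  have hR' : ENNReal.ofReal R ≠ 0 := by simpa using hR
  set K : ℝ≥0∞ := (max 1 (M / ENNReal.ofReal R)) ^ P with hK
  have hKt : K ≠ ⊤ := by
    refine ENNReal.rpow_ne_top_of_nonneg hP ?_
    exact max_ne_top ENNReal.one_ne_top (ENNReal.div_ne_top hM hR')
  obtain ⟨k, hk0, hk⟩ : ∃ k : ℝ, 0 ≤ k ∧ K = ENNReal.ofReal k :=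
    ⟨K.toReal, ENNReal.toReal_nonneg, (ENNReal.ofReal_toReal hKt).symm⟩
  refine ⟨min T (1 / (k + 1)), by positivity, min_le_left _ _, sInf_le ⟨by simpa using hR, ?_⟩⟩
  rw [Measure.restrict_congr_set Ioo_ae_eq_Ioc] at hu
  have hsub : Ioc 0 (min T (1 / (k + 1))) ⊆ Ioc 0 T := Ioc_subset_Ioc_right (min_le_left _ _)
  have h1 : ∀ᵐ t ∂(volume.restrict (Ioc 0 T)),
      (eLpNorm (u t) (ENNReal.ofReal q) volume / ENNReal.ofReal R) ^ p t ≤ K := by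
    filter_upwards [hp0, hp, hu] with t h1 h2 h3
    rw [eLpNorm_eq_lnorm hq]
    calc _ ≤ (max 1 (M / ENNReal.ofReal R)) ^ p t :=
          ENNReal.rpow_le_rpow ((ENNReal.div_le_div_right h3 _).trans (le_max_right _ _)) h1
      _ ≤ K := ENNReal.rpow_le_rpow_of_exponent_le (le_max_left _ _) h2
  refine (lintegral_mono_ae (ae_restrict_of_ae_restrict_of_subset hsub h1)).trans ?_
  rw [lintegral_const, Measure.restrict_apply_univ, Real.volume_Ioc, sub_zero]
  rw [hk, ← ENNReal.ofReal_mul hk0, ENNReal.ofReal_le_one]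
  refine (mul_le_mul_of_nonneg_left (min_le_right _ _) hk0).trans ?_
  rw [mul_one_div, div_le_one (by linarith)]
  linarith

lemma setLIntegral_sub_left (S t : ℝ) {g : ℝ → ℝ≥0∞} :
    ∫⁻ s in Ioo S t, g s = ∫⁻ τ in Ioo 0 (t - S), g (t - τ) := by
  have h1 := (Measure.measurePreserving_sub_left (volume : Measure ℝ) t).setLIntegral_comp_preimage_emb
    (MeasurableEquiv.subLeft t).measurableEmbedding g (Ioo S t)
  rw [← h1]
  congr 2
  ext x; simp only [mem_preimage, mem_Ioo]
  constructor <;> rintro ⟨h1, h2⟩ <;> constructor <;> linarith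

lemma setLIntegral_le_fracInt {δ S T t : ℝ} (D : ℝ → ℝ≥0∞) (ht : t ≤ T) :
    ∫⁻ s in Ioo S t, ENNReal.ofReal ((t - s) ^ (δ - 1)) * D s ≤
      fracInt δ ((Ioo S T).indicator D) t := by
  rw [setLIntegral_sub_left, fracInt]
  refine (setLIntegral_mono_ae' measurableSet_Ioo (Eventually.of_forall fun τ hτ => ?_)).trans
    (lintegral_mono_set (Ioo_subset_Ioi_self : Ioo 0 (t - S) ⊆ Ioi 0))
  rw [indicator_of_mem (show t - τ ∈ Ioo S T from ⟨by linarith [hτ.2], by linarith [hτ.1]⟩), sub_sub_cancel]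

/-- A Volterra inequality with critical coefficient has only the trivial solution. -/
theorem ae_eq_zero_of_le_mul_volterra {δ m : ℝ} (hδ : 0 < δ) (hm : 1 < m) (hmδ : m * δ < 1) :
    ∃ ε > 0, ∀ (S T : ℝ) (A D : ℝ → ℝ≥0∞), Measurable A → Measurable D →
      ∫⁻ t in Ioo S T, D t ^ m ≠ ⊤ →
      (∀ᵐ t ∂(volume.restrict (Ioo S T)),
        D t ≤ A t * ∫⁻ s in Ioo S t, ENNReal.ofReal ((t - s) ^ (δ - 1)) * D s) →
      ∫⁻ t in Ioo S T, A t ^ (1 / δ) ≤ ENNReal.ofReal (ε ^ (1 / δ)) →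
      ∀ᵐ t ∂(volume.restrict (Ioo S T)), D t = 0 := by
  obtain ⟨ε, hε, H⟩ := ae_eq_zero_of_le_mul_fracInt hδ hm hmδ
  refine ⟨ε, hε, fun S T A D hA hD hDm hle hAε => ?_⟩
  have hind : ∀ (F : ℝ → ℝ≥0∞) (k : ℝ), 0 < k →
      ∫⁻ t, (Ioo S T).indicator F t ^ k = ∫⁻ t in Ioo S T, F t ^ k := by
    intro F k hk
    rw [← lintegral_indicator measurableSet_Ioo]
    congr 1; ext t
    by_cases ht : t ∈ Ioo S T <;> simp [ht, hk]
  have h1 := H ((Ioo S T).indicator A) ((Ioo S T).indicator D) (hA.indicator measurableSet_Ioo)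
    (hD.indicator measurableSet_Ioo) (by rw [hind D m (by linarith)]; exact hDm) ?_
    (by rw [hind A _ (by positivity)]; exact hAε)
  · rw [ae_restrict_iff' measurableSet_Ioo]
    filter_upwards [h1] with t ht hmem
    rwa [indicator_of_mem hmem] at ht
  · filter_upwards [(ae_restrict_iff' measurableSet_Ioo).1 hle] with t ht
    by_cases hmem : t ∈ Ioo S T
    · rw [indicator_of_mem hmem, indicator_of_mem hmem]
      exact (ht hmem).trans (mul_le_mul_right (setLIntegral_le_fracInt D hmem.2.le) _)
    · rw [indicator_of_notMem hmem]; exact bot_le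

section
variable {n : ℕ} {α : ℝ} {η : Measure ℝ} {b : ℕ} {u v l : ℝ → Rn n → ℝ} {T : ℝ}
  {ι : Type*} [Fintype ι] {k : ι → ℝ → Rn n → ℝ}

/-- The difference of two solutions is controlled by the Duhamel integral of the difference of
the nonlinearities. -/
lemma enorm_sub_le_duh (hk : ∀ j, Measurable (Function.uncurry (k j)))
    (hu : Measurable (Function.uncurry u)) (hv : Measurable (Function.uncurry v)) {t : ℝ} {x : Rn n}
    (h1 : duh (absKer k) (fun s y => ‖|u s y| ^ b * u s y‖ₑ) t x ≠ ⊤)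
    (h2 : u t x = l t x - sduh k (fun s y => |u s y| ^ b * u s y) t x)
    (h1' : duh (absKer k) (fun s y => ‖|v s y| ^ b * v s y‖ₑ) t x ≠ ⊤)
    (h2' : v t x = l t x - sduh k (fun s y => |v s y| ^ b * v s y) t x) :
    ‖v t x - u t x‖ₑ ≤
      duh (absKer k) (fun s y => ENNReal.ofReal (b + 1) *
        ((max ‖u s y‖ₑ ‖v s y‖ₑ) ^ (b:ℝ) * ‖v s y - u s y‖ₑ)) t x := by
  have h3 : v t x - u t x = sduh k (fun s y => |u s y| ^ b * u s y - |v s y| ^ b * v s y) t x := by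
    rw [← sduh_sub hk (abs_pow_mul_measurable b hu) (abs_pow_mul_measurable b hv) h1 h1', h2, h2']
    ring
  rw [h3]
  refine (enorm_sduh_le hk (H := fun s y => |u s y| ^ b * u s y - |v s y| ^ b * v s y)
    ((abs_pow_mul_measurable b hu).sub (abs_pow_mul_measurable b hv)) t x).trans ?_
  unfold duh
  refine lintegral_mono fun s => lintegral_mono fun y => mul_le_mul_right ?_ _
  have := enorm_abs_pow_mul_sub_le b (U := max ‖u s y‖ₑ ‖v s y‖ₑ) (x := u s y) (y := v s y) (le_max_left _ _)
    (le_max_right _ _)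
  rwa [enorm_sub_rev (u s y)] at this

lemma lintegral_coeff_le {X : Type*} [MeasurableSpace X] {μ : Measure X} {δ b C ε R : ℝ} {M : X → ℝ≥0∞}
    (hδ : 0 < δ) (hb : 0 < b) (hC : 0 ≤ C) (hε : 0 ≤ ε) (hM : Measurable M)
    (hMR : lnorm μ (b / δ) M ≤ ENNReal.ofReal R) (hR : C * R ^ b ≤ ε) :
    ∫⁻ x, (ENNReal.ofReal C * M x ^ b) ^ (1 / δ) ∂μ ≤ ENNReal.ofReal (ε ^ (1 / δ)) := by
  have h1 : (0:ℝ) < 1 / δ := by positivity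
  rw [← ENNReal.ofReal_rpow_of_nonneg hε h1.le, ← lnorm_le_iff h1, lnorm_const_mul h1 _
    (hM.pow_const b).aemeasurable, lnorm_pow h1 hb, mul_one_div]
  rcases le_total 0 R with hR0 | hR0
  · refine (mul_le_mul_right (ENNReal.rpow_le_rpow hMR hb.le) _).trans ?_
    rw [ENNReal.ofReal_rpow_of_nonneg hR0 hb.le, ← ENNReal.ofReal_mul hC]
    exact ENNReal.ofReal_le_ofReal hR
  · rw [ENNReal.ofReal_of_nonpos hR0] at hMR
    rw [le_antisymm hMR bot_le, ENNReal.zero_rpow_of_pos hb, mul_zero]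
    exact bot_le

lemma lnorm_max_le {X : Type*} [MeasurableSpace X] {μ : Measure X} {r : ℝ} (hr : 1 ≤ r)
    {F G : X → ℝ≥0∞} (hF : Measurable F) (hG : Measurable G) :
    lnorm μ r (fun x => max (F x) (G x)) ≤ lnorm μ r F + lnorm μ r G :=
  (lnorm_mono (by linarith) (Eventually.of_forall fun _ => max_le le_self_add le_add_self)).trans
    (lnorm_add_le hr hF.aemeasurable hG.aemeasurable)

end

section
variable {n : ℕ} {α : ℝ} {η : Measure ℝ} {b : ℕ} {q : ℝ}

/-- Uniqueness of small solutions when the nonlinearity is locally integrable. -/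
theorem IsStable.unique_of_le (h : IsStable α η) (hα : 1 / 2 < α) (hb : 1 ≤ b)
    (hq : (b:ℝ) + 1 ≤ q) {δ : ℝ} (hδ : δ = 1 - 1 / (2 * α) - n / (2 * α) * (b / q)) (hδ0 : 0 < δ)
    (hδ1 : δ < 1 / 2) :
    ∃ R > 0, ∀ (T : ℝ) (l u v : ℝ → Rn n → ℝ), Measurable (Function.uncurry u) →
      Measurable (Function.uncurry v) →
      lnorm (volume.restrict (Ioo 0 T)) (b / δ) (fun t => lnorm volume q (fun x => ‖u t x‖ₑ)) ≤
        ENNReal.ofReal R →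
      lnorm (volume.restrict (Ioo 0 T)) (b / δ) (fun t => lnorm volume q (fun x => ‖v t x‖ₑ)) ≤
        ENNReal.ofReal R →
      (∀ᵐ z ∂((volume.restrict (Ioo 0 T)).prod (volume : Measure (Rn n))),
        duh (absKer (dMix n α η)) (fun s y => ‖|u s y| ^ b * u s y‖ₑ) z.1 z.2 ≠ ⊤ ∧
        u z.1 z.2 = l z.1 z.2 - sduh (dMix n α η) (fun s y => |u s y| ^ b * u s y) z.1 z.2) →
      (∀ᵐ z ∂((volume.restrict (Ioo 0 T)).prod (volume : Measure (Rn n))),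
        duh (absKer (dMix n α η)) (fun s y => ‖|v s y| ^ b * v s y‖ₑ) z.1 z.2 ≠ ⊤ ∧
        v z.1 z.2 = l z.1 z.2 - sduh (dMix n α η) (fun s y => |v s y| ^ b * v s y) z.1 z.2) →
      ∀ᵐ z ∂((volume.restrict (Ioo 0 T)).prod (volume : Measure (Rn n))), v z.1 z.2 = u z.1 z.2 := by
  have := h.prob
  have hα0 : 0 < α := by linarith
  have hb1 : (1:ℝ) ≤ b := by exact_mod_cast hb
  have hb0 : (0:ℝ) < b := by linarith
  have hq0 : 0 < q := by linarith
  obtain ⟨P, hP⟩ : ∃ P, P = b / δ := ⟨_, rfl⟩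
  have hP0 : 0 < P := by rw [hP]; positivity
  have hPb : (b:ℝ) + 1 < P := by rw [hP, lt_div_iff₀ hδ0]; nlinarith
  obtain ⟨ε, hε, H⟩ := ae_eq_zero_of_le_mul_volterra (δ := δ) (m := P / (b + 1)) hδ0
    (by rw [lt_div_iff₀ (by linarith)]; linarith)
    (by rw [hP]; field_simp; linarith)
  have hbq : b / q < 1 := by rw [div_lt_one hq0]; linarith
  have hr1 : 1 ≤ 1 / (1 - b / q) := by
    rw [le_div_iff₀ (by linarith)]
    have : 0 ≤ b / q := by positivity
    linarith
  obtain ⟨C, hC, hK⟩ := h.lnorm_absKer_le hα0 n hr1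
  obtain ⟨C', hC'⟩ : ∃ C', C' = (b + 1) * C := ⟨_, rfl⟩
  have hC'0 : 0 < C' := by rw [hC']; positivity
  have hK' : ∀ t > 0, lnorm volume (1 / (1 - b / q)) (absKer (dMix n α η) t) ≤
      ENNReal.ofReal (C * t ^ (-(1 - δ))) := by
    intro t ht
    refine (hK t ht).trans (le_of_eq ?_)
    rw [one_div_one_div, hδ]; congr 4; ring
  have hdm : ∀ j, Measurable (Function.uncurry (dMix n α η j)) := dMix_measurable n α η
  obtain ⟨R, hR0, hRε⟩ : ∃ R > 0, C' * (2 * R) ^ (b:ℝ) ≤ ε := by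
    refine ⟨(ε / C') ^ (1 / (b:ℝ)) / 2, by positivity, le_of_eq ?_⟩
    rw [mul_div_cancel₀ _ two_ne_zero, ← Real.rpow_mul (by positivity), one_div_mul_cancel hb0.ne',
      Real.rpow_one, mul_div_cancel₀ _ hC'0.ne']
  refine ⟨R, hR0, fun T l u v hu hv huR hvR Hu Hv => ?_⟩
  rw [← hP] at huR hvR
  set U : ℝ → Rn n → ℝ≥0∞ := fun t x => max ‖u t x‖ₑ ‖v t x‖ₑ with hU
  set w : ℝ → Rn n → ℝ≥0∞ := fun t x => ‖v t x - u t x‖ₑ with hw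
  have hue : Measurable (Function.uncurry fun t x => ‖u t x‖ₑ) := hu.enorm
  have hve : Measurable (Function.uncurry fun t x => ‖v t x‖ₑ) := hv.enorm
  have hUm : Measurable (Function.uncurry U) := hue.max hve
  have hwm : Measurable (Function.uncurry w) := (hv.sub hu).enorm
  set M : ℝ → ℝ≥0∞ := fun t => lnorm volume q (U t) with hM
  set W : ℝ → ℝ≥0∞ := fun t => lnorm volume q (w t) with hW
  have hMm : Measurable M := lnorm_measurable q hUm
  have hWm : Measurable W := lnorm_measurable q hwm
  have hum := lnorm_measurable (μ := (volume : Measure (Rn n))) q hue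
  have hvm := lnorm_measurable (μ := (volume : Measure (Rn n))) q hve
  have hMR : lnorm (volume.restrict (Ioo 0 T)) P M ≤ ENNReal.ofReal (2 * R) := by
    refine (lnorm_mono hP0.le (Eventually.of_forall fun t => lnorm_max_le (by linarith)
      hue.of_uncurry_left hve.of_uncurry_left)).trans ?_
    refine (lnorm_add_le (by linarith) hum.aemeasurable hvm.aemeasurable).trans ?_
    rw [two_mul, ENNReal.ofReal_add hR0.le hR0.le]
    exact add_le_add huR hvR
  have hWR : lnorm (volume.restrict (Ioo 0 T)) P W ≤ ENNReal.ofReal (2 * R) := by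
    refine (lnorm_mono hP0.le (G := fun t => lnorm volume q (fun x => ‖v t x‖ₑ) +
      lnorm volume q (fun x => ‖u t x‖ₑ)) (Eventually.of_forall fun t => ?_)).trans ?_
    · exact (lnorm_mono hq0.le (Eventually.of_forall fun _ => enorm_sub_le)).trans
        (lnorm_add_le (by linarith) hve.of_uncurry_left.aemeasurable hue.of_uncurry_left.aemeasurable)
    refine (lnorm_add_le (by linarith) hvm.aemeasurable hum.aemeasurable).trans ?_
    rw [two_mul, ENNReal.ofReal_add hR0.le hR0.le]
    exact add_le_add hvR huR
  set D : ℝ → ℝ≥0∞ := fun t => M t ^ (b:ℝ) * W t with hD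
  have hDm : Measurable D := (hMm.pow_const _).mul hWm
  have hWle : ∀ᵐ t ∂(volume.restrict (Ioo 0 T)), W t ≤
      ENNReal.ofReal C' * ∫⁻ s in Ioo 0 t, ENNReal.ofReal ((t - s) ^ (δ - 1)) * D s := by
    filter_upwards [Measure.ae_ae_of_ae_prod Hu, Measure.ae_ae_of_ae_prod Hv] with t h1 h2
    have hm1 : Measurable (Function.uncurry fun s y => ENNReal.ofReal (b + 1) *
        (U s y ^ (b:ℝ) * w s y)) := ((hUm.pow_const (b:ℝ)).mul hwm).const_mul _
    have h3 : W t ≤ lnorm volume q (duh (absKer (dMix n α η)) (fun s y => ENNReal.ofReal (b + 1) *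
        (U s y ^ (b:ℝ) * w s y)) t) := by
      refine lnorm_mono hq0.le ?_
      filter_upwards [h1, h2] with x hx hx'
      exact enorm_sub_le_duh hdm hu hv hx.1 hx.2 hx'.1 hx'.2
    refine h3.trans ((lnorm_duh_le (absKer_measurable hdm) hm1 hr1 (m := q / (b + 1))
      (by rw [le_div_iff₀ (by linarith)]; linarith) (by linarith) ?_ hK' t).trans ?_)
    · rw [one_div_one_div, one_div_div]; field_simp; ring
    · unfold volt
      rw [← lintegral_const_mul' _ _ ENNReal.ofReal_ne_top]
      refine setLIntegral_mono_ae' measurableSet_Ioo (Eventually.of_forall fun s hs => ?_)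
      beta_reduce
      have hm2 : Measurable (fun y => U s y ^ (b:ℝ) * w s y) :=
        (hUm.of_uncurry_left.pow_const _).mul hwm.of_uncurry_left
      rw [lnorm_const_mul (by positivity) _ hm2.aemeasurable]
      refine (mul_le_mul_right (mul_le_mul_right (lnorm_pow_mul_le hb0 hq0
        hUm.of_uncurry_left.aemeasurable hwm.of_uncurry_left.aemeasurable) _) _).trans (le_of_eq ?_)
      have : 0 ≤ t - s := by linarith [hs.2]
      rw [neg_sub, ENNReal.ofReal_mul hC.le, hC', ENNReal.ofReal_mul (by linarith)]
      ring
  have hD0 : ∀ᵐ t ∂(volume.restrict (Ioo 0 T)), D t = 0 := by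
    refine H 0 T (fun t => ENNReal.ofReal C' * M t ^ (b:ℝ)) D ((hMm.pow_const _).const_mul _) hDm ?_ ?_ ?_
    · rw [← lnorm_rpow (by positivity)]
      refine ENNReal.rpow_ne_top_of_nonneg (by positivity) ?_
      refine ne_top_of_le_ne_top ?_ (lnorm_pow_mul_le hb0 hP0 hMm.aemeasurable hWm.aemeasurable)
      exact ENNReal.mul_ne_top (ENNReal.rpow_ne_top_of_nonneg hb0.le
        (ne_top_of_le_ne_top ENNReal.ofReal_ne_top hMR)) (ne_top_of_le_ne_top ENNReal.ofReal_ne_top hWR)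
    · filter_upwards [hWle] with t ht
      refine (mul_le_mul_right ht _).trans (le_of_eq ?_)
      ring
    · exact lintegral_coeff_le hδ0 hb0 hC'0.le hε.le hMm (hP ▸ hMR) hRε
  have hW0 : ∀ᵐ t ∂(volume.restrict (Ioo 0 T)), W t = 0 := by
    filter_upwards [hWle, ae_restrict_mem measurableSet_Ioo] with t ht htT
    refine le_antisymm (ht.trans (le_of_eq ?_)) bot_le
    have hm3 : Measurable (fun s => ENNReal.ofReal ((t - s) ^ (δ - 1)) * D s) :=
      Measurable.mul (by fun_prop) hDm
    rw [(lintegral_eq_zero_iff hm3).2, mul_zero]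
    filter_upwards [ae_restrict_of_ae_restrict_of_subset (Ioo_subset_Ioo_right htT.2.le) hD0] with s hs
    simp [hs]
  have hvu : MeasurableSet {z : ℝ × Rn n | v z.1 z.2 = u z.1 z.2} := measurableSet_eq_fun hv hu
  rw [Measure.ae_prod_iff_ae_ae hvu]
  filter_upwards [hW0] with t ht
  filter_upwards [lnorm_eq_zero hq0 hwm.of_uncurry_left.aemeasurable ht] with x hx
  simpa [hw, sub_eq_zero] using hx

end

/-- The radial profile of the derivative of the one-dimensional Gaussian of variance `ρ`. -/
def psi (ρ a : ℝ) : ℝ := 2 * Real.pi ^ 2 / ρ * (√(Real.pi / ρ) * Real.exp (-(Real.pi ^ 2 * a / ρ)))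

lemma psi_nonneg {ρ : ℝ} (hρ : 0 < ρ) (a : ℝ) : 0 ≤ psi ρ a := by unfold psi; positivity

lemma psi_scale {ρ m : ℝ} (hρ : 0 < ρ) (hm : 0 < m) (a : ℝ) :
    psi ρ (a * m ^ 2) = m ^ (-3 : ℝ) * psi (ρ / m ^ 2) a := by
  unfold psi
  have e1 : Real.pi / (ρ / m ^ 2) = Real.pi / ρ * m ^ 2 := by field_simp
  have e2 : Real.pi ^ 2 * a / (ρ / m ^ 2) = Real.pi ^ 2 * (a * m ^ 2) / ρ := by field_simp
  have e3 : m ^ (-3 : ℝ) = (m ^ 3)⁻¹ := by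
    rw [Real.rpow_neg hm.le]; norm_cast
  rw [e1, e2, e3, Real.sqrt_mul (by positivity), Real.sqrt_sq hm.le]
  field_simp

lemma psi_anti {ρ a a' : ℝ} (hρ : 0 < ρ) (h : a ≤ a') : psi ρ a' ≤ psi ρ a := by
  unfold psi; gcongr

lemma poly_le_exp {s : ℝ} (hs : 0 ≤ s) : s * (1 + s) ^ 2 ≤ 11 * Real.exp s := by
  have h1 := Real.pow_div_factorial_le_exp s hs 1
  have h2 := Real.pow_div_factorial_le_exp s hs 2
  have h3 := Real.pow_div_factorial_le_exp s hs 3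
  simp [Nat.factorial] at h1 h2 h3
  nlinarith

lemma sqrt_le_one_add {s : ℝ} (hs : 0 ≤ s) : √s ≤ 1 + s := by
  nlinarith [Real.sq_sqrt hs, Real.sqrt_nonneg s, sq_nonneg (√s - 1)]

lemma psi_eq {y : ℝ} (hy : 0 < y) :
    psi y 1 = 2 * Real.pi ^ 2 * √Real.pi * (y⁻¹ * √(y⁻¹) * Real.exp (-(Real.pi ^ 2 * y⁻¹))) := by
  unfold psi
  rw [div_eq_mul_inv Real.pi y, Real.sqrt_mul Real.pi_pos.le]
  field_simp

lemma exists_psi_le : ∃ C > 0, ∀ y > 0, psi y 1 ≤ C * (1 - Real.exp (-y)) := by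
  refine ⟨2 * Real.pi ^ 2 * √Real.pi * 11, by positivity, fun y hy => ?_⟩
  rw [psi_eq hy, mul_assoc _ 11]
  refine mul_le_mul_of_nonneg_left ?_ (by positivity)
  obtain ⟨s, hs⟩ : ∃ s, s = y⁻¹ := ⟨_, rfl⟩
  have hs0 : 0 < s := by rw [hs]; positivity
  have hy' : y = s⁻¹ := by rw [hs, inv_inv]
  have h1 : 1 / (1 + s) ≤ 1 - Real.exp (-y) := by
    have h2 : Real.exp (-y) ≤ 1 / (1 + y) := by
      rw [Real.exp_neg, ← one_div]
      exact one_div_le_one_div_of_le (by positivity) (by linarith [Real.add_one_le_exp y])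
    have h3 : 1 - 1 / (1 + y) = 1 / (1 + s) := by rw [hy']; field_simp; ring
    linarith
  have h4 : Real.exp (-(Real.pi ^ 2 * s)) ≤ Real.exp (-s) := by
    have h5 : 1 ≤ Real.pi ^ 2 := by nlinarith [Real.pi_gt_three]
    rw [Real.exp_le_exp, neg_le_neg_iff]
    exact le_mul_of_one_le_left hs0.le h5
  rw [← hs]
  calc s * √s * Real.exp (-(Real.pi ^ 2 * s)) ≤ s * (1 + s) * Real.exp (-s) := by
        gcongr; exact sqrt_le_one_add hs0.le
    _ ≤ 11 * (1 / (1 + s)) := by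
        rw [Real.exp_neg, mul_one_div, le_div_iff₀ (by positivity), ← div_eq_mul_inv,
          div_mul_eq_mul_div, div_le_iff₀ (Real.exp_pos _)]
        linarith [poly_le_exp hs0.le]
    _ ≤ _ := by gcongr

lemma exists_le_psi {M : ℝ} (hM : 1 ≤ M) : ∃ c > 0, ∀ y > 0,
    c * (Real.exp (-y) - Real.exp (-(y * 2)) - 2 / M * (1 - Real.exp (-(y * M)))) ≤ psi y 1 := by
  refine ⟨(3 * Real.exp (Real.pi ^ 2 * M))⁻¹, by positivity, fun y hy => ?_⟩
  rcases le_total (y * M) 1 with h | h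
  · refine le_trans (mul_nonpos_of_nonneg_of_nonpos (by positivity) ?_) (psi_nonneg hy 1)
    have h1 : y * M / 2 ≤ 1 - Real.exp (-(y * M)) := by
      have hyM : 0 < y * M := by positivity
      have h2 : Real.exp (-(y * M)) ≤ 1 / (1 + y * M) := by
        rw [Real.exp_neg, ← one_div]
        exact one_div_le_one_div_of_le (by positivity) (by linarith [Real.add_one_le_exp (y * M)])
      have h3 : y * M / 2 ≤ 1 - 1 / (1 + y * M) := by
        have : 1 - 1 / (1 + y * M) = y * M / (1 + y * M) := by field_simp; ring
        rw [this]; gcongr; linarith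
      linarith
    have h4 : y ≤ 2 / M * (1 - Real.exp (-(y * M))) := by
      calc y = 2 / M * (y * M / 2) := by field_simp
        _ ≤ _ := by gcongr
    have h5 : Real.exp (-y) - Real.exp (-(y * 2)) ≤ y := by
      have e : Real.exp (-(y * 2)) = Real.exp (-y) * Real.exp (-y) := by
        rw [← Real.exp_add]; congr 1; ring
      have h6 : 1 - y ≤ Real.exp (-y) := by linarith [Real.add_one_le_exp (-y)]
      have h7 : Real.exp (-y) ≤ 1 := by rw [Real.exp_le_one_iff]; linarith
      rw [e]
      nlinarith [Real.exp_pos (-y)]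
    linarith
  · rw [inv_mul_le_iff₀ (by positivity), psi_eq hy]
    have h1 : y⁻¹ ≤ M := by rw [inv_le_iff_one_le_mul₀ hy]; linarith
    have h2 : 0 ≤ 2 / M * (1 - Real.exp (-(y * M))) := by
      have : Real.exp (-(y * M)) ≤ 1 := by
        rw [Real.exp_le_one_iff]; linarith
      exact mul_nonneg (by positivity) (by linarith)
    have h3 : Real.exp (-y) ≤ 3 * (y⁻¹ * √(y⁻¹)) := by
      have h4 : y * (1 + y) ≤ 3 * Real.exp y := by
        have h1 := Real.pow_div_factorial_le_exp y hy.le 1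
        have h2 := Real.pow_div_factorial_le_exp y hy.le 2
        simp [Nat.factorial] at h1 h2
        nlinarith
      have h5 : y * √y ≤ 3 * Real.exp y :=
        (mul_le_mul_of_nonneg_left (sqrt_le_one_add hy.le) hy.le).trans h4
      have hsy := Real.sqrt_pos.2 hy
      rw [Real.exp_neg, Real.sqrt_inv, ← mul_inv, ← div_eq_mul_inv, le_div_iff₀ (by positivity),
        inv_mul_le_iff₀ (Real.exp_pos _)]
      linarith
    have h6 : 1 ≤ 2 * Real.pi ^ 2 * √Real.pi := by
      have : 1 ≤ √Real.pi := by rw [Real.one_le_sqrt]; linarith [Real.pi_gt_three]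
      have h7 : 1 ≤ Real.pi ^ 2 := by nlinarith [Real.pi_gt_three]
      nlinarith
    have h7 : 1 ≤ Real.exp (Real.pi ^ 2 * M) * Real.exp (-(Real.pi ^ 2 * y⁻¹)) := by
      rw [← Real.exp_add, Real.one_le_exp_iff]
      nlinarith [sq_nonneg Real.pi]
    calc Real.exp (-y) - Real.exp (-(y * 2)) - 2 / M * (1 - Real.exp (-(y * M)))
        ≤ Real.exp (-y) := by linarith [Real.exp_pos (-(y * 2))]
      _ ≤ 3 * (y⁻¹ * √(y⁻¹)) * 1 * 1 := by linarith
      _ ≤ 3 * (y⁻¹ * √(y⁻¹)) * (Real.exp (Real.pi ^ 2 * M) * Real.exp (-(Real.pi ^ 2 * y⁻¹))) *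
          (2 * Real.pi ^ 2 * √Real.pi) := by gcongr
      _ = _ := by ring

lemma norm_rn_one (z : Rn 1) : ‖z‖ = |z 0| := by
  simp [EuclideanSpace.norm_eq, Real.sqrt_sq_eq_abs]

lemma dgauss_one {ρ : ℝ} (z : Rn 1) : dgauss 1 ρ 0 z = -z 0 * psi ρ (‖z‖ ^ 2) := by
  unfold dgauss gauss psi
  rw [Nat.cast_one, Real.sqrt_eq_rpow]
  ring

namespace IsStable
variable {α : ℝ} {η : Measure ℝ}

lemma absKer_one_eq (h : IsStable α η) {t : ℝ} (ht : 0 < t) (z : Rn 1) :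
    absKer (dMix 1 α η) t z =
      ENNReal.ofReal (‖z‖ * ∫ r, psi (r * t ^ (1 / α)) (‖z‖ ^ 2) ∂η) := by
  have h0 : 0 ≤ ∫ r, psi (r * t ^ (1 / α)) (‖z‖ ^ 2) ∂η := by
    refine integral_nonneg_of_ae ?_
    filter_upwards [h.pos] with r hr
    exact psi_nonneg (by positivity) _
  simp only [absKer, Finset.univ_unique, Fin.default_eq_zero, Finset.sum_singleton, dMix,
    dgauss_one, integral_const_mul]
  rw [Real.enorm_eq_ofReal_abs, abs_mul, abs_neg, abs_of_nonneg h0, norm_rn_one]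

lemma integrable_psi (h : IsStable α η) (hα : 0 < α) {t a : ℝ} (ht : 0 < t) (ha : 0 ≤ a) :
    Integrable (fun r => psi (r * t) a) η := by
  refine ((h.integrable_scaled hα (σ := 3 / 2) (c := 1) (by norm_num) zero_le_one ht).const_mul
    (2 * Real.pi ^ 2 * √Real.pi)).mono' (Measurable.aestronglyMeasurable (by unfold psi; fun_prop)) ?_
  filter_upwards [h.pos] with r hr
  have hρ : 0 < r * t := by positivity
  rw [Real.norm_of_nonneg (psi_nonneg hρ a)]
  unfold psi
  have e : (1 / (r * t)) ^ (3 / 2 : ℝ) = 1 / (r * t) * √(1 / (r * t)) := by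
    rw [Real.sqrt_eq_rpow, ← Real.rpow_one_add' (by positivity) (by norm_num)]; norm_num
  have h1 : Real.exp (-(Real.pi ^ 2 * a / (r * t))) ≤ 1 := by
    rw [Real.exp_le_one_iff, neg_nonpos]; positivity
  rw [e, div_eq_mul_one_div Real.pi, Real.sqrt_mul Real.pi_pos.le]
  calc _ ≤ 2 * Real.pi ^ 2 / (r * t) * (√Real.pi * √(1 / (r * t)) * 1) := by gcongr
    _ = _ := by ring

lemma integral_one_sub_exp (h : IsStable α η) (hα : 0 < α) {t m : ℝ} (ht : 0 < t) (hm : 0 < m)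
    {s : ℝ} (hs : 0 ≤ s) : ∫ r, Real.exp (-(r * t ^ (1 / α) / m ^ 2 * s)) ∂η =
      Real.exp (-(s ^ α * (t * m ^ (-(2 * α))))) := by
  have e : ∀ r, r * t ^ (1 / α) / m ^ 2 * s = r * (t ^ (1 / α) / m ^ 2 * s) := fun r => by ring
  simp_rw [e]
  rw [h.laplace_nonneg hα (by positivity), Real.mul_rpow (by positivity) hs,
    Real.div_rpow (by positivity) (by positivity), ← Real.rpow_mul ht.le, one_div_mul_cancel hα.ne',
    Real.rpow_one, Real.rpow_neg hm.le, Real.rpow_mul hm.le]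
  norm_cast
  congr 2
  ring

lemma integrable_one_sub_exp (h : IsStable α η) {t m : ℝ} (ht : 0 < t)
    {s : ℝ} (hs : 0 ≤ s) : Integrable (fun r => Real.exp (-(r * t ^ (1 / α) / m ^ 2 * s))) η := by
  have e : ∀ r, r * t ^ (1 / α) / m ^ 2 * s = r * (t ^ (1 / α) / m ^ 2 * s) := fun r => by ring
  simp_rw [e]
  exact h.integrable_exp (by positivity)

lemma absKer_one_le (h : IsStable α η) (hα : 0 < α) : ∃ C > 0, ∀ t > 0, ∀ z : Rn 1, z ≠ 0 →
    absKer (dMix 1 α η) t z ≤ ENNReal.ofReal (C * (t * ‖z‖ ^ (-(2 + 2 * α)))) := by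
  have := h.prob
  obtain ⟨C, hC, hψ⟩ := exists_psi_le
  refine ⟨C, hC, fun t ht z hz => ?_⟩
  rw [h.absKer_one_eq ht]
  refine ENNReal.ofReal_le_ofReal ?_
  have hm : 0 < ‖z‖ := norm_pos_iff.2 hz
  generalize ‖z‖ = m at hm
  have h1 : ∫ r, psi (r * t ^ (1 / α)) (m ^ 2) ∂η ≤
      ∫ r, m ^ (-3:ℝ) * (C * (1 - Real.exp (-(r * t ^ (1 / α) / m ^ 2 * 1)))) ∂η := by
    refine integral_mono_ae (h.integrable_psi hα (by positivity) (by positivity))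
      ((((integrable_const _).sub (h.integrable_one_sub_exp ht zero_le_one)).const_mul _).const_mul _) ?_
    filter_upwards [h.pos] with r hr
    have h2 := psi_scale (ρ := r * t ^ (1 / α)) (by positivity) hm 1
    rw [one_mul] at h2
    rw [h2, mul_one]
    exact mul_le_mul_of_nonneg_left (hψ _ (by positivity)) (by positivity)
  rw [integral_const_mul, integral_const_mul, integral_sub (integrable_const _)
    (h.integrable_one_sub_exp ht zero_le_one), h.integral_one_sub_exp hα ht hm zero_le_one] at h1
  simp only [integral_const, probReal_univ, one_smul, Real.one_rpow, one_mul] at h1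
  have h3 : 1 - Real.exp (-(t * m ^ (-(2 * α)))) ≤ t * m ^ (-(2 * α)) := by
    linarith [Real.add_one_le_exp (-(t * m ^ (-(2 * α))))]
  calc m * ∫ r, psi (r * t ^ (1 / α)) (m ^ 2) ∂η
      ≤ m * (m ^ (-3:ℝ) * (C * (t * m ^ (-(2 * α))))) := by
        refine mul_le_mul_of_nonneg_left (h1.trans ?_) hm.le
        gcongr
    _ = C * (t * (m ^ (1:ℝ) * m ^ (-3:ℝ) * m ^ (-(2 * α)))) := by rw [Real.rpow_one]; ring
    _ = _ := by
        rw [← Real.rpow_add hm, ← Real.rpow_add hm]; congr 3; ring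

lemma le_absKer_one (h : IsStable α η) (hα : 0 < α) (hα1 : α < 1) :
    ∃ c > 0, ∀ t > 0, t ≤ 1 → ∀ z : Rn 1,
    ENNReal.ofReal (c * (t * (‖z‖ * (1 + ‖z‖) ^ (-(3 + 2 * α))))) ≤ absKer (dMix 1 α η) t z := by
  have := h.prob
  obtain ⟨M, hM, hMα⟩ : ∃ M : ℝ, 1 ≤ M ∧ 2 * M ^ (-(1 - α)) ≤ (2 ^ α - 1) * Real.exp (-2) / 2 := by
    have h2 : (1:ℝ) < 2 ^ α := Real.one_lt_rpow one_lt_two hα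
    have h1 := (tendsto_rpow_neg_atTop (sub_pos.2 hα1)).const_mul 2
    rw [mul_zero] at h1
    have h3 : 0 < (2 ^ α - 1) * Real.exp (-2) / 2 :=
      div_pos (mul_pos (by linarith) (Real.exp_pos _)) two_pos
    obtain ⟨M, h4, h5⟩ := ((eventually_ge_atTop 1).and (h1.eventually_le_const h3)).exists
    exact ⟨M, h4, h5⟩
  have hκ : 0 < (2 ^ α - 1) * Real.exp (-2) / 2 := by
    have h2 : (1:ℝ) < 2 ^ α := Real.one_lt_rpow one_lt_two hα
    exact div_pos (mul_pos (by linarith) (Real.exp_pos _)) two_pos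
  obtain ⟨κ, hκe⟩ : ∃ κ, κ = (2 ^ α - 1) * Real.exp (-2) / 2 := ⟨_, rfl⟩
  rw [← hκe] at hκ hMα
  obtain ⟨c, hc, hψ⟩ := exists_le_psi hM
  refine ⟨c * κ, by positivity, fun t ht ht1 z => ?_⟩
  rw [h.absKer_one_eq ht]
  refine ENNReal.ofReal_le_ofReal ?_
  have hz : 0 ≤ ‖z‖ := norm_nonneg z
  generalize ‖z‖ = a at hz
  obtain ⟨m, hm⟩ : ∃ m, m = 1 + a := ⟨_, rfl⟩
  have hm0 : 0 < m := by linarith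
  rw [← hm]
  have hM0 : 0 < M := by linarith
  have i1 := h.integrable_one_sub_exp (m := m) ht zero_le_one
  have i2 := h.integrable_one_sub_exp (m := m) ht zero_le_two
  have i3 := h.integrable_one_sub_exp (m := m) ht hM0.le
  have h1 : ∫ r, m ^ (-3:ℝ) * (c * (Real.exp (-(r * t ^ (1 / α) / m ^ 2 * 1)) -
      Real.exp (-(r * t ^ (1 / α) / m ^ 2 * 2)) -
      2 / M * (1 - Real.exp (-(r * t ^ (1 / α) / m ^ 2 * M))))) ∂η ≤
      ∫ r, psi (r * t ^ (1 / α)) (a ^ 2) ∂η := by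
    refine integral_mono_ae (((((i1.sub i2).sub
      (((integrable_const _).sub i3).const_mul _)).const_mul _).const_mul _))
      (h.integrable_psi hα (by positivity) (by positivity)) ?_
    filter_upwards [h.pos] with r hr
    have h2 := psi_scale (ρ := r * t ^ (1 / α)) (by positivity) hm0 1
    rw [one_mul] at h2
    have h3 : psi (r * t ^ (1 / α)) (m ^ 2) ≤ psi (r * t ^ (1 / α)) (a ^ 2) :=
      psi_anti (by positivity) (by gcongr; linarith)
    rw [h2] at h3
    refine le_trans ?_ h3
    rw [mul_one]
    exact mul_le_mul_of_nonneg_left (hψ _ (by positivity)) (by positivity)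
  have i4 : Integrable (fun r => Real.exp (-(r * t ^ (1 / α) / m ^ 2 * 1)) -
      Real.exp (-(r * t ^ (1 / α) / m ^ 2 * 2))) η := i1.sub i2
  have i5 : Integrable (fun r => 2 / M * (1 - Real.exp (-(r * t ^ (1 / α) / m ^ 2 * M)))) η :=
    ((integrable_const _).sub i3).const_mul _
  rw [integral_const_mul, integral_const_mul, integral_sub i4 i5, integral_sub i1 i2,
    integral_const_mul, integral_sub (integrable_const _) i3,
    h.integral_one_sub_exp hα ht hm0 zero_le_one, h.integral_one_sub_exp hα ht hm0 zero_le_two,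
    h.integral_one_sub_exp hα ht hm0 hM0.le] at h1
  simp only [integral_const, probReal_univ, one_smul, Real.one_rpow, one_mul] at h1
  obtain ⟨u, hu⟩ : ∃ u, u = t * m ^ (-(2 * α)) := ⟨_, rfl⟩
  have hu0 : 0 < u := by rw [hu]; positivity
  have hu1 : u ≤ 1 := by
    have : m ^ (-(2 * α)) ≤ 1 := Real.rpow_le_one_of_one_le_of_nonpos (by linarith) (by linarith)
    rw [hu]; exact mul_le_one₀ ht1 (by positivity) this
  rw [← hu] at h1
  have h4 : κ * u ≤ Real.exp (-u) - Real.exp (-(2 ^ α * u)) -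
      2 / M * (1 - Real.exp (-(M ^ α * u))) := by
    have h2 : (2:ℝ) ^ α ≤ 2 := by
      simpa using Real.rpow_le_rpow_of_exponent_le one_le_two hα1.le
    have h2' : (1:ℝ) < 2 ^ α := Real.one_lt_rpow one_lt_two hα
    have h5 : (2 ^ α - 1) * u * Real.exp (-2) ≤ Real.exp (-u) - Real.exp (-(2 ^ α * u)) := by
      have e : Real.exp (-u) = Real.exp (-(2 ^ α * u)) * Real.exp ((2 ^ α - 1) * u) := by
        rw [← Real.exp_add]; congr 1; ring
      have h6 := Real.add_one_le_exp ((2 ^ α - 1) * u)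
      have h7 : Real.exp (-2) ≤ Real.exp (-(2 ^ α * u)) := by
        rw [Real.exp_le_exp, neg_le_neg_iff]
        calc (2:ℝ) ^ α * u ≤ 2 * 1 := by gcongr
          _ = 2 := by ring
      have h8 : 0 ≤ (2 ^ α - 1) * u := mul_nonneg (by linarith) hu0.le
      calc (2 ^ α - 1) * u * Real.exp (-2) ≤ (2 ^ α - 1) * u * Real.exp (-(2 ^ α * u)) := by gcongr
        _ ≤ (Real.exp ((2 ^ α - 1) * u) - 1) * Real.exp (-(2 ^ α * u)) := by gcongr; linarith
        _ = _ := by rw [e]; ring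
    have h9 : 2 / M * (1 - Real.exp (-(M ^ α * u))) ≤ κ * u := by
      have h10 := Real.add_one_le_exp (-(M ^ α * u))
      calc 2 / M * (1 - Real.exp (-(M ^ α * u))) ≤ 2 / M * (M ^ α * u) := by gcongr; linarith
        _ = 2 * M ^ (-(1 - α)) * u := by
          rw [neg_sub, Real.rpow_sub hM0, Real.rpow_one]; ring
        _ ≤ _ := by gcongr
    have h11 : (2 ^ α - 1) * u * Real.exp (-2) = 2 * (κ * u) := by rw [hκe]; ring
    linarith
  calc c * κ * (t * (a * m ^ (-(3 + 2 * α))))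
      = a * (m ^ (-3:ℝ) * (c * (κ * u))) := by
        rw [hu, neg_add, Real.rpow_add hm0]; ring
    _ ≤ a * (m ^ (-3:ℝ) * (c * (Real.exp (-u) - Real.exp (-(2 ^ α * u)) -
      2 / M * (1 - Real.exp (-(M ^ α * u)))))) := by gcongr
    _ ≤ _ := by gcongr

end IsStable

/-- A space-time weight adapted to the kernel `k` in one space dimension: multiplication by the
weight is compatible with the smoothing of `k`, and the weight is dominated by later kernels. -/
structure IsKerWeight (α : ℝ) (k : ℝ → Rn 1 → ℝ≥0∞) (ω : ℝ → ℝ → Rn 1 → ℝ≥0∞) : Prop where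
  meas : ∀ t₀, Measurable (Function.uncurry (ω t₀))
  ne_zero : ∀ t₀ t x, ω t₀ t x ≠ 0
  le_one : ∀ t₀ t x, t < t₀ → ω t₀ t x ≤ 1
  smoothing : ∀ r : ℝ, 1 ≤ r → ∃ C > 0, ∀ t₀ s t : ℝ, s < t → t < t₀ → t - s ≤ 1 → ∀ y,
    lnorm volume r (fun x => ω t₀ t x * k (t - s) (x - y)) ≤
      ω t₀ s y * ENNReal.ofReal (C * (t - s) ^ (-(1 / (2 * α) + 1 / (2 * α) * (1 - 1 / r))))
  dominated : ∀ S t₀ t₁ X d : ℝ, S < t₀ → 4 * (t₀ - S) ≤ t₁ - S → t₁ - S ≤ 1 → 0 < d → 0 ≤ X →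
    ∃ c : ℝ≥0∞, c ≠ ⊤ ∧ ∀ s ∈ Ioo S t₀, ∀ x y : Rn 1, ‖x‖ ≤ X → d ≤ ‖x - y‖ →
      ω t₀ s y ≤ c * k (t₁ - s) (x - y)

lemma lnorm_comp_sub_right {n : ℕ} (r : ℝ) (F : Rn n → ℝ≥0∞) (y : Rn n) :
    lnorm volume r (fun x => F (x - y)) = lnorm volume r F := by
  unfold lnorm
  rw [lintegral_sub_right_eq_self (fun x => F x ^ r) y]

lemma sq_add_div_le {a b A B : ℝ} (hA : 0 < A) (hB : 0 < B) :
    (a + b) ^ 2 / (A + B) ≤ a ^ 2 / A + b ^ 2 / B := by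
  have : a ^ 2 / A + b ^ 2 / B - (a + b) ^ 2 / (A + B) = (a * B - b * A) ^ 2 / (A * B * (A + B)) := by
    field_simp; ring
  have h2 : 0 ≤ (a * B - b * A) ^ 2 / (A * B * (A + B)) := by positivity
  linarith

lemma isStable_dirac : IsStable 1 (Measure.dirac (1:ℝ)) where
  prob := inferInstance
  pos := by simp [ae_dirac_eq]
  laplace s hs := by simp

namespace IsStable
variable {α : ℝ} {η : Measure ℝ}

lemma absKer_eq_psi (h : IsStable 1 η) {t : ℝ} (ht : 0 < t) (z : Rn 1) :
    absKer (dMix 1 1 η) t z = ENNReal.ofReal (‖z‖ * psi t (‖z‖ ^ 2)) := by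
  have e : absKer (dMix 1 1 η) t z = absKer (dMix 1 1 (Measure.dirac 1)) t z := by
    unfold absKer
    refine Finset.sum_congr rfl fun j _ => ?_
    have e1 := h.dKer_eq one_pos 1 ht j z
    have e2 := isStable_dirac.dKer_eq one_pos 1 ht j z
    unfold dMix
    rw [← e1, ← e2]
  rw [e, isStable_dirac.absKer_one_eq ht]
  simp

lemma isKerWeight_one (h : IsStable 1 η) : IsKerWeight 1 (absKer (dMix 1 1 η))
    (fun t₀ t x => ENNReal.ofReal (min 1 (Real.exp (-(Real.pi ^ 2 * ‖x‖ ^ 2 / (2 * (t₀ - t))))))) where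
  meas t₀ := by unfold Function.uncurry; fun_prop
  ne_zero t₀ t x := by simp [Real.exp_pos]
  le_one t₀ t x _ := by simp
  smoothing r hr := by
    have := h.prob
    obtain ⟨C, hC, hK⟩ := h.lnorm_absKer_le one_pos 1 hr
    refine ⟨4 * C, by positivity, fun t₀ s t hst ht _ y => ?_⟩
    have hτ : 0 < t - s := by linarith
    have hkm : Measurable (absKer (dMix 1 1 η) (2 * (t - s))) :=
      (absKer_measurable fun j => dMix_measurable 1 1 η j).of_uncurry_left
    have hmin : ∀ (x : Rn 1) (t : ℝ), t < t₀ →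
        min 1 (Real.exp (-(Real.pi ^ 2 * ‖x‖ ^ 2 / (2 * (t₀ - t))))) =
        Real.exp (-(Real.pi ^ 2 * ‖x‖ ^ 2 / (2 * (t₀ - t)))) := fun x t ht => by
      have : 0 < t₀ - t := by linarith
      rw [min_eq_right]
      rw [Real.exp_le_one_iff, neg_nonpos]; positivity
    have key : ∀ x : Rn 1, ENNReal.ofReal (min 1 (Real.exp (-(Real.pi ^ 2 * ‖x‖ ^ 2 / (2 * (t₀ - t)))))) *
        absKer (dMix 1 1 η) (t - s) (x - y) ≤
        ENNReal.ofReal (min 1 (Real.exp (-(Real.pi ^ 2 * ‖y‖ ^ 2 / (2 * (t₀ - s)))))) *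
          ENNReal.ofReal 4 * absKer (dMix 1 1 η) (2 * (t - s)) (x - y) := by
      intro x
      rw [h.absKer_eq_psi hτ, h.absKer_eq_psi (by positivity), hmin x t ht, hmin y s (by linarith),
        ← ENNReal.ofReal_mul (by positivity), ← ENNReal.ofReal_mul (by positivity),
        ← ENNReal.ofReal_mul (by positivity)]
      refine ENNReal.ofReal_le_ofReal ?_
      obtain ⟨z, hz⟩ : ∃ z, z = ‖x - y‖ := ⟨_, rfl⟩
      obtain ⟨τ, hτe⟩ : ∃ τ, τ = t - s := ⟨_, rfl⟩
      have hz0 : 0 ≤ z := by rw [hz]; positivity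
      have hy : ‖y‖ ≤ ‖x‖ + z := by
        rw [hz, norm_sub_rev]
        calc ‖y‖ = ‖x + (y - x)‖ := by congr 1; abel
          _ ≤ _ := norm_add_le _ _
      rw [← hz, ← hτe]
      rw [← hτe] at hτ
      have hA : 0 < t₀ - t := by linarith
      have e : t₀ - s = (t₀ - t) + τ := by rw [hτe]; ring
      have h1 : ‖y‖ ^ 2 / (t₀ - s) ≤ ‖x‖ ^ 2 / (t₀ - t) + z ^ 2 / τ := by
        rw [e]
        refine le_trans ?_ (sq_add_div_le hA hτ)
        gcongr
      have h2 : Real.exp (-(Real.pi ^ 2 * ‖x‖ ^ 2 / (2 * (t₀ - t)))) *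
          Real.exp (-(Real.pi ^ 2 * z ^ 2 / τ)) ≤ Real.exp (-(Real.pi ^ 2 * ‖y‖ ^ 2 / (2 * (t₀ - s)))) *
          Real.exp (-(Real.pi ^ 2 * z ^ 2 / (2 * τ))) := by
        rw [← Real.exp_add, ← Real.exp_add, Real.exp_le_exp]
        have h3 := mul_le_mul_of_nonneg_left h1 (by positivity : (0:ℝ) ≤ Real.pi ^ 2 / 2)
        have e1 : Real.pi ^ 2 * ‖x‖ ^ 2 / (2 * (t₀ - t)) = Real.pi ^ 2 / 2 * (‖x‖ ^ 2 / (t₀ - t)) := by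
          field_simp
        have e2 : Real.pi ^ 2 * ‖y‖ ^ 2 / (2 * (t₀ - s)) = Real.pi ^ 2 / 2 * (‖y‖ ^ 2 / (t₀ - s)) := by
          have : t₀ - s ≠ 0 := by linarith
          field_simp
        have e3 : Real.pi ^ 2 * z ^ 2 / (2 * τ) = Real.pi ^ 2 / 2 * (z ^ 2 / τ) := by field_simp
        have e4 : Real.pi ^ 2 * z ^ 2 / τ = 2 * (Real.pi ^ 2 / 2 * (z ^ 2 / τ)) := by field_simp
        rw [e1, e2, e3, e4]
        linarith
      have h5 : 2 * Real.pi ^ 2 / τ * √(Real.pi / τ) ≤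
          4 * (2 * Real.pi ^ 2 / (2 * τ) * √(Real.pi / (2 * τ))) := by
        have e5 : √(Real.pi / τ) ≤ 2 * √(Real.pi / (2 * τ)) := by
          rw [Real.sqrt_le_iff]
          refine ⟨by positivity, ?_⟩
          rw [mul_pow, Real.sq_sqrt (by positivity)]
          have : 0 < Real.pi / τ := by positivity
          have e6 : 2 ^ 2 * (Real.pi / (2 * τ)) = 2 * (Real.pi / τ) := by field_simp
          linarith
        calc _ ≤ 2 * Real.pi ^ 2 / τ * (2 * √(Real.pi / (2 * τ))) := by gcongr
          _ = _ := by field_simp; ring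
      unfold psi
      calc _ = z * ((2 * Real.pi ^ 2 / τ * √(Real.pi / τ)) *
            (Real.exp (-(Real.pi ^ 2 * ‖x‖ ^ 2 / (2 * (t₀ - t)))) *
              Real.exp (-(Real.pi ^ 2 * z ^ 2 / τ)))) := by ring
        _ ≤ z * ((4 * (2 * Real.pi ^ 2 / (2 * τ) * √(Real.pi / (2 * τ)))) *
            (Real.exp (-(Real.pi ^ 2 * ‖y‖ ^ 2 / (2 * (t₀ - s)))) *
          Real.exp (-(Real.pi ^ 2 * z ^ 2 / (2 * τ))))) := by gcongr
        _ = _ := by ring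
    refine (lnorm_mono (by linarith) (Eventually.of_forall key)).trans ?_
    have hm : Measurable (fun x => absKer (dMix 1 1 η) (2 * (t - s)) (x - y)) :=
      hkm.comp (measurable_id.sub_const y)
    rw [lnorm_const_mul (by linarith) _ hm.aemeasurable, lnorm_comp_sub_right, mul_assoc]
    refine mul_le_mul_right ?_ _
    refine (mul_le_mul_right (hK _ (by positivity)) _).trans ?_
    rw [← ENNReal.ofReal_mul (by norm_num), ← mul_assoc]
    refine ENNReal.ofReal_le_ofReal (mul_le_mul_of_nonneg_left ?_ (by positivity))
    rw [Nat.cast_one]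
    have h1r : 1 / r ≤ 1 := by rw [div_le_one (by linarith)]; exact hr
    refine Real.rpow_le_rpow_of_nonpos hτ (by linarith) ?_
    have : 0 ≤ 1 / (2 * (1:ℝ)) + 1 / (2 * 1) * (1 - 1 / r) :=
      add_nonneg (by norm_num) (mul_nonneg (by norm_num) (by linarith))
    linarith
  dominated S t₀ t₁ X d hS h4 h1 hd hX := by
    have hθ : 0 < t₁ - t₀ := by linarith
    obtain ⟨c, hc⟩ : ∃ c, c = (d * Real.exp (-(2 * Real.pi ^ 2 * X ^ 2 / (t₁ - t₀))))⁻¹ := ⟨_, rfl⟩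
    have hc0 : 0 < c := by rw [hc]; positivity
    refine ⟨ENNReal.ofReal c, ENNReal.ofReal_ne_top, fun s hs x y hx hxy => ?_⟩
    have hτ : 0 < t₁ - s := by linarith [hs.2]
    rw [h.absKer_eq_psi hτ, ← ENNReal.ofReal_mul hc0.le]
    refine ENNReal.ofReal_le_ofReal ((min_le_right _ _).trans ?_)
    rw [hc, ← div_eq_inv_mul, le_div_iff₀ (by positivity)]
    obtain ⟨z, hz⟩ : ∃ z, z = ‖x - y‖ := ⟨_, rfl⟩
    obtain ⟨τ, hτe⟩ : ∃ τ, τ = t₁ - s := ⟨_, rfl⟩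
    rw [← hz] at hxy ⊢
    have hz0 : 0 ≤ z := by linarith
    have hz1 : z ≤ X + ‖y‖ := by rw [hz]; exact (norm_sub_le _ _).trans (by linarith)
    rw [← hτe] at hτ ⊢
    have hs1 := hs.1
    have hs2 := hs.2
    have hτ1 : τ ≤ 1 := by linarith
    have hτθ : t₁ - t₀ ≤ τ := by linarith
    have hτ4 : 4 * (t₀ - s) ≤ τ := by linarith
    have ht0s : 0 < t₀ - s := by linarith
    have hz2 : z ^ 2 ≤ 2 * X ^ 2 + 2 * ‖y‖ ^ 2 := by
      have : z ^ 2 ≤ (X + ‖y‖) ^ 2 := by gcongr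
      nlinarith [sq_nonneg (X - ‖y‖)]
    have h2 : Real.exp (-(Real.pi ^ 2 * ‖y‖ ^ 2 / (2 * (t₀ - s)))) *
        Real.exp (-(2 * Real.pi ^ 2 * X ^ 2 / (t₁ - t₀))) ≤ Real.exp (-(Real.pi ^ 2 * z ^ 2 / τ)) := by
      rw [← Real.exp_add, Real.exp_le_exp]
      have h5 : Real.pi ^ 2 * z ^ 2 / τ ≤ Real.pi ^ 2 * (2 * X ^ 2 + 2 * ‖y‖ ^ 2) / τ := by gcongr
      have e5 : Real.pi ^ 2 * (2 * X ^ 2 + 2 * ‖y‖ ^ 2) / τ =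
        2 * Real.pi ^ 2 * X ^ 2 / τ + Real.pi ^ 2 * ‖y‖ ^ 2 / (τ / 2) := by field_simp
      have h6 : 2 * Real.pi ^ 2 * X ^ 2 / τ ≤ 2 * Real.pi ^ 2 * X ^ 2 / (t₁ - t₀) := by gcongr
      have h7 : Real.pi ^ 2 * ‖y‖ ^ 2 / (τ / 2) ≤ Real.pi ^ 2 * ‖y‖ ^ 2 / (2 * (t₀ - s)) := by
        gcongr; linarith
      linarith
    have h8 : 1 ≤ 2 * Real.pi ^ 2 / τ * √(Real.pi / τ) := by
      have hp := Real.pi_gt_three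
      have h9 : 1 ≤ √(Real.pi / τ) := by
        rw [Real.one_le_sqrt, le_div_iff₀ hτ]; linarith
      have h10 : 1 ≤ 2 * Real.pi ^ 2 / τ := by rw [le_div_iff₀ hτ]; nlinarith
      calc (1:ℝ) = 1 * 1 := by ring
        _ ≤ _ := by gcongr
    unfold psi
    calc _ = d * (1 * (Real.exp (-(Real.pi ^ 2 * ‖y‖ ^ 2 / (2 * (t₀ - s)))) *
          Real.exp (-(2 * Real.pi ^ 2 * X ^ 2 / (t₁ - t₀))))) := by ring
      _ ≤ z * ((2 * Real.pi ^ 2 / τ * √(Real.pi / τ)) * Real.exp (-(Real.pi ^ 2 * z ^ 2 / τ))) := by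
        gcongr
      _ = _ := by ring

end IsStable

/-- The polynomial weight `(1+|x|)^{-(2+2α)}`. -/
def polyWeight (α : ℝ) (x : Rn 1) : ℝ := (1 + ‖x‖) ^ (-(2 + 2 * α))

lemma polyWeight_pos (α : ℝ) (x : Rn 1) : 0 < polyWeight α x := by
  unfold polyWeight; positivity

lemma polyWeight_le_one {α : ℝ} (hα : 0 < α) (x : Rn 1) : polyWeight α x ≤ 1 :=
  Real.rpow_le_one_of_one_le_of_nonpos (by linarith [norm_nonneg x]) (by linarith)

lemma polyWeight_le {α a : ℝ} (hα : 0 < α) {y : Rn 1} (h : (1 + ‖y‖) / 2 ≤ a) :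
    a ^ (-(2 + 2 * α)) ≤ 2 ^ (2 + 2 * α) * polyWeight α y := by
  have hy : 0 < 1 + ‖y‖ := by positivity
  refine (Real.rpow_le_rpow_of_nonpos (by positivity) h (by linarith)).trans (le_of_eq ?_)
  rw [Real.div_rpow hy.le (by norm_num), Real.rpow_neg (x := 2) (by norm_num), div_inv_eq_mul,
    mul_comm]
  rfl

lemma lnorm_polyWeight_ne_top {α r : ℝ} (hα : 0 < α) (hr : 1 ≤ r) :
    lnorm volume r (fun x => ENNReal.ofReal (polyWeight α x)) ≠ ⊤ := by
  refine ENNReal.rpow_ne_top_of_nonneg (by positivity) ?_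
  have h1 : Integrable (fun x : Rn 1 => polyWeight α x) :=
    integrable_one_add_norm (by simp; linarith)
  refine ne_top_of_le_ne_top (b := ∫⁻ x : Rn 1, ENNReal.ofReal (polyWeight α x)) ?_
    (lintegral_mono fun x => ?_)
  · exact (hasFiniteIntegral_iff_ofReal (Eventually.of_forall fun x => (polyWeight_pos α x).le)).1
      h1.hasFiniteIntegral |>.ne
  · have : ENNReal.ofReal (polyWeight α x) ≤ 1 := by
      rw [ENNReal.ofReal_le_one]; exact polyWeight_le_one hα x
    calc _ ≤ ENNReal.ofReal (polyWeight α x) ^ (1:ℝ) :=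
          ENNReal.rpow_le_rpow_of_exponent_ge this hr
      _ = _ := ENNReal.rpow_one _

namespace IsStable
variable {α : ℝ} {η : Measure ℝ}

lemma exists_polyWeight_mul_le (h : IsStable α η) (hα : 0 < α) : ∃ A > 0, ∀ t > 0, t ≤ 1 →
    ∀ x y : Rn 1, ENNReal.ofReal (polyWeight α x) * absKer (dMix 1 α η) t (x - y) ≤
      ENNReal.ofReal (polyWeight α y) * ENNReal.ofReal A *
        (absKer (dMix 1 α η) t (x - y) + ENNReal.ofReal (polyWeight α x)) := by
  obtain ⟨C, hC, hk⟩ := h.absKer_one_le hα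
  refine ⟨2 ^ (2 + 2 * α) * (1 + C), by positivity, fun t ht ht1 x y => ?_⟩
  have hy := polyWeight_pos α y
  rw [← ENNReal.ofReal_mul hy.le]
  rcases le_or_gt ((1 + ‖y‖) / 2) (1 + ‖x‖) with hxy | hxy
  · refine mul_le_mul' (ENNReal.ofReal_le_ofReal ?_) le_self_add
    refine (polyWeight_le hα hxy).trans ?_
    have : 0 ≤ 2 ^ (2 + 2 * α) * C * polyWeight α y := by positivity
    linarith
  · rw [mul_comm]
    have h1 : (1 + ‖y‖) / 2 ≤ ‖x - y‖ := by
      have h2 := norm_sub_norm_le y x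
      rw [norm_sub_rev] at h2
      linarith
    have h0 : x - y ≠ 0 := by
      rw [← norm_pos_iff]
      linarith [norm_nonneg y]
    refine mul_le_mul' ((hk t ht _ h0).trans (ENNReal.ofReal_le_ofReal ?_)) le_add_self
    have h3 := polyWeight_le hα h1
    calc C * (t * ‖x - y‖ ^ (-(2 + 2 * α))) ≤ C * (1 * (2 ^ (2 + 2 * α) * polyWeight α y)) := by
          gcongr
      _ ≤ polyWeight α y * (2 ^ (2 + 2 * α) * (1 + C)) := by
          have : 0 ≤ 2 ^ (2 + 2 * α) * polyWeight α y := by positivity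
          linarith

lemma isKerWeight_of_lt_one (h : IsStable α η) (hα : 0 < α) (hα1 : α < 1) :
    IsKerWeight α (absKer (dMix 1 α η)) (fun _ _ x => ENNReal.ofReal (polyWeight α x)) where
  meas t₀ := by unfold Function.uncurry polyWeight; fun_prop
  ne_zero t₀ t x := by simp [polyWeight_pos]
  le_one t₀ t x _ := by simpa using polyWeight_le_one hα x
  smoothing r hr := by
    have := h.prob
    obtain ⟨C, hC, hK⟩ := h.lnorm_absKer_le hα 1 hr
    obtain ⟨A, hA, hk⟩ := h.exists_polyWeight_mul_le hα
    have hW := lnorm_polyWeight_ne_top hα hr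
    obtain ⟨W, hWe⟩ : ∃ W, W = (lnorm volume r
      (fun x => ENNReal.ofReal (polyWeight α x))).toReal := ⟨_, rfl⟩
    have hW0 : 0 ≤ W := by rw [hWe]; positivity
    refine ⟨A * (C + W), by positivity, fun t₀ s t hst ht hts y => ?_⟩
    have hτ : 0 < t - s := by linarith
    refine (lnorm_mono (by linarith) (Eventually.of_forall fun x => hk _ hτ hts x y)).trans ?_
    have hkm : Measurable (absKer (dMix 1 α η) (t - s)) :=
      (absKer_measurable fun j => dMix_measurable 1 α η j).of_uncurry_left
    have hm1 : Measurable (fun x => absKer (dMix 1 α η) (t - s) (x - y)) :=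
      hkm.comp (measurable_id.sub_const y)
    have hm2 : Measurable (fun x => ENNReal.ofReal (polyWeight α x)) := by
      unfold polyWeight; fun_prop
    have hm3 : Measurable (fun x => absKer (dMix 1 α η) (t - s) (x - y) +
      ENNReal.ofReal (polyWeight α x)) := hm1.add hm2
    rw [lnorm_const_mul (by linarith) _ hm3.aemeasurable, mul_assoc]
    refine mul_le_mul_right ?_ _
    have h2 := lnorm_add_le hr (μ := (volume : Measure (Rn 1))) hm1.aemeasurable hm2.aemeasurable
    rw [lnorm_comp_sub_right] at h2
    have h3 := hK _ hτ
    rw [Nat.cast_one] at h3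
    obtain ⟨β, hβ⟩ : ∃ β, β = 1 / (2 * α) + 1 / (2 * α) * (1 - 1 / r) := ⟨_, rfl⟩
    rw [← hβ] at h3 ⊢
    have h1r : 1 / r ≤ 1 := by rw [div_le_one (by linarith)]; exact hr
    have hβ0 : 0 ≤ β := by
      rw [hβ]; exact add_nonneg (by positivity) (mul_nonneg (by positivity) (by linarith))
    have h4 : lnorm volume r (fun x => ENNReal.ofReal (polyWeight α x)) ≤
        ENNReal.ofReal (W * (t - s) ^ (-β)) := by
      rw [← ENNReal.ofReal_toReal hW, ← hWe]
      exact ENNReal.ofReal_le_ofReal (le_mul_of_one_le_right hW0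
        (Real.one_le_rpow_of_pos_of_le_one_of_nonpos hτ hts (by linarith)))
    refine (mul_le_mul_right (h2.trans (add_le_add h3 h4)) _).trans (le_of_eq ?_)
    rw [← ENNReal.ofReal_add (by positivity) (by positivity), ← ENNReal.ofReal_mul hA.le]
    congr 1; ring
  dominated S t₀ t₁ X d hS h4 h1 hd hX := by
    obtain ⟨c, hc, hk⟩ := h.le_absKer_one hα hα1
    have hθ : 0 < t₁ - t₀ := by linarith
    obtain ⟨e, he⟩ : ∃ e, e = c * ((t₁ - t₀) * ((d / (1 + d)) * (1 + X) ^ (-(2 + 2 * α)))) := ⟨_, rfl⟩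
    have he0 : 0 < e := by rw [he]; positivity
    refine ⟨ENNReal.ofReal e⁻¹, ENNReal.ofReal_ne_top, fun s hs x y hx hxy => ?_⟩
    have hs1 := hs.1
    have hs2 := hs.2
    refine le_trans ?_ (mul_le_mul_right (hk (t₁ - s) (by linarith) (by linarith) (x - y)) _)
    rw [← ENNReal.ofReal_mul (by positivity)]
    refine ENNReal.ofReal_le_ofReal ?_
    rw [← div_eq_inv_mul, le_div_iff₀ he0, he]
    have hz1 : ‖x - y‖ ≤ X + ‖y‖ := (norm_sub_le _ _).trans (by linarith)
    generalize ‖x - y‖ = z at hxy hz1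
    have hz0 : 0 < z := by linarith
    have h5 : (1 + X) ^ (-(2 + 2 * α)) * polyWeight α y ≤ (1 + z) ^ (-(2 + 2 * α)) := by
      unfold polyWeight
      rw [← Real.mul_rpow (by positivity) (by positivity)]
      refine Real.rpow_le_rpow_of_nonpos (by positivity) ?_ (by linarith)
      have := mul_nonneg hX (norm_nonneg y)
      linarith
    have h6 : d / (1 + d) ≤ z / (1 + z) := by
      rw [div_le_div_iff₀ (by positivity) (by positivity)]; linarith
    have h7 : z * (1 + z) ^ (-(3 + 2 * α)) = z / (1 + z) * (1 + z) ^ (-(2 + 2 * α)) := by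
      have : -(3 + 2 * α) = -1 + -(2 + 2 * α) := by ring
      rw [this, Real.rpow_add (by positivity), Real.rpow_neg_one]; ring
    rw [h7]
    calc _ = c * ((t₁ - t₀) * (d / (1 + d) * ((1 + X) ^ (-(2 + 2 * α)) * polyWeight α y))) := by ring
      _ ≤ _ := by
        have := (polyWeight_pos α y).le
        have ht : 0 ≤ t₁ - s := by linarith
        gcongr

lemma exists_isKerWeight (h : IsStable α η) (hα : 0 < α) (hα1 : α ≤ 1) :
    ∃ ω, IsKerWeight α (absKer (dMix 1 α η)) ω := by
  rcases hα1.lt_or_eq with h1 | rfl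
  · exact ⟨_, h.isKerWeight_of_lt_one hα h1⟩
  · exact ⟨_, h.isKerWeight_one⟩

end IsStable

/-- The mass of `H t` with respect to the weight `ω t`. -/
def wMass {n : ℕ} (ω H : ℝ → Rn n → ℝ≥0∞) (t : ℝ) : ℝ≥0∞ := ∫⁻ x, ω t x * H t x

lemma wMass_measurable {n : ℕ} {ω H : ℝ → Rn n → ℝ≥0∞} (hω : Measurable (Function.uncurry ω))
    (hH : Measurable (Function.uncurry H)) : Measurable (wMass ω H) :=
  Measurable.lintegral_prod_right' (f := fun z : ℝ × Rn n => ω z.1 z.2 * H z.1 z.2) (hω.mul hH)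

section
variable {α : ℝ} {k : ℝ → Rn 1 → ℝ≥0∞} {ω : ℝ → ℝ → Rn 1 → ℝ≥0∞}

lemma IsKerWeight.lnorm_mul_duh_le (hω : IsKerWeight α k ω) (hk : Measurable (Function.uncurry k))
    {r : ℝ} (hr : 1 ≤ r) : ∃ C > 0, ∀ (t₀ t : ℝ) (H : ℝ → Rn 1 → ℝ≥0∞),
      Measurable (Function.uncurry H) → t < t₀ → t ≤ 1 →
      lnorm volume r (fun x => ω t₀ t x * duh k H t x) ≤
        volt C (1 / (2 * α) + 1 / (2 * α) * (1 - 1 / r)) (wMass (ω t₀) H) t := by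
  obtain ⟨C, hC, hs⟩ := hω.smoothing r hr
  refine ⟨C, hC, fun t₀ t H hH ht ht1 => ?_⟩
  have hr0 : 0 < r := by linarith
  have hωm := hω.meas t₀
  have hωt : Measurable (ω t₀ t) := hωm.of_uncurry_left
  have hF : Measurable (fun z : (ℝ × Rn 1) × Rn 1 =>
      H z.1.1 z.1.2 * (ω t₀ t z.2 * k (t - z.1.1) (z.2 - z.1.2))) := by
    exact (hH.comp measurable_fst).mul ((hωt.comp measurable_snd).mul (hk.comp
      (by fun_prop : Measurable fun z : (ℝ × Rn 1) × Rn 1 => (t - z.1.1, z.2 - z.1.2))))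
  have e1 : ∀ x, ω t₀ t x * duh k H t x =
      ∫⁻ z, H z.1 z.2 * (ω t₀ t x * k (t - z.1) (x - z.2)) ∂((volume.restrict (Ioo 0 t)).prod volume) := by
    intro x
    have hFx : Measurable (fun z : ℝ × Rn 1 => H z.1 z.2 * (ω t₀ t x * k (t - z.1) (x - z.2))) :=
      hF.comp (by fun_prop : Measurable fun z : ℝ × Rn 1 => (z, x))
    have hne : ω t₀ t x ≠ ⊤ := ne_top_of_le_ne_top ENNReal.one_ne_top (hω.le_one t₀ t x ht)
    rw [lintegral_prod _ hFx.aemeasurable, duh, ← lintegral_const_mul' _ _ hne]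
    refine lintegral_congr fun s => ?_
    rw [← lintegral_const_mul' _ _ hne]
    refine lintegral_congr fun y => ?_
    ring
  simp_rw [e1]
  refine (minkowski_integral hr (F := fun (z : ℝ × Rn 1) x => H z.1 z.2 * (ω t₀ t x * k (t - z.1) (x - z.2))) hF).trans ?_
  rw [lintegral_prod _ (lnorm_measurable r (F := fun (z : ℝ × Rn 1) x =>
    H z.1 z.2 * (ω t₀ t x * k (t - z.1) (x - z.2))) hF).aemeasurable, volt]
  refine setLIntegral_mono_ae' measurableSet_Ioo (Eventually.of_forall fun s hs' => ?_)
  unfold wMass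
  rw [← lintegral_const_mul' _ _ ENNReal.ofReal_ne_top]
  refine lintegral_mono fun y => ?_
  beta_reduce
  have hm : Measurable (fun x => ω t₀ t x * k (t - s) (x - y)) :=
    hωt.mul (hk.comp (by fun_prop : Measurable fun x : Rn 1 => (t - s, x - y)))
  rw [lnorm_const_mul hr0 _ hm.aemeasurable]
  refine (mul_le_mul_right (hs t₀ s t hs'.2 ht (by linarith [hs'.1]) y) _).trans (le_of_eq ?_)
  ring

lemma IsKerWeight.lintegral_wMass_ne_top (hω : IsKerWeight α k ω) (hk : Measurable (Function.uncurry k))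
    {S t₀ t₁ : ℝ} {H : ℝ → Rn 1 → ℝ≥0∞} (hH : Measurable (Function.uncurry H)) (hS : S < t₀)
    (h4 : 4 * (t₀ - S) ≤ t₁ - S) (h1 : t₁ - S ≤ 1)
    (h0 : ∀ᵐ t ∂(volume.restrict (Ioo 0 S)), ∀ᵐ x, H t x = 0) {x₁ x₂ : Rn 1} (hx : x₁ ≠ x₂)
    (hx₁ : duh k H t₁ x₁ ≠ ⊤) (hx₂ : duh k H t₁ x₂ ≠ ⊤) :
    ∫⁻ t in Ioo 0 t₀, wMass (ω t₀) H t ≠ ⊤ := by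
  have hd : 0 < ‖x₁ - x₂‖ / 2 := by
    have := norm_pos_iff.2 (sub_ne_zero.2 hx)
    positivity
  obtain ⟨c, hc, hdom⟩ := hω.dominated S t₀ t₁ (max ‖x₁‖ ‖x₂‖) _ hS h4 h1 hd
    (le_max_of_le_left (norm_nonneg _))
  have hkm : ∀ x, Measurable (Function.uncurry fun t y => k (t₁ - t) (x - y) * H t y) := fun x =>
    (hk.comp (by fun_prop : Measurable fun z : ℝ × Rn 1 => (t₁ - z.1, x - z.2))).mul hH
  have key : ∀ᵐ t ∂(volume.restrict (Ioo 0 t₀)), wMass (ω t₀) H t ≤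
      c * ((∫⁻ y, k (t₁ - t) (x₁ - y) * H t y) + ∫⁻ y, k (t₁ - t) (x₂ - y) * H t y) := by
    rw [ae_restrict_iff' measurableSet_Ioo] at h0 ⊢
    have hSne : ∀ᵐ t : ℝ, t ≠ S := by simp [ae_iff, measure_singleton]
    filter_upwards [h0, hSne] with t ht htS htm
    rcases lt_or_gt_of_ne htS with hlt | hgt
    · have : wMass (ω t₀) H t = 0 := by
        unfold wMass
        rw [lintegral_congr_ae (g := fun _ => 0)]
        · simp
        · filter_upwards [ht ⟨htm.1, hlt⟩] with x hx
          simp [hx]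
      rw [this]; exact bot_le
    · unfold wMass
      rw [← lintegral_add_left (hkm x₁).of_uncurry_left, ← lintegral_const_mul' _ _ hc]
      refine lintegral_mono fun y => ?_
      rw [← add_mul, ← mul_assoc]
      refine mul_le_mul_left ?_ _
      have h3 : ‖x₁ - x₂‖ ≤ ‖x₁ - y‖ + ‖x₂ - y‖ := by
        rw [norm_sub_rev x₂ y]; exact norm_sub_le_norm_sub_add_norm_sub _ _ _
      rcases le_total (‖x₁ - x₂‖ / 2) ‖x₁ - y‖ with h5 | h5
      · exact (hdom t ⟨hgt, htm.2⟩ x₁ y (le_max_left _ _) h5).trans (mul_le_mul_right le_self_add _)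
      · exact (hdom t ⟨hgt, htm.2⟩ x₂ y (le_max_right _ _) (by linarith)).trans
          (mul_le_mul_right le_add_self _)
  refine ne_top_of_le_ne_top ?_ ((lintegral_mono_ae key).trans
    (lintegral_mono_set (Ioo_subset_Ioo_right (show t₀ ≤ t₁ by linarith))))
  rw [lintegral_const_mul' _ _ hc, lintegral_add_left
    (Measurable.lintegral_prod_right' (f := fun z : ℝ × Rn 1 => k (t₁ - z.1) (x₁ - z.2) * H z.1 z.2) (hkm x₁))]
  exact ENNReal.mul_ne_top hc (ENNReal.add_ne_top.2 ⟨hx₁, hx₂⟩)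

end

lemma lintegral_interp_le {X : Type*} [MeasurableSpace X] {μ : Measure X} {b l q r : ℝ} (hb : 0 < b)
    (hl : 0 ≤ l) (hl1 : l < 1) (hq : 0 < q) (hr : 0 < r) (he : (b + l) / q + (1 - l) / r = 1)
    {W U w : X → ℝ≥0∞} (hW : Measurable W) (hU : Measurable U) (hw : Measurable w)
    (hW1 : ∀ x, W x ≤ 1) (hwU : ∀ x, w x ≤ 2 * U x) :
    ∫⁻ x, W x * (U x ^ b * w x) ∂μ ≤
      2 * (lnorm μ q U ^ (b + l) * lnorm μ r (fun x => W x * w x) ^ (1 - l)) := by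
  have h1l : 0 < 1 - l := by linarith
  have hpt : ∀ x, W x * (U x ^ b * w x) ≤ 2 * (U x ^ (b + l) * (W x * w x) ^ (1 - l)) := by
    intro x
    have e1 : W x ≤ W x ^ (1 - l) := by
      conv_lhs => rw [← ENNReal.rpow_one (W x)]
      exact ENNReal.rpow_le_rpow_of_exponent_ge (hW1 x) (by linarith)
    have e2 : w x = w x ^ l * w x ^ (1 - l) := by
      rw [← ENNReal.rpow_add_of_nonneg _ _ hl h1l.le]; simp
    have e3 : w x ^ l ≤ 2 * U x ^ l := by
      refine (ENNReal.rpow_le_rpow (hwU x) hl).trans ?_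
      rw [ENNReal.mul_rpow_of_nonneg _ _ hl]
      refine mul_le_mul_left ?_ _
      conv_rhs => rw [← ENNReal.rpow_one 2]
      exact ENNReal.rpow_le_rpow_of_exponent_le (by norm_num) hl1.le
    calc W x * (U x ^ b * w x) ≤ W x ^ (1 - l) * (U x ^ b * (2 * U x ^ l * w x ^ (1 - l))) := by
          conv_lhs => rw [e2]
          exact mul_le_mul' e1 (mul_le_mul_right (mul_le_mul_left e3 _) _)
      _ = _ := by
          rw [ENNReal.rpow_add_of_nonneg _ _ hb.le hl, ENNReal.mul_rpow_of_nonneg _ _ h1l.le]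
          ring
  refine (lintegral_mono hpt).trans ?_
  rw [lintegral_const_mul' _ _ (by norm_num), ← lnorm_one]
  have hp : 0 < q / (b + l) := by positivity
  have hr' : 0 < r / (1 - l) := by positivity
  refine mul_le_mul_right ((lnorm_mul_le one_pos hp hr' ?_ (hU.pow_const _).aemeasurable
    ((hW.mul hw).pow_const _).aemeasurable).trans (le_of_eq ?_)) _
  · rw [one_div_div, one_div_div, he]; norm_num
  · rw [lnorm_pow hp (by linarith), lnorm_pow hr' h1l, mul_div_cancel₀ _ (by linarith : b + l ≠ 0),
      mul_div_cancel₀ _ h1l.ne']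
    rfl

/-- Exponents for the gain of integrability below the local integrability threshold. -/
lemma exists_gain_exponents {α b q δ : ℝ} (hα : 1 / 2 < α) (hα1 : α ≤ 1) (hb : 1 ≤ b) (hbq : b < q)
    (hqb : q ≤ b + 1) (hδ : δ = 1 - 1 / (2 * α) - 1 / (2 * α) * (b / q)) (hδ0 : 0 < δ) :
    ∃ r μ m : ℝ, 1 ≤ r ∧ 1 ≤ μ ∧ 1 < m ∧ m * δ < 1 ∧ (b + δ) / q + (1 - δ) / r = 1 ∧
      (1 / (2 * α) + 1 / (2 * α) * (1 - 1 / r)) * μ < 1 ∧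
      1 / m = (b + δ) * δ / b + (1 - δ) / μ := by
  have hq1 : 1 < q := by linarith
  obtain ⟨a, ha⟩ : ∃ a, a = 1 / (2 * α) := ⟨_, rfl⟩
  have ha1 : 1 / 2 ≤ a := by rw [ha]; exact one_div_le_one_div_of_le (by linarith) (by linarith)
  obtain ⟨x, hx⟩ : ∃ x, x = 1 / q := ⟨_, rfl⟩
  have hxq : x * q = 1 := by rw [hx]; field_simp
  have hx0 : 0 < x := by rw [hx]; positivity
  have hx1 : x < 1 := by rw [hx, div_lt_one (by linarith)]; exact hq1
  have hbx : b / q = b * x := by rw [hx]; ring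
  have hbx1 : b * x < 1 := by rw [← hbx, div_lt_one (by linarith)]; exact hbq
  have hbx0 : 0 < b * x := by positivity
  rw [hbx, ← ha] at hδ
  have hδh : δ ≤ (1 - b * x) / 2 := by
    have := mul_le_mul_of_nonneg_right ha1 (show 0 ≤ 1 + b * x by linarith)
    linarith
  have hδ2 : δ < 1 / 2 := by linarith
  have hδ1 : 1 - δ ≠ 0 := by linarith
  have hbxd : (b + δ) * x < 1 := by
    have : δ * x ≤ δ * 1 := mul_le_mul_of_nonneg_left hx1.le hδ0.le
    linarith
  obtain ⟨y, hy⟩ : ∃ y, y = (1 - (b + δ) * x) / (1 - δ) := ⟨_, rfl⟩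
  have hyd : y * (1 - δ) = 1 - (b + δ) * x := by rw [hy, div_mul_cancel₀ _ hδ1]
  have hy0 : 0 < y := by rw [hy]; exact div_pos (by linarith) (by linarith)
  have hy1 : y ≤ 1 := by
    rw [hy, div_le_one (by linarith)]
    have h1 : δ * (1 - x) ≤ 1 * (1 - x) := mul_le_mul_of_nonneg_right (by linarith) (by linarith)
    have h2 : q * x ≤ (b + 1) * x := mul_le_mul_of_nonneg_right hqb hx0.le
    linarith
  obtain ⟨E, hE⟩ : ∃ E, E = 1 - δ * ((2 - x) * a - δ / b) := ⟨_, rfl⟩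
  have hdb0 : 0 < δ / b := by positivity
  have hdb : δ / b ≤ δ := div_le_self hδ0.le hb
  have hE1 : E < 1 := by
    have h1 : (2 - x) * (1 / 2) ≤ (2 - x) * a := mul_le_mul_of_nonneg_left ha1 (by linarith)
    have h2 : 0 < δ * ((2 - x) * a - δ / b) := mul_pos hδ0 (by linarith)
    linarith
  have hEd : E = δ + δ * (δ / b) + (1 - δ) * (a + a * (1 - y)) := by
    have : (1 - δ) * (a + a * (1 - y)) = a * (2 * (1 - δ) - y * (1 - δ)) := by ring
    rw [this, hyd, hE]
    linear_combination -hδ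
  have hEδ : δ < E := by
    have h1 : 0 ≤ (1 - δ) * (a + a * (1 - y)) :=
      mul_nonneg (by linarith) (add_nonneg (by linarith) (mul_nonneg (by linarith) (by linarith)))
    have : 0 < δ * (δ / b) := by positivity
    linarith
  obtain ⟨e, he⟩ : ∃ e, e = (1 + E) / 2 := ⟨_, rfl⟩
  have he0 : 0 < e := by linarith
  obtain ⟨ν, hν⟩ : ∃ ν, ν = (e - δ - δ * (δ / b)) / (1 - δ) := ⟨_, rfl⟩
  have hνd : ν * (1 - δ) = e - δ - δ * (δ / b) := by rw [hν, div_mul_cancel₀ _ hδ1]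
  have hνβ : a + a * (1 - y) < ν := by
    rw [hν, lt_div_iff₀ (by linarith)]; linarith
  have hβ0 : 0 < a + a * (1 - y) := add_pos_of_pos_of_nonneg (by linarith)
    (mul_nonneg (by linarith) (by linarith))
  have hν0 : 0 < ν := by linarith
  have hν1 : ν ≤ 1 := by
    rw [hν, div_le_one (by linarith)]
    have : 0 < δ * (δ / b) := by positivity
    linarith
  refine ⟨1 / y, 1 / ν, 1 / e, ?_, ?_, ?_, ?_, ?_, ?_, ?_⟩
  · rw [le_div_iff₀ hy0]; linarith
  · rw [le_div_iff₀ hν0]; linarith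
  · rw [lt_div_iff₀ he0]; linarith
  · rw [one_div_mul_eq_div, div_lt_one he0]; linarith
  · have : (b + δ) / q = (b + δ) * x := by rw [hx]; ring
    rw [this, div_div_eq_mul_div, div_one, mul_comm (1 - δ), hyd]; ring
  · rw [one_div_one_div, ← ha, mul_one_div, div_lt_one hν0]; exact hνβ
  · rw [one_div_one_div, div_div_eq_mul_div, div_one, mul_comm (1 - δ), hνd]
    have : (b + δ) * δ / b = δ + δ * (δ / b) := by field_simp
    rw [this]; ring

lemma ae_Ioo_of_step {Q : ℝ → Prop} {T : ℝ} (hT : 0 < T)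
    (hstep : ∀ S, 0 ≤ S → S < T → (∀ᵐ t ∂(volume.restrict (Ioo 0 S)), Q t) →
      ∀ᵐ t ∂(volume.restrict (Ioo 0 (S + (T - S) / 10))), Q t) :
    ∀ᵐ t ∂(volume.restrict (Ioo 0 T)), Q t := by
  have hk : ∀ k : ℕ, ∀ᵐ t ∂(volume.restrict (Ioo 0 (T * (1 - (9 / 10) ^ k)))), Q t := by
    intro k
    induction k with
    | zero => simp
    | succ k ih =>
      have h1 : (0:ℝ) < (9 / 10) ^ k := by positivity
      have h2 : ((9 / 10) ^ k : ℝ) ≤ 1 := pow_le_one₀ (by norm_num) (by norm_num)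
      have h3 := hstep _ (mul_nonneg hT.le (by linarith)) (by
        have := mul_pos hT h1
        linarith) ih
      have e : T * (1 - (9 / 10) ^ k) + (T - T * (1 - (9 / 10) ^ k)) / 10 =
        T * (1 - (9 / 10) ^ (k + 1)) := by ring
      rwa [e] at h3
  simp_rw [ae_restrict_iff' measurableSet_Ioo] at hk ⊢
  filter_upwards [ae_all_iff.2 hk] with t ht htT
  obtain ⟨k, hk'⟩ := exists_pow_lt_of_lt_one (show 0 < 1 - t / T by
    rw [sub_pos, div_lt_one hT]; exact htT.2) (show (9 / 10 : ℝ) < 1 by norm_num)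
  refine ht k ⟨htT.1, ?_⟩
  rw [← div_lt_iff₀' hT]; linarith

lemma duh_add {n : ℕ} {κ F G : ℝ → Rn n → ℝ≥0∞} (hκ : Measurable (Function.uncurry κ))
    (hF : Measurable (Function.uncurry F)) (t : ℝ) (x : Rn n) :
    duh κ (fun s y => F s y + G s y) t x = duh κ F t x + duh κ G t x := by
  have hm : Measurable (fun z : ℝ × Rn n => κ (t - z.1) (x - z.2) * F z.1 z.2) :=
    (hκ.comp (by fun_prop : Measurable fun z : ℝ × Rn n => (t - z.1, x - z.2))).mul hF
  unfold duh
  rw [← lintegral_add_left (Measurable.lintegral_prod_right' hm)]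
  refine lintegral_congr fun s => ?_
  have hs : Measurable (fun y => κ (t - s) (x - y) * F s y) :=
    hm.comp (measurable_prodMk_left (x := s))
  rw [← lintegral_add_left hs]
  simp_rw [mul_add]

lemma exists_ae_pair {P : Rn 1 → Prop} (h : ∀ᵐ x, P x) : ∃ x₁ x₂, x₁ ≠ x₂ ∧ P x₁ ∧ P x₂ := by
  obtain ⟨x₁, h1⟩ := h.exists
  have hne : ∀ᵐ x : Rn 1, x ≠ x₁ := by simp [ae_iff, measure_singleton]
  obtain ⟨x₂, h2, h3⟩ := (h.and hne).exists
  exact ⟨x₁, x₂, h3.symm, h1, h2⟩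

lemma exists_mem_Ioo_of_ae {P : ℝ → Prop} {a c T : ℝ} (ha : 0 ≤ a) (hac : a < c) (hcT : c ≤ T)
    (h : ∀ᵐ t ∂(volume.restrict (Ioo 0 T)), P t) : ∃ t ∈ Ioo a c, P t := by
  have h' := ae_restrict_of_ae_restrict_of_subset (Ioo_subset_Ioo ha hcT) h
  have : NeBot (ae (volume.restrict (Ioo a c))) := by
    rw [ae_neBot, Ne, Measure.restrict_eq_zero]
    simp [hac]
  obtain ⟨t, h1, h2⟩ := (h'.and (ae_restrict_mem measurableSet_Ioo)).exists
  exact ⟨t, h2, h1⟩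

/-- Uniqueness of small solutions below the local integrability threshold, in one dimension. -/
theorem IsStable.unique_of_lt {α : ℝ} {η : Measure ℝ} {b : ℕ} {q : ℝ} (h : IsStable α η)
    (hα : 1 / 2 < α) (hα1 : α ≤ 1) (hb : 1 ≤ b) (hbq : (b:ℝ) < q) (hqb : q ≤ b + 1) {δ : ℝ}
    (hδ : δ = 1 - 1 / (2 * α) - 1 / (2 * α) * (b / q)) (hδ0 : 0 < δ) (hδ1 : δ < 1 / 2) :
    ∃ R > 0, ∀ (T : ℝ) (l u v : ℝ → Rn 1 → ℝ), T ≤ 1 → Measurable (Function.uncurry u) →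
      Measurable (Function.uncurry v) →
      lnorm (volume.restrict (Ioo 0 T)) (b / δ) (fun t => lnorm volume q (fun x => ‖u t x‖ₑ)) ≤
        ENNReal.ofReal R →
      lnorm (volume.restrict (Ioo 0 T)) (b / δ) (fun t => lnorm volume q (fun x => ‖v t x‖ₑ)) ≤
        ENNReal.ofReal R →
      (∀ᵐ z ∂((volume.restrict (Ioo 0 T)).prod (volume : Measure (Rn 1))),
        duh (absKer (dMix 1 α η)) (fun s y => ‖|u s y| ^ b * u s y‖ₑ) z.1 z.2 ≠ ⊤ ∧
        u z.1 z.2 = l z.1 z.2 - sduh (dMix 1 α η) (fun s y => |u s y| ^ b * u s y) z.1 z.2) →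
      (∀ᵐ z ∂((volume.restrict (Ioo 0 T)).prod (volume : Measure (Rn 1))),
        duh (absKer (dMix 1 α η)) (fun s y => ‖|v s y| ^ b * v s y‖ₑ) z.1 z.2 ≠ ⊤ ∧
        v z.1 z.2 = l z.1 z.2 - sduh (dMix 1 α η) (fun s y => |v s y| ^ b * v s y) z.1 z.2) →
      ∀ᵐ z ∂((volume.restrict (Ioo 0 T)).prod (volume : Measure (Rn 1))), v z.1 z.2 = u z.1 z.2 := by
  have := h.prob
  have hα0 : 0 < α := by linarith
  have hb1 : (1:ℝ) ≤ b := by exact_mod_cast hb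
  have hb0 : (0:ℝ) < b := by linarith
  have hq0 : 0 < q := by linarith
  have hq1 : 1 ≤ q := by linarith
  obtain ⟨P, hP⟩ : ∃ P, P = b / δ := ⟨_, rfl⟩
  have hP0 : 0 < P := by rw [hP]; positivity
  have hP1 : 1 ≤ P := by rw [hP, le_div_iff₀ hδ0]; linarith
  obtain ⟨r, μ, m, hr, hμ, hm, hmδ, her, heμ, hem⟩ :=
    exists_gain_exponents hα hα1 hb1 hbq hqb hδ hδ0
  have hdm : ∀ j, Measurable (Function.uncurry (dMix 1 α η j)) := dMix_measurable 1 α η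
  have hkm := absKer_measurable hdm
  obtain ⟨ω, hω⟩ := h.exists_isKerWeight hα0 hα1
  obtain ⟨ε, hε, H⟩ := ae_eq_zero_of_le_mul_volterra hδ0 hm hmδ
  obtain ⟨r₀, hr₀⟩ : ∃ r₀, r₀ = q / (q - b) := ⟨_, rfl⟩
  have hqb0 : 0 < q - b := by linarith
  have hr₀1 : 1 ≤ r₀ := by rw [hr₀, le_div_iff₀ hqb0]; linarith
  have hr₀e : 1 / r₀ = 1 - b / q := by rw [hr₀, one_div_div, sub_div, div_self hq0.ne']
  obtain ⟨C₀, hC₀, hK₀⟩ := hω.lnorm_mul_duh_le hkm hr₀1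
  have hβ₀ : 1 / (2 * α) + 1 / (2 * α) * (1 - 1 / r₀) = 1 - δ := by rw [hr₀e, hδ]; ring
  rw [hβ₀] at hK₀
  obtain ⟨C₁, hC₁, hK₁⟩ := hω.lnorm_mul_duh_le hkm hr
  obtain ⟨β, hβ⟩ : ∃ β, β = 1 / (2 * α) + 1 / (2 * α) * (1 - 1 / r) := ⟨_, rfl⟩
  rw [← hβ] at hK₁ heμ
  obtain ⟨C', hC'⟩ : ∃ C', C' = 2 * ((b + 1) * C₀) := ⟨_, rfl⟩
  have hC'0 : 0 < C' := by rw [hC']; positivity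
  obtain ⟨R, hR0, hRε⟩ : ∃ R > 0, C' * (2 * R) ^ (b:ℝ) ≤ ε := by
    refine ⟨(ε / C') ^ (1 / (b:ℝ)) / 2, by positivity, le_of_eq ?_⟩
    rw [mul_div_cancel₀ _ two_ne_zero, ← Real.rpow_mul (by positivity), one_div_mul_cancel hb0.ne',
      Real.rpow_one, mul_div_cancel₀ _ hC'0.ne']
  refine ⟨R, hR0, fun T l u v hT1 hu hv huR hvR Hu Hv => ?_⟩
  rw [← hP] at huR hvR
  set U : ℝ → Rn 1 → ℝ≥0∞ := fun t x => max ‖u t x‖ₑ ‖v t x‖ₑ with hU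
  set w : ℝ → Rn 1 → ℝ≥0∞ := fun t x => ‖v t x - u t x‖ₑ with hw
  have hue : Measurable (Function.uncurry fun t x => ‖u t x‖ₑ) := hu.enorm
  have hve : Measurable (Function.uncurry fun t x => ‖v t x‖ₑ) := hv.enorm
  have hUm : Measurable (Function.uncurry U) := hue.max hve
  have hwm : Measurable (Function.uncurry w) := (hv.sub hu).enorm
  have hwU : ∀ t x, w t x ≤ 2 * U t x := fun t x => by
    rw [two_mul]
    exact enorm_sub_le.trans (add_le_add (le_max_right _ _) (le_max_left _ _))
  set M : ℝ → ℝ≥0∞ := fun t => lnorm volume q (U t) with hM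
  have hMm : Measurable M := lnorm_measurable q hUm
  have hum := lnorm_measurable (μ := (volume : Measure (Rn 1))) q hue
  have hvm := lnorm_measurable (μ := (volume : Measure (Rn 1))) q hve
  have hMR : lnorm (volume.restrict (Ioo 0 T)) P M ≤ ENNReal.ofReal (2 * R) := by
    refine (lnorm_mono hP0.le (Eventually.of_forall fun t => lnorm_max_le hq1
      hue.of_uncurry_left hve.of_uncurry_left)).trans ?_
    refine (lnorm_add_le hP1 hum.aemeasurable hvm.aemeasurable).trans ?_
    rw [two_mul, ENNReal.ofReal_add hR0.le hR0.le]
    exact add_le_add huR hvR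
  set N : ℝ → Rn 1 → ℝ≥0∞ := fun t x => U t x ^ (b:ℝ) * w t x with hN
  have hNm : Measurable (Function.uncurry N) := (hUm.pow_const (b:ℝ)).mul hwm
  have hNle : ∀ t x, N t x ≤ 2 * (‖|u t x| ^ b * u t x‖ₑ + ‖|v t x| ^ b * v t x‖ₑ) := by
    intro t x
    rw [enorm_abs_pow_mul, enorm_abs_pow_mul]
    refine (mul_le_mul_right (hwU t x) _).trans ?_
    rw [mul_left_comm]
    refine mul_le_mul_right ?_ _
    rcases le_total ‖u t x‖ₑ ‖v t x‖ₑ with h1 | h1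
    · simp only [hU, max_eq_right h1]; exact le_add_self
    · simp only [hU, max_eq_left h1]; exact le_self_add
  have hw_le : ∀ᵐ t ∂(volume.restrict (Ioo 0 T)), ∀ᵐ x,
      w t x ≤ ENNReal.ofReal (b + 1) * duh (absKer (dMix 1 α η)) N t x := by
    filter_upwards [Measure.ae_ae_of_ae_prod Hu, Measure.ae_ae_of_ae_prod Hv] with t h1 h2
    filter_upwards [h1, h2] with x hx hx'
    rw [← duh_const_mul ENNReal.ofReal_ne_top]
    exact enorm_sub_le_duh hdm hu hv hx.1 hx.2 hx'.1 hx'.2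
  have hNfin : ∀ᵐ t ∂(volume.restrict (Ioo 0 T)), ∀ᵐ x, duh (absKer (dMix 1 α η)) N t x ≠ ⊤ := by
    filter_upwards [Measure.ae_ae_of_ae_prod Hu, Measure.ae_ae_of_ae_prod Hv] with t h1 h2
    filter_upwards [h1, h2] with x hx hx'
    refine ne_top_of_le_ne_top ?_ (duh_mono hNle t x)
    rw [duh_const_mul (by norm_num), duh_add (F := fun s y => ‖|u s y| ^ b * u s y‖ₑ) hkm (abs_pow_mul_measurable b hu).enorm]
    exact ENNReal.mul_ne_top (by norm_num) (ENNReal.add_ne_top.2 ⟨hx.1, hx'.1⟩)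
  have hvu : MeasurableSet {z : ℝ × Rn 1 | v z.1 z.2 = u z.1 z.2} := measurableSet_eq_fun hv hu
  rw [Measure.ae_prod_iff_ae_ae hvu]
  rcases le_or_gt T 0 with hT | hT
  · simp [Ioo_eq_empty_of_le hT]
  refine ae_Ioo_of_step hT fun S hS hST hSu => ?_
  obtain ⟨t₀, ht₀⟩ : ∃ t₀, t₀ = S + (T - S) / 10 := ⟨_, rfl⟩
  rw [← ht₀]
  have ht₀T : t₀ ≤ T := by linarith
  have ht₀0 : 0 < t₀ := by linarith
  have hres : ∀ {p : ℝ → Prop}, (∀ᵐ t ∂(volume.restrict (Ioo 0 T)), p t) →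
      ∀ᵐ t ∂(volume.restrict (Ioo 0 t₀)), p t :=
    fun hp => ae_restrict_of_ae_restrict_of_subset (Ioo_subset_Ioo_right ht₀T) hp
  have hωm := hω.meas t₀
  set D : ℝ → ℝ≥0∞ := wMass (ω t₀) N with hD
  have hDm : Measurable D := wMass_measurable hωm hNm
  have hD1 : ∫⁻ t in Ioo 0 t₀, D t ≠ ⊤ := by
    obtain ⟨t₁, ht₁, hx⟩ := exists_mem_Ioo_of_ae (a := S + (T - S) / 2) (by linarith) (by linarith)
      le_rfl hNfin
    obtain ⟨x₁, x₂, hne, h1, h2⟩ := exists_ae_pair hx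
    have := ht₁.1
    have := ht₁.2
    refine hω.lintegral_wMass_ne_top hkm hNm (S := S) (t₁ := t₁) (by linarith) (by linarith)
      (by linarith) ?_ hne h1 h2
    filter_upwards [hSu] with t ht
    filter_upwards [ht] with x hx
    simp [hN, hw, hx]
  have hwt : ∀ {C β r : ℝ}, 1 ≤ r → (∀ (t₀ t : ℝ) (H : ℝ → Rn 1 → ℝ≥0∞),
      Measurable (Function.uncurry H) → t < t₀ → t ≤ 1 → lnorm volume r (fun x =>
        ω t₀ t x * duh (absKer (dMix 1 α η)) H t x) ≤ volt C β (wMass (ω t₀) H) t) →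
      ∀ᵐ t ∂(volume.restrict (Ioo 0 t₀)), lnorm volume r (fun x => ω t₀ t x * w t x) ≤
        ENNReal.ofReal (b + 1) * volt C β D t := by
    intro C β r hr hK
    filter_upwards [hres hw_le, ae_restrict_mem measurableSet_Ioo] with t ht htm
    refine le_trans ?_ (mul_le_mul_right (hK t₀ t N hNm htm.2 (by linarith [htm.2])) _)
    have hm1 : Measurable (fun x => ω t₀ t x * duh (absKer (dMix 1 α η)) N t x) :=
      hωm.of_uncurry_left.mul (duh_measurable hkm hNm).of_uncurry_left
    rw [← lnorm_const_mul (by linarith) _ hm1.aemeasurable]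
    refine lnorm_mono (by linarith) ?_
    filter_upwards [ht] with x hx
    exact (mul_le_mul_right hx _).trans (le_of_eq (mul_left_comm _ _ _))
  have hw₀ := hwt hr₀1 hK₀
  have hw₁ := hwt hr hK₁
  have hDle : ∀ {l r : ℝ}, 0 ≤ l → l < 1 → 0 < r → (b + l) / q + (1 - l) / r = 1 →
      ∀ᵐ t ∂(volume.restrict (Ioo 0 t₀)), D t ≤
        2 * (M t ^ (b + l) * lnorm volume r (fun x => ω t₀ t x * w t x) ^ (1 - l)) := by
    intro l r hl hl1 hr he
    filter_upwards [ae_restrict_mem measurableSet_Ioo] with t ht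
    exact lintegral_interp_le hb0 hl hl1 hq0 hr he hωm.of_uncurry_left hUm.of_uncurry_left
      hwm.of_uncurry_left (fun x => hω.le_one t₀ t x ht.2) (hwU t)
  have hMR' : lnorm (volume.restrict (Ioo 0 t₀)) P M ≤ ENNReal.ofReal (2 * R) :=
    (lnorm_mono_measure hP0.le (Measure.restrict_mono_set _ (Ioo_subset_Ioo_right ht₀T)) _).trans hMR
  have hDm' : ∫⁻ t in Ioo 0 t₀, D t ^ m ≠ ⊤ := by
    have hm0 : 0 < m := by linarith
    have hμ0 : 0 < μ := by linarith
    have hδ1' : 0 < 1 - δ := by linarith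
    obtain ⟨V, hV⟩ : ∃ V : ℝ → ℝ≥0∞, V = fun t => ENNReal.ofReal (b + 1) * volt C₁ β D t := ⟨_, rfl⟩
    have hvm := volt_measurable C₁ β hDm
    have hVm : Measurable V := by rw [hV]; exact hvm.const_mul _
    have hVμ : lnorm (volume.restrict (Ioo 0 t₀)) μ V ≠ ⊤ := by
      rw [hV, lnorm_const_mul hμ0 _ hvm.aemeasurable]
      refine ENNReal.mul_ne_top ENNReal.ofReal_ne_top (ne_top_of_le_ne_top ?_
        (lnorm_volt_le hDm hC₁.le hμ le_rfl hμ0 (by ring) heμ ht₀0))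
      exact ENNReal.mul_ne_top ENNReal.ofReal_ne_top (by rwa [lnorm_one])
    have hle : ∀ᵐ t ∂(volume.restrict (Ioo 0 t₀)), D t ≤ 2 * (M t ^ (b + δ) * V t ^ (1 - δ)) := by
      filter_upwards [hDle hδ0.le (by linarith) (by linarith) her, hw₁] with t h1 h2
      refine h1.trans (mul_le_mul_right (mul_le_mul_right (ENNReal.rpow_le_rpow ?_ hδ1'.le) _) _)
      rw [hV]; exact h2
    rw [← lnorm_rpow hm0]
    refine ENNReal.rpow_ne_top_of_nonneg hm0.le (ne_top_of_le_ne_top ?_ (lnorm_mono hm0.le hle))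
    have hm2 : Measurable (fun t => M t ^ (b + δ) * V t ^ (1 - δ)) :=
      (hMm.pow_const _).mul (hVm.pow_const _)
    have hp : 0 < P / (b + δ) := by positivity
    have hr' : 0 < μ / (1 - δ) := by positivity
    rw [lnorm_const_mul hm0 _ hm2.aemeasurable]
    refine ENNReal.mul_ne_top (by norm_num) (ne_top_of_le_ne_top ?_
      (lnorm_mul_le hm0 hp hr' ?_ (hMm.pow_const _).aemeasurable (hVm.pow_const _).aemeasurable))
    · rw [lnorm_pow hp (by linarith), lnorm_pow hr' hδ1', mul_div_cancel₀ _ (by linarith : b + δ ≠ 0),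
        mul_div_cancel₀ _ hδ1'.ne']
      exact ENNReal.mul_ne_top (ENNReal.rpow_ne_top_of_nonneg (by linarith)
        (ne_top_of_le_ne_top ENNReal.ofReal_ne_top hMR')) (ENNReal.rpow_ne_top_of_nonneg hδ1'.le hVμ)
    · rw [hem, one_div_div, one_div_div, hP, div_div_eq_mul_div]
  have hvolt : ∀ t, ENNReal.ofReal (b + 1) * volt C₀ (1 - δ) D t = ENNReal.ofReal ((b + 1) * C₀) *
      ∫⁻ s in Ioo 0 t, ENNReal.ofReal ((t - s) ^ (δ - 1)) * D s := by
    intro t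
    rw [ENNReal.ofReal_mul (by positivity), mul_assoc, volt]
    congr 1
    rw [← lintegral_const_mul' _ _ ENNReal.ofReal_ne_top]
    refine lintegral_congr fun s => ?_
    rw [ENNReal.ofReal_mul hC₀.le, neg_sub, mul_assoc]
  have hD0 : ∀ᵐ t ∂(volume.restrict (Ioo 0 t₀)), D t = 0 := by
    refine H 0 t₀ (fun t => ENNReal.ofReal C' * M t ^ (b:ℝ)) D ((hMm.pow_const _).const_mul _) hDm
      hDm' ?_ (lintegral_coeff_le hδ0 hb0 hC'0.le hε.le hMm (hP ▸ hMR') hRε)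
    filter_upwards [hDle (l := 0) (r := r₀) le_rfl one_pos (by linarith) (by
      rw [add_zero, sub_zero, hr₀e]; ring), hw₀] with t h1 h2
    rw [hvolt] at h2
    rw [add_zero, sub_zero, ENNReal.rpow_one] at h1
    refine h1.trans ((mul_le_mul_right (mul_le_mul_right h2 _) _).trans (le_of_eq ?_))
    rw [hC', ENNReal.ofReal_mul (by norm_num : (0:ℝ) ≤ 2), ENNReal.ofReal_ofNat]
    ring
  filter_upwards [hw₀, ae_restrict_mem measurableSet_Ioo] with t h1 ht
  have h2 : lnorm volume r₀ (fun x => ω t₀ t x * w t x) = 0 := by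
    refine le_antisymm (h1.trans (le_of_eq ?_)) bot_le
    rw [hvolt]
    have hm3 : Measurable (fun s => ENNReal.ofReal ((t - s) ^ (δ - 1)) * D s) :=
      Measurable.mul (by fun_prop) hDm
    rw [(lintegral_eq_zero_iff hm3).2, mul_zero]
    filter_upwards [ae_restrict_of_ae_restrict_of_subset (Ioo_subset_Ioo_right ht.2.le) hD0] with s hs
    simp [hs]
  have hm4 : Measurable (fun x => ω t₀ t x * w t x) :=
    hωm.of_uncurry_left.mul hwm.of_uncurry_left
  filter_upwards [lnorm_eq_zero (by linarith) hm4.aemeasurable h2] with x hx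
  have := (mul_eq_zero.1 hx).resolve_left (hω.ne_zero t₀ t x)
  simpa [hw, sub_eq_zero] using this

/-- Uniqueness of small solutions on time intervals of length at most one. -/
theorem IsStable.exists_unique_radius {n : ℕ} {α : ℝ} {η : Measure ℝ} {b : ℕ} {q : ℝ}
    (h : IsStable α η) (hn : 1 ≤ n) (hα : 1 / 2 < α) (hα1 : α ≤ 1) (hb : 1 ≤ b)
    (hq : (n:ℝ) * b / (2 * α - 1) < q) {δ : ℝ}
    (hδ : δ = 1 - 1 / (2 * α) - n / (2 * α) * (b / q)) (hδ0 : 0 < δ) (hδ1 : δ < 1 / 2) :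
    ∃ R > 0, ∀ (T : ℝ) (l u v : ℝ → Rn n → ℝ), T ≤ 1 → Measurable (Function.uncurry u) →
      Measurable (Function.uncurry v) →
      lnorm (volume.restrict (Ioo 0 T)) (b / δ) (fun t => lnorm volume q (fun x => ‖u t x‖ₑ)) ≤
        ENNReal.ofReal R →
      lnorm (volume.restrict (Ioo 0 T)) (b / δ) (fun t => lnorm volume q (fun x => ‖v t x‖ₑ)) ≤
        ENNReal.ofReal R →
      (∀ᵐ z ∂((volume.restrict (Ioo 0 T)).prod (volume : Measure (Rn n))),
        duh (absKer (dMix n α η)) (fun s y => ‖|u s y| ^ b * u s y‖ₑ) z.1 z.2 ≠ ⊤ ∧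
        u z.1 z.2 = l z.1 z.2 - sduh (dMix n α η) (fun s y => |u s y| ^ b * u s y) z.1 z.2) →
      (∀ᵐ z ∂((volume.restrict (Ioo 0 T)).prod (volume : Measure (Rn n))),
        duh (absKer (dMix n α η)) (fun s y => ‖|v s y| ^ b * v s y‖ₑ) z.1 z.2 ≠ ⊤ ∧
        v z.1 z.2 = l z.1 z.2 - sduh (dMix n α η) (fun s y => |v s y| ^ b * v s y) z.1 z.2) →
      ∀ᵐ z ∂((volume.restrict (Ioo 0 T)).prod (volume : Measure (Rn n))), v z.1 z.2 = u z.1 z.2 := by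
  have hb1 : (1:ℝ) ≤ b := by exact_mod_cast hb
  rcases le_total ((b:ℝ) + 1) q with hqb | hqb
  · obtain ⟨R, hR, H⟩ := h.unique_of_le hα hb hqb hδ hδ0 hδ1
    exact ⟨R, hR, fun T l u v _ => H T l u v⟩
  · have hnb : (n:ℝ) * b < q := by
      refine lt_of_le_of_lt ?_ hq
      rw [le_div_iff₀ (by linarith)]
      exact mul_le_of_le_one_right (by positivity) (by linarith)
    have hn1 : n = 1 := by
      by_contra hne
      have h2 : (2:ℝ) ≤ n := by exact_mod_cast (by omega : 2 ≤ n)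
      have := mul_le_mul_of_nonneg_right h2 (show (0:ℝ) ≤ b by linarith)
      linarith
    subst hn1
    rw [Nat.cast_one] at hδ hnb
    exact h.unique_of_lt hα hα1 hb (by linarith) hqb hδ hδ0 hδ1

/-- Local well-posedness (γ = 1) in `L^{p(·)}([0,T], L^q(ℝ^n))`. -/
theorem stmt3 (n b : ℕ) (hn : 1 ≤ n) (hb : 1 ≤ b) (α : ℝ) (hα : 1/2 < α ∧ α ≤ 1)
    (p : ℝ → ℝ) (hplog : IsPLog (Ici (0:ℝ)) p)
    (hpminus : ∃ pm : ℝ, (b:ℝ) + 1 < pm ∧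
      ∀ᵐ t ∂(volume.restrict (Ici (0:ℝ))), pm ≤ p t)
    (hpplus : ∃ M : ℝ, ∀ᵐ t ∂(volume.restrict (Ici (0:ℝ))), p t ≤ M)
    (q : ℝ) (hq1 : 1 < q) (hq : (n:ℝ) * b / (2 * α - 1) < q)
    (hq2 : ∀ᵐ t ∂(volume.restrict (Ici (0:ℝ))),
      (b:ℝ) / p t + 1 / (2 * α) + (n:ℝ) * b / (2 * α * q) < 1 ∧
      1 ≤ ((b:ℝ) + 1) / p t + 1 / (2 * α) + (n:ℝ) * b / (2 * α * q))
    (qb : Rn n → ℝ) (hqb : IsPembq n q qb)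
    (u₀ : Rn n → ℝ) (hu₀m : Measurable u₀) (hu₀ : luxNormR volume qb u₀ < ⊤)
    (f : ℝ → Rn n → ℝ) (hfm : Measurable (Function.uncurry f))
    (hf : ∫⁻ s in Ioi (0:ℝ), luxNormR volume qb (f s) < ⊤) :
    ∃ T > (0:ℝ), ∃ R > (0:ℝ), ∃ u : ℝ → Rn n → ℝ, Measurable (Function.uncurry u) ∧
      eNormT n p q T u ≤ ENNReal.ofReal R ∧
      IsMildSol1' n α b (Ioc 0 T) f u₀ u ∧
      ∀ v : ℝ → Rn n → ℝ, Measurable (Function.uncurry v) →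
        eNormT n p q T v ≤ ENNReal.ofReal R →
        IsMildSol1' n α b (Ioc 0 T) f u₀ v →
        ∀ᵐ tx : ℝ × Rn n ∂((volume.restrict (Ioc (0:ℝ) T)).prod volume),
          v tx.1 tx.2 = u tx.1 tx.2 := by
  obtain ⟨hα0, hα1⟩ := hα
  have hb1 : (1:ℝ) ≤ b := by exact_mod_cast hb
  have hn1 : (1:ℝ) ≤ n := by exact_mod_cast hn
  have hαp : 0 < α := by linarith
  have hq0 : 0 < q := by linarith
  obtain ⟨η, h⟩ := exists_isStable hαp hα1
  obtain ⟨δ, hδ⟩ : ∃ δ, δ = 1 - 1 / (2 * α) - n / (2 * α) * (b / q) := ⟨_, rfl⟩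
  have hδe : (n:ℝ) * b / (2 * α * q) = n / (2 * α) * (b / q) := by
    rw [div_mul_div_comm]
  have hδ0 : 0 < δ := by
    rw [div_lt_iff₀ (by linarith)] at hq
    have : δ = (q * (2 * α - 1) - n * b) / (2 * α * q) := by rw [hδ]; field_simp
    rw [this]
    exact div_pos (by linarith) (by positivity)
  have hδ1 : δ < 1 / 2 := by
    have h1 : 1 / 2 ≤ 1 / (2 * α) := one_div_le_one_div_of_le (by linarith) (by linarith)
    have h2 : 0 < n / (2 * α) * (b / q) := by positivity
    linarith
  obtain ⟨R₀, hR₀, huniq⟩ := h.exists_unique_radius hn hα0 hα1 hb hq hδ hδ0 hδ1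
  obtain ⟨C, hC, hemb⟩ := hqb.embedding hn hq1
  have hlux : ∀ g : Rn n → ℝ, luxNormR volume qb g = luxNorm volume qb (fun x => ‖g x‖ₑ) := by
    intro g
    simp only [luxNormR, Real.enorm_eq_ofReal_abs]
  have hu₀' : lnorm volume q (fun x => ‖u₀ x‖ₑ) ≠ ⊤ := by
    refine ne_top_of_le_ne_top (ENNReal.mul_ne_top hC ?_) (hemb _ hu₀m.enorm)
    rw [← hlux]; exact hu₀.ne
  have hf' : ∫⁻ s in Ioo (0:ℝ) 1, lnorm volume q (fun x => ‖f s x‖ₑ) ≠ ⊤ := by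
    refine ne_top_of_le_ne_top (ENNReal.mul_ne_top hC hf.ne) ?_
    rw [← lintegral_const_mul' _ _ hC]
    refine (lintegral_mono fun s => ?_).trans (lintegral_mono_set Ioo_subset_Ioi_self)
    rw [hlux]
    exact hemb _ (hfm.of_uncurry_left).enorm
  obtain ⟨T₀, hT₀, hT₀1, u, hum, ⟨M, hM, huM⟩, hu⟩ :=
    h.exists_solution hα0 hb hq1 (hδ ▸ hδ0) hu₀m hu₀' hfm hf'
  obtain ⟨Mp, hMp⟩ := hpplus
  have hres : ∀ (T : ℝ) {Q : ℝ → Prop}, (∀ᵐ t ∂(volume.restrict (Ici (0:ℝ))), Q t) →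
      ∀ᵐ t ∂(volume.restrict (Ioc 0 T)), Q t := fun T _ hQ =>
    ae_restrict_of_ae_restrict_of_subset (fun t ht => ht.1.le) hQ
  have hp1 : ∀ᵐ t ∂(volume.restrict (Ici (0:ℝ))), 1 ≤ p t := by
    filter_upwards [ae_restrict_mem measurableSet_Ici] with t ht using hplog.2.1 t ht
  have hpδ : ∀ᵐ t ∂(volume.restrict (Ici (0:ℝ))), b / δ ≤ p t := by
    filter_upwards [hp1, hq2] with t h1 h2
    rw [div_le_iff₀ hδ0, ← div_le_iff₀' (by linarith)]
    linarith [h2.1]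
  obtain ⟨T, hT, hTT₀, huT⟩ := exists_eNormT_le (p := p) (R := R₀ / 4) (P := max 0 Mp) hq0 hT₀
    (by positivity) ((hres T₀ hp1).mono fun t ht => by linarith)
    ((hres T₀ hMp).mono fun t ht => le_max_of_le_right ht) (le_max_left _ _) hM huM
  have huT' := ae_mono (prod_restrict_Ioo_le hTT₀) hu
  have hmild := h.isMildSol_of_ae hαp hu₀m hfm hum huT'
  have hsmall : ∀ v : ℝ → Rn n → ℝ, eNormT n p q T v ≤ ENNReal.ofReal (R₀ / 4) →
      lnorm (volume.restrict (Ioo 0 T)) (b / δ) (fun t => lnorm volume q (fun x => ‖v t x‖ₑ)) ≤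
        ENNReal.ofReal R₀ := by
    intro v hv
    have := lnorm_le_of_eNormT_le hq0 (hTT₀.trans hT₀1) (by positivity)
      (by rw [le_div_iff₀ hδ0]; linarith) (hres T hpδ) hv
    rwa [mul_div_cancel₀ _ four_ne_zero] at this
  refine ⟨T, hT, R₀ / 4, by positivity, u, hum, huT, hmild, fun v hvm hvT hv => ?_⟩
  exact ae_prod_restrict_Ioc_iff.2 (huniq T (linPart n α η u₀ f) u v (hTT₀.trans hT₀1) hum hvm
    (hsmall u huT) (hsmall v hvT) (h.ae_of_isMildSol hαp hum hmild) (h.ae_of_isMildSol hαp hvm hv))
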